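/- For every noncommutative reductive Lie algebra g: (i) codim_C C^sing ≥ 2; (ii) if g contains no simple ideal of type G_2 (i.e. every simple ideal has lacing number at most 2), then codim_C C^sing ≥ 3; (iii) if g is simply laced (every simple ideal is of type A, D or E, i.e. has lacing number 1), then codim_C C^sing ≥ 4. -/

import Mathlib

noncomputable section

namespace CV

variable (k : Type*) [Field k] (V : Type*) [AddCommGroup V] [Module k V] [FiniteDimensional k V]

/-- Coordinates with respect to a chosen basis of `V`. -/
def coordFn (z : V) (i : Module.Free.ChooseBasisIndex k V) : k :=
  (Module.Free.chooseBasis k V).repr z i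

/-- Evaluation of a polynomial (in the chosen coordinates) at a point of `V`. -/
def evalP (F : MvPolynomial (Module.Free.ChooseBasisIndex k V) k) (z : V) : k :=
  MvPolynomial.aeval (coordFn k V z) F

/-- The Zariski topology on `V`: generated by complements of zero sets of polynomial
functions. -/
def zar : TopologicalSpace V :=
  TopologicalSpace.generateFrom
    {U | ∃ F : MvPolynomial (Module.Free.ChooseBasisIndex k V) k, U = {z | evalP k V F z ≠ 0}}

/-- The dimension of a subset of `V`:  the Krull dimension for the topology induced by the
Zariski topology of `V`. -/
def dimSet (S : Set V) : WithBot ℕ∞ :=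
  @topologicalKrullDim S (TopologicalSpace.induced Subtype.val (zar k V))

/-- The differential at `z ∈ V` of a polynomial `F`, as a linear functional on `V`. -/
def diffAt (F : MvPolynomial (Module.Free.ChooseBasisIndex k V) k) (z : V) : V →ₗ[k] k :=
  (Module.Free.chooseBasis k V).constr k fun i => evalP k V (MvPolynomial.pderiv i F) z

/-- The Zariski tangent space at `z` of a subset `S ⊆ V`:  the common kernel of the
differentials at `z` of all polynomial functions vanishing identically on `S`. -/
def tangent (S : Set V) (z : V) : Submodule k V :=
  ⨅ F ∈ {F | ∀ w ∈ S, evalP k V F w = 0}, LinearMap.ker (diffAt k V F z)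

end CV

/-- The commuting variety `C = {(x,y) ∈ g × g | [x,y] = 0}`. -/
def commSet (k : Type*) (g : Type*) [Field k] [LieRing g] [LieAlgebra k g] : Set (g × g) :=
  {p | ⁅p.1, p.2⁆ = 0}

/-- The centralizer `g_x = {y ∈ g | [x,y] = 0}` of an element `x` of a Lie algebra,
as a submodule. -/
def cent (k : Type*) {g : Type*} [Field k] [LieRing g] [LieAlgebra k g] (x : g) :
    Submodule k g := LinearMap.ker (LieAlgebra.ad k g x)

/-- The lacing number ("lacety") of a Lie algebra with nondegenerate Killing form, relative
to a Cartan subalgebra `t`:  it is `1` if `rk g = 1`, and otherwise the maximum of the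
absolute values of the Cartan integers `⟨α, β∨⟩ = α (coroot β)` over pairs of
non-proportional roots `α`, `β`.  (For a simple Lie algebra this equals `1` in types
`A`, `D`, `E`, `2` in types `B`, `C`, `F₄`, and `3` in type `G₂`.) -/
def lacety (k : Type*) [Field k] [IsAlgClosed k] [CharZero k]
    (g : Type*) [LieRing g] [LieAlgebra k g] [FiniteDimensional k g]
    [LieAlgebra.IsKilling k g] (t : LieSubalgebra k g) [t.IsCartanSubalgebra] : ℕ :=
  if Module.finrank k ↥t = 1 then 1
  else sSup {n : ℕ | ∃ α β : LieModule.Weight k ↥t g, α.IsNonZero ∧ β.IsNonZero ∧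
    (∀ c : k, (α : ↥t → k) ≠ c • (β : ↥t → k)) ∧
    (α (LieAlgebra.IsKilling.coroot β) = (n : k) ∨ α (LieAlgebra.IsKilling.coroot β) = -(n : k))}

variable (k : Type*) [Field k] [IsAlgClosed k] [CharZero k]
variable (g : Type*) [LieRing g] [LieAlgebra k g] [FiniteDimensional k g]

/-- The singular locus of the commuting variety:  points `z` of `C` at which the Zariski
tangent space has dimension strictly greater than `dim C = dim g + rk g`. -/
def Csing (t : LieSubalgebra k g) : Set (g × g) :=
  {z ∈ commSet k g |
    Module.finrank k g + Module.finrank k ↥t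
      < Module.finrank k ↥(CV.tangent k (g × g) (commSet k g) z)}

set_option linter.unusedSectionVars false
set_option linter.deprecated false

namespace CVP

open LieAlgebra Module

section basic
variable {L : Type*} [Field L] {G : Type*} [LieRing G] [LieAlgebra L G] [FiniteDimensional L G]

lemma kinv (x y z : G) : killingForm L G ⁅x, y⁆ z = killingForm L G x ⁅y, z⁆ :=
  LieModule.traceForm_apply_lie_apply L G G x y z

lemma ksymm (x y : G) : killingForm L G x y = killingForm L G y x :=
  LieModule.traceForm_comm L G G x y

lemma knd [IsKilling L G] {x : G} (h : ∀ y, killingForm L G x y = 0) : x = 0 := by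
  have h2 := (LieAlgebra.IsKilling.ker_killingForm_eq_bot L G)
  have : x ∈ LinearMap.ker (killingForm L G) := by
    rw [LinearMap.mem_ker]; ext y; exact h y
  rw [h2] at this; simpa using this

lemma range_perp [IsKilling L G] {e v : G}
    (h : ∀ w, ⁅e, w⁆ = 0 → killingForm L G v w = 0) : ∃ u, ⁅e, u⁆ = v := by
  have hnd := LieAlgebra.IsKilling.killingForm_nondegenerate L G
  have hr : (killingForm L G).IsRefl := fun x y h => by rw [ksymm]; exact h
  have key := LinearMap.BilinForm.orthogonal_orthogonal hnd hr (LinearMap.range (ad L G e))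
  have : v ∈ LinearMap.range (ad L G e) := by
    rw [← key, LinearMap.BilinForm.mem_orthogonal_iff]
    intro n hn
    rw [LinearMap.BilinForm.mem_orthogonal_iff] at hn
    have : ⁅e, n⁆ = 0 := by
      apply knd (L := L)
      intro y
      have := hn ⁅e, y⁆ ⟨y, rfl⟩
      change killingForm L G ⁅e, y⁆ n = 0 at this
      rw [← lie_skew, map_neg, LinearMap.neg_apply, kinv, ksymm] at this
      simpa using this
    show killingForm L G n v = 0
    rw [ksymm]; exact h n this
  obtain ⟨u, hu⟩ := this
  exact ⟨u, hu⟩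

lemma ad_comm {x y : G} (h : ⁅x, y⁆ = 0) : Commute (ad L G x) (ad L G y) := by
  apply LinearMap.ext
  intro v
  show ⁅x, ⁅y, v⁆⁆ = ⁅y, ⁅x, v⁆⁆
  rw [leibniz_lie, h, zero_lie, zero_add]

lemma nil_comm {e z : G} (he : IsNilpotent (ad L G e)) (h : ⁅e, z⁆ = 0) :
    killingForm L G e z = 0 := by
  have h1 := (ad_comm (L := L) h).isNilpotent_mul_right he
  have h2 := LinearMap.isNilpotent_trace_of_isNilpotent h1
  exact h2.eq_zero

end basic

section ss
variable {L : Type*} [Field L] {V : Type*} [AddCommGroup V] [Module L V] [FiniteDimensional L V]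

lemma ss_ker {A : End L V} (hA : A.IsSemisimple) {v : V} (h : A (A v) = 0) : A v = 0 := by
  have h1 := (hA.isFinitelySemisimple).genEigenspace_eq_eigenspace 0 (k := 2) (by norm_num)
  have h2 : v ∈ A.genEigenspace 0 2 := by
    rw [show (2 : ℕ∞) = ((2 : ℕ) : ℕ∞) from rfl, Module.End.mem_genEigenspace_nat]
    simp [pow_two, h]
  rw [h1] at h2
  simpa using h2

lemma ss_isCompl {A : End L V} (hA : A.IsSemisimple) :
    IsCompl (LinearMap.ker A) (LinearMap.range A) := by
  have hd : Disjoint (LinearMap.ker A) (LinearMap.range A) := by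
    rw [Submodule.disjoint_def]
    rintro x hx ⟨y, rfl⟩
    exact ss_ker hA hx
  refine ⟨hd, ?_⟩
  rw [codisjoint_iff]
  apply Submodule.eq_top_of_disjoint _ _ _ hd
  have := LinearMap.finrank_range_add_finrank_ker A
  omega

/-- projection on the kernel along the range -/
def kproj {A : End L V} (hA : A.IsSemisimple) : End L V :=
  Submodule.projection _ _ (ss_isCompl hA)

lemma kproj_ker {A : End L V} (hA : A.IsSemisimple) (v : V) : A (kproj hA v) = 0 :=
  Submodule.IsCompl.projection_apply_mem (ss_isCompl hA) v

lemma kproj_of {A : End L V} (hA : A.IsSemisimple) {v : V} (h : A v = 0) : kproj hA v = v :=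
  Submodule.IsCompl.projection_apply_left (ss_isCompl hA) ⟨v, h⟩

lemma kproj_range {A : End L V} (hA : A.IsSemisimple) (v : V) : kproj hA (A v) = 0 :=
  (Submodule.IsCompl.projection_apply_eq_zero_iff (ss_isCompl hA)).2 ⟨v, rfl⟩

lemma kproj_sub {A : End L V} (hA : A.IsSemisimple) (v : V) : ∃ w, v = kproj hA v + A w := by
  have : kproj hA (v - kproj hA v) = 0 := by
    rw [map_sub, kproj_of hA (kproj_ker hA v), sub_self]
  obtain ⟨w, hw⟩ := (Submodule.IsCompl.projection_apply_eq_zero_iff (ss_isCompl hA)).1 this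
  exact ⟨w, by rw [hw]; abel⟩

/-- additive maps which commute with A (or just preserve kernel and range) commute with kproj -/
lemma kproj_comm {A : End L V} (hA : A.IsSemisimple) (D : V →+ V) (h : ∀ v, D (A v) = A (D v))
    (v : V) : kproj hA (D v) = D (kproj hA v) := by
  obtain ⟨w, hw⟩ := kproj_sub hA v
  have h1 : A (D (kproj hA v)) = 0 := by rw [← h, kproj_ker, map_zero]
  conv_lhs => rw [hw, map_add, map_add, h, kproj_range, kproj_of hA h1, add_zero]

/-- within an A-stable subspace -/
lemma ss_range_sub {A : End L V} (hA : A.IsSemisimple) {M : Submodule L V}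
    (hM : ∀ v ∈ M, A v ∈ M) {v : V} (hv : v ∈ M) : kproj hA v ∈ M ∧ ∃ w ∈ M, v = kproj hA v + A w := by
  have hB := hA.restrict (p := M) hM
  obtain ⟨w, hw⟩ := kproj_sub hB ⟨v, hv⟩
  have h1 : A (kproj hB ⟨v, hv⟩ : M) = 0 := congrArg Subtype.val (kproj_ker hB ⟨v, hv⟩)
  have hw' : v = (kproj hB ⟨v, hv⟩ : M) + A w := congrArg Subtype.val hw
  have h2 : kproj hA v = (kproj hB ⟨v, hv⟩ : M) := by
    conv_lhs => rw [hw', map_add, kproj_range, kproj_of hA h1, add_zero]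
  refine ⟨by rw [h2]; exact Subtype.property _, w, w.2, by rw [h2]; exact hw'⟩

end ss

section jc
variable {L : Type*} [Field L] [IsAlgClosed L] [CharZero L]
  {G : Type*} [LieRing G] [LieAlgebra L G] [FiniteDimensional L G]

lemma mem_top_of_iSup {V : Type*} [AddCommGroup V] [Module L V] {ι : Type*} {S : ι → Submodule L V}
    (h : ⨆ i, S i = ⊤) (M : Submodule L V) (hM : ∀ i, S i ≤ M) (v : V) : v ∈ M := by
  have : (⊤ : Submodule L V) ≤ M := h ▸ iSup_le hM
  exact this trivial

/-- Jordan decomposition. -/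
lemma jordan [IsKilling L G] (x : G) : ∃ s n : G, x = s + n ∧ (ad L G s).IsSemisimple ∧
    IsNilpotent (ad L G n) ∧ (∀ w : G, ⁅x, w⁆ = 0 → ⁅s, w⁆ = 0) ∧
    (∀ (w : G) (c : L), ⁅x, w⁆ = c • w → ⁅s, w⁆ = c • w) := by
  obtain ⟨ν, hν, σ, hσ, hnil, hss, hsum⟩ := (ad L G x).exists_isNilpotent_isSemisimple
  have hc : Commute ν σ := Algebra.commute_of_mem_adjoin_singleton_of_commute hσ
      (Algebra.commute_of_mem_adjoin_self hν).symm
  have hσx : Commute (ad L G x) σ := by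
    exact Algebra.commute_of_mem_adjoin_self hσ
  have hact : ∀ (c : L) (v : G), v ∈ (ad L G x).maxGenEigenspace c → σ v = c • v := by
    intro c v hv
    exact Module.End.apply_eq_of_mem_of_comm_of_isFinitelySemisimple_of_isNil hv hσx
      hss.isFinitelySemisimple (by rw [hsum]; simpa using hnil)
  have htop := Module.End.iSup_maxGenEigenspace_eq_top (ad L G x)
  have hder : ∀ u v : G, σ ⁅u, v⁆ = ⁅u, σ v⁆ - ⁅v, σ u⁆ := by
    intro u v
    let M1 : Submodule L G := LinearMap.ker
      (σ ∘ₗ ((LieModule.toEnd L G G : G →ₗ[L] End L G).flip v)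
        - (((LieModule.toEnd L G G : G →ₗ[L] End L G).flip (σ v))) +
          ad L G v ∘ₗ σ)
    have : u ∈ M1 := by
      refine mem_top_of_iSup htop M1 ?_ u
      intro c u hu
      let M2 : Submodule L G := LinearMap.ker
        (σ ∘ₗ (ad L G u) - (ad L G u) ∘ₗ σ +
          ((LieModule.toEnd L G G : G →ₗ[L] End L G).flip (σ u)))
      have : v ∈ M2 := by
        refine mem_top_of_iSup htop M2 ?_ v
        intro d v hv
        have h3 : ⁅u, v⁆ ∈ (ad L G x).maxGenEigenspace (c + d) :=
          LieModule.lie_mem_maxGenEigenspace_toEnd hu hv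
        have h4 := hact _ _ h3
        have h5 := hact _ _ hu
        have h6 := hact _ _ hv
        simp only [M2, LinearMap.mem_ker, LinearMap.add_apply, LinearMap.sub_apply,
          LinearMap.comp_apply, LinearMap.flip_apply, ad_apply, h4, h5, h6]
        simp only [LieHom.coe_toLinearMap, LieModule.toEnd_apply_apply, lie_smul]
        rw [← lie_skew u v]; module
      simp only [M2, LinearMap.mem_ker, LinearMap.add_apply, LinearMap.sub_apply,
          LinearMap.comp_apply, LinearMap.flip_apply, ad_apply, LieHom.coe_toLinearMap,
          LieModule.toEnd_apply_apply] at this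
      simp only [M1, LinearMap.mem_ker, LinearMap.add_apply, LinearMap.sub_apply,
          LinearMap.comp_apply, LinearMap.flip_apply, ad_apply, LieHom.coe_toLinearMap,
          LieModule.toEnd_apply_apply]
      rw [← this, ← lie_skew v (σ u)]
    simp only [M1, LinearMap.mem_ker, LinearMap.add_apply, LinearMap.sub_apply,
          LinearMap.comp_apply, LinearMap.flip_apply, ad_apply, LieHom.coe_toLinearMap,
          LieModule.toEnd_apply_apply] at this
    rw [← sub_eq_zero, ← this]; abel
  let Dσ : LieDerivation L G G := ⟨σ, hder⟩
  obtain ⟨s, hs⟩ := LieDerivation.IsKilling.exists_eq_ad Dσ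
  have hs' : ad L G s = σ := by
    ext v
    have := congrArg (fun D : LieDerivation L G G => D v) hs
    simp only [LieDerivation.ad_apply_apply] at this
    exact this
  have hn : ad L G (x - s) = ν := by rw [map_sub, hs', hsum]; abel
  refine ⟨s, x - s, by abel, hs' ▸ hss, hn ▸ hnil, ?_, ?_⟩
  · intro w hw
    have := hact 0 w ?_
    · rw [← hs'] at this; simpa using this
    · rw [Module.End.mem_maxGenEigenspace]; exact ⟨1, by simpa using hw⟩
  · intro w c hw
    have := hact c w ?_
    · rw [← hs'] at this; simpa using this
    · rw [Module.End.mem_maxGenEigenspace]; refine ⟨1, ?_⟩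
      simp [hw]
end jc
end CVP

namespace CVP

open LieAlgebra Module

section jac
variable {L : Type*} [Field L] [CharZero L] {V : Type*} [AddCommGroup V] [Module L V]

lemma pow_mul_sub {A B C : End L V} (hC : A * B - B * A = C) (hAC : Commute A C) (j : ℕ) :
    A ^ (j + 1) * B - B * A ^ (j + 1) = ((j + 1 : ℕ) : L) • (A ^ j * C) := by
  induction j with
  | zero => simp [hC]
  | succ j ih =>
    have h1 : A ^ (j + 2) * B - B * A ^ (j + 2) =
        A * (A ^ (j + 1) * B - B * A ^ (j + 1)) + (A * B - B * A) * A ^ (j + 1) := by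
      rw [pow_succ' A (j + 1)]; noncomm_ring
    rw [h1, ih, hC, ← (hAC.pow_left (j + 1)).eq, mul_smul_comm, ← mul_assoc, ← pow_succ']
    push_cast
    module

lemma jac_nil {A B C : End L V} (hC : A * B - B * A = C) (hAC : Commute A C)
    (hA : IsNilpotent A) : IsNilpotent C := by
  obtain ⟨N, hN⟩ := hA
  have key : ∀ j m : ℕ, A ^ j * C ^ m = 0 → ∃ M, C ^ M = 0 := by
    intro j
    induction j with
    | zero => intro m h; exact ⟨m, by simpa using h⟩
    | succ j ih =>
      intro m h
      apply ih (2 * m + 1)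
      have h2 := congrArg (fun X => C ^ m * X * C ^ m) (pow_mul_sub hC hAC j)
      have e1 : C ^ m * (A ^ (j + 1) * B - B * A ^ (j + 1)) * C ^ m = 0 := by
        have : C ^ m * A ^ (j + 1) = A ^ (j + 1) * C ^ m := ((hAC.pow_left _).pow_right _).eq.symm
        calc _ = (C ^ m * A ^ (j + 1)) * B * C ^ m - C ^ m * B * (A ^ (j + 1) * C ^ m) := by
              noncomm_ring
          _ = 0 := by rw [this, h]; simp
      have e2 : C ^ m * (((j + 1 : ℕ) : L) • (A ^ j * C)) * C ^ m
          = ((j + 1 : ℕ) : L) • (A ^ j * C ^ (2 * m + 1)) := by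
        rw [mul_smul_comm, smul_mul_assoc, ← mul_assoc, ← ((hAC.pow_left j).pow_right m).eq]
        congr 1
        rw [mul_assoc, mul_assoc, ← pow_succ', ← pow_add]; congr 2; ring
      simp only [e1, e2] at h2
      have : ((j + 1 : ℕ) : L) ≠ 0 := Nat.cast_ne_zero.2 (by omega)
      exact (smul_eq_zero.1 h2.symm).resolve_left this
  obtain ⟨M, hM⟩ := key N 0 (by simp [hN])
  exact ⟨M, hM⟩

lemma jac_mul_nil {A B C : End L V} (hC : A * B - B * A = C) (hAC : Commute A C)
    (hA : IsNilpotent A) : IsNilpotent (A * B) := by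
  obtain ⟨p, hp⟩ := jac_nil hC hAC hA
  obtain ⟨N, hN⟩ := hA
  have stab : ∀ (i : ℕ) (v : V), (A ^ (i + 1)) v = 0 →
      (A ^ (i + 1)) ((A * B) v) = 0 ∧ (A ^ i) ((A * B) v) = ((i + 1 : ℕ) : L) • C ((A ^ i) v) := by
    intro i v hv
    have h1 : ∀ j w, (A ^ j) ((A * B) w) = (A ^ (j + 1)) (B w) := by
      intro j w; rw [pow_succ]; rfl
    have h2 : ∀ j w, (A ^ (j + 1)) (B w) = B ((A ^ (j + 1)) w) + ((j + 1 : ℕ) : L) • C ((A ^ j) w) := by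
      intro j w
      have := congrArg (fun X : End L V => X w) (pow_mul_sub hC hAC j)
      rw [(hAC.pow_left j).eq] at this
      simp only [LinearMap.sub_apply, Module.End.mul_apply, LinearMap.smul_apply] at this
      rw [← this]; abel
    constructor
    · rw [h1, h2, hv, pow_succ' A (i + 1), Module.End.mul_apply, hv]; simp
    · rw [h1, h2, hv]; simp
  have it : ∀ (i n : ℕ) (v : V), (A ^ (i + 1)) v = 0 →
      (A ^ (i + 1)) (((A * B) ^ n) v) = 0 ∧
      (A ^ i) (((A * B) ^ n) v) = (((i + 1 : ℕ) : L) ^ n) • (C ^ n) ((A ^ i) v) := by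
    intro i n v hv
    induction n with
    | zero => simpa using hv
    | succ n ih =>
      rw [pow_succ' (A * B) n, Module.End.mul_apply]
      have := stab i _ ih.1
      refine ⟨this.1, ?_⟩
      rw [this.2, ih.2, map_smul, pow_succ' C, pow_succ, Module.End.mul_apply, smul_smul, mul_comm]
  have fin : ∀ i (v : V), (A ^ i) v = 0 → ((A * B) ^ (p * i)) v = 0 := by
    intro i
    induction i with
    | zero => intro v hv; simpa using hv
    | succ i ih =>
      intro v hv
      rw [mul_add, pow_add, Module.End.mul_apply, mul_one]
      apply ih
      rw [(it i p v hv).2, hp]; simp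
  refine ⟨p * N, ?_⟩
  ext v
  exact fin N v (by rw [hN]; rfl)
end jac

section jm
variable {L : Type*} [Field L]
  {G : Type*} [LieRing G] [LieAlgebra L G] [FiniteDimensional L G]

lemma range_perp' [IsKilling L G] {A A' : End L G} {v : G}
    (hA : ∀ x y, killingForm L G (A x) y = killingForm L G x (A' y))
    (h : ∀ w, A' w = 0 → killingForm L G v w = 0) : ∃ u, A u = v := by
  have hnd := LieAlgebra.IsKilling.killingForm_nondegenerate L G
  have hr : (killingForm L G).IsRefl := fun x y h => by rw [ksymm]; exact h
  have key := LinearMap.BilinForm.orthogonal_orthogonal hnd hr (LinearMap.range A)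
  have : v ∈ LinearMap.range A := by
    rw [← key, LinearMap.BilinForm.mem_orthogonal_iff]
    intro n hn
    rw [LinearMap.BilinForm.mem_orthogonal_iff] at hn
    have : A' n = 0 := by
      apply knd (L := L)
      intro y
      have := hn (A y) ⟨y, rfl⟩
      change killingForm L G (A y) n = 0 at this
      rwa [hA, ksymm] at this
    show killingForm L G n v = 0
    rw [ksymm]; exact h n this
  obtain ⟨u, hu⟩ := this
  exact ⟨u, hu⟩

lemma kinv' (x y z : G) : killingForm L G ⁅x, y⁆ z = - killingForm L G y ⁅x, z⁆ := by
  rw [← lie_skew, map_neg, LinearMap.neg_apply, kinv]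

variable [CharZero L] [IsKilling L G]

lemma kappa_ee {e w : G} (he : IsNilpotent (ad L G e)) (h : ⁅e, ⁅e, w⁆⁆ = 0) :
    killingForm L G e w = 0 := by
  have hc : ad L G e * ad L G w - ad L G w * ad L G e = ad L G ⁅e, w⁆ := by
    apply LinearMap.ext; intro v
    show ⁅e, ⁅w, v⁆⁆ - ⁅w, ⁅e, v⁆⁆ = ⁅⁅e, w⁆, v⁆
    rw [lie_lie]
  have h2 := LinearMap.isNilpotent_trace_of_isNilpotent (jac_mul_nil hc (ad_comm h) he)
  exact h2.eq_zero

/-- `e = [e,[e,u]]`. -/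
lemma e_mem {e : G} (he : IsNilpotent (ad L G e)) : ∃ u, ⁅e, ⁅e, u⁆⁆ = e := by
  refine range_perp' (A := ad L G e * ad L G e) (A' := ad L G e * ad L G e) ?_ ?_
  · intro x y
    show killingForm L G ⁅e, ⁅e, x⁆⁆ y = killingForm L G x ⁅e, ⁅e, y⁆⁆
    rw [kinv', kinv', neg_neg]
  · intro w hw; exact kappa_ee he hw

/-- the basic identity -/
lemma eh_id {e h u : G} (heu : ⁅e, u⁆ = h) (hhe : ⁅h, e⁆ = (2 : L) • e) (i : ℕ) (w : G) :
    ((ad L G e) ^ (i + 1)) ⁅u, w⁆ - ⁅u, ((ad L G e) ^ (i + 1)) w⁆ =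
      ((i + 1 : ℕ) : L) • (⁅h, ((ad L G e) ^ i) w⁆ - (i : L) • ((ad L G e) ^ i) w) := by
  have hsw : ∀ (j : ℕ) (w : G), ((ad L G e) ^ j) ⁅h, w⁆ = ⁅h, ((ad L G e) ^ j) w⁆
      - (2 * j : L) • ((ad L G e) ^ j) w := by
    intro j
    induction j with
    | zero => intro w; simp
    | succ j ih =>
      intro w
      rw [pow_succ, Module.End.mul_apply, Module.End.mul_apply]
      have : (ad L G e) ⁅h, w⁆ = ⁅h, (ad L G e) w⁆ - (2 : L) • (ad L G e) w := by
        show ⁅e, ⁅h, w⁆⁆ = ⁅h, ⁅e, w⁆⁆ - (2 : L) • ⁅e, w⁆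
        rw [leibniz_lie h e w, hhe, smul_lie]; abel
      rw [this, map_sub, map_smul, ih]
      push_cast; module
  induction i with
  | zero =>
    simp only [zero_add, pow_one, pow_zero, Module.End.one_apply, ad_apply]
    rw [leibniz_lie e u w, heu]; simp
  | succ i ih =>
    have h1 : ((ad L G e) ^ (i + 2)) ⁅u, w⁆ = (ad L G e) (((ad L G e) ^ (i + 1)) ⁅u, w⁆) := by
      rw [pow_succ' _ (i + 1)]; rfl
    have h2 : ((ad L G e) ^ (i + 2)) w = (ad L G e) (((ad L G e) ^ (i + 1)) w) := by
      rw [pow_succ' _ (i + 1)]; rfl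
    have h3 : ((ad L G e) ^ (i + 1)) w = (ad L G e) (((ad L G e) ^ i) w) := by
      rw [pow_succ' _ i]; rfl
    rw [sub_eq_iff_eq_add] at ih
    set z := ((ad L G e) ^ (i + 1)) w with hz
    rw [h1, h2, ih, map_add, map_smul, map_sub, map_smul, ← h3]
    have h4 : (ad L G e) ⁅u, z⁆ = ⁅h, z⁆ + ⁅u, (ad L G e) z⁆ := by
      show ⁅e, ⁅u, z⁆⁆ = _
      rw [leibniz_lie e u z, heu]; rfl
    have h5 : (ad L G e) ⁅h, ((ad L G e) ^ i) w⁆ = ⁅h, z⁆ - (2 : L) • z := by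
      have := hsw 1 (((ad L G e) ^ i) w)
      simp only [pow_one, ← h3] at this
      rw [this]; simp
    rw [h4, h5]
    push_cast; module

/-- for v in ker e ∩ im e^i  -/
lemma ker_e_step {e h u : G} (heu : ⁅e, u⁆ = h) (hhe : ⁅h, e⁆ = (2 : L) • e) (i : ℕ) {v : G}
    (hv : ⁅e, v⁆ = 0) (hi : ∃ w, ((ad L G e) ^ i) w = v) :
    ∃ w, ((ad L G e) ^ (i + 1)) w = ⁅h, v⁆ - (i : L) • v := by
  obtain ⟨w, hw⟩ := hi
  have := eh_id heu hhe i w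
  have h2 : ((ad L G e) ^ (i + 1)) w = 0 := by
    rw [pow_succ', Module.End.mul_apply, hw]; exact hv
  rw [h2, hw, lie_zero, sub_zero] at this
  refine ⟨((i + 1 : ℕ) : L)⁻¹ • ⁅u, w⁆, ?_⟩
  rw [map_smul, this, smul_smul, inv_mul_cancel₀, one_smul]
  exact Nat.cast_ne_zero.2 (by omega)

/-- ker e ∩ ker h ∩ im e = 0 -/
lemma ker_e_h_im {e h u : G} (he : IsNilpotent (ad L G e)) (heu : ⁅e, u⁆ = h)
    (hhe : ⁅h, e⁆ = (2 : L) • e) {v : G}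
    (hv : ⁅e, v⁆ = 0) (hhv : ⁅h, v⁆ = 0) (hi : ∃ w, ⁅e, w⁆ = v) : v = 0 := by
  obtain ⟨N, hN⟩ := he
  have key : ∀ i, ∃ w, ((ad L G e) ^ (i + 1)) w = v := by
    intro i
    induction i with
    | zero => simpa using hi
    | succ i ih =>
      obtain ⟨w, hw⟩ := ker_e_step heu hhe (i + 1) hv ih
      rw [hhv, zero_sub, ← neg_smul] at hw
      refine ⟨(-((i + 1 : ℕ) : L))⁻¹ • w, ?_⟩
      rw [map_smul, hw, smul_smul, inv_mul_cancel₀, one_smul]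
      exact neg_ne_zero.2 (Nat.cast_ne_zero.2 (by omega))
  obtain ⟨w, hw⟩ := key N
  rw [← hw, pow_succ, hN]; simp

/-- a polynomial with natural roots, squarefree, kills h on ker e. -/
lemma ker_e_poly {e h u : G} (he : IsNilpotent (ad L G e)) (heu : ⁅e, u⁆ = h)
    (hhe : ⁅h, e⁆ = (2 : L) • e) : ∃ N : ℕ, ∀ v : G, ⁅e, v⁆ = 0 →
      Polynomial.aeval (ad L G h)
        (∏ i ∈ Finset.range N, (Polynomial.X - Polynomial.C (i : L))) v = 0 := by
  obtain ⟨N, hN⟩ := he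
  refine ⟨N, ?_⟩
  have key : ∀ (i : ℕ) (v : G), ⁅e, v⁆ = 0 →
      ⁅e, Polynomial.aeval (ad L G h)
        (∏ i ∈ Finset.range i, (Polynomial.X - Polynomial.C (i : L))) v⁆ = 0 ∧
      ∃ w, ((ad L G e) ^ i) w = Polynomial.aeval (ad L G h)
        (∏ i ∈ Finset.range i, (Polynomial.X - Polynomial.C (i : L))) v := by
    intro i v hv
    induction i with
    | zero => simpa using hv
    | succ i ih =>
      rw [Finset.prod_range_succ, mul_comm, map_mul, Module.End.mul_apply]
      set z := Polynomial.aeval (ad L G h)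
        (∏ i ∈ Finset.range i, (Polynomial.X - Polynomial.C (i : L))) v
      have hz : (Polynomial.aeval (ad L G h) (Polynomial.X - Polynomial.C (i : L))) z
          = ⁅h, z⁆ - (i : L) • z := by
        simp [Module.algebraMap_end_apply, Nat.cast_smul_eq_nsmul]
      rw [hz]
      refine ⟨?_, ker_e_step heu hhe i ih.1 ih.2⟩
      rw [lie_sub, lie_smul, ih.1, leibniz_lie e h z, ← lie_skew e h, hhe, ih.1]
      simp [ih.1]
  intro v hv
  obtain ⟨w, hw⟩ := (key N v hv).2
  rw [← hw, hN]; rfl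

end jm
end CVP

namespace CVP
open Module

section comb
variable {ι L M N : Type*} [Fintype ι] [Field L] [CharZero L] [AddCommGroup M] [Module L M]
  [AddCommGroup N] [Module L N] (P : RootPairing ι L M N) [P.IsCrystallographic] [P.IsReduced]

lemma exists_ratpart : ∃ π : L →+ ℚ, ∀ n : ℕ, π n = n := by
  have hinj : LinearMap.ker (Algebra.linearMap ℚ L) = ⊥ := by
    rw [LinearMap.ker_eq_bot]; exact (algebraMap ℚ L).injective
  obtain ⟨π, hπ⟩ := LinearMap.exists_leftInverse_of_injective (Algebra.linearMap ℚ L) hinj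
  refine ⟨π.toAddMonoidHom, fun n => ?_⟩
  have := LinearMap.congr_fun hπ (n : ℚ)
  simpa using this

/-- Pairwise obtuse roots of positive degree are linearly independent. -/
lemma obtuse_li {κ : Type*} [Finite κ] (v : κ → ι) (d : M →ₗ[L] L) (n : κ → ℕ)
    (hn : ∀ i, 0 < n i) (hd : ∀ i, d (P.root (v i)) = n i)
    (hp : Pairwise fun i j => P.pairingIn ℤ (v i) (v j) ≤ 0) :
    LinearIndependent L (fun i => P.root (v i)) := by
  classical
  have : Fintype κ := Fintype.ofFinite κ
  let _i : Module ℚ M := Module.compHom M (algebraMap ℚ L)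
  let _i : Module ℚ N := Module.compHom N (algebraMap ℚ L)
  have : IsScalarTower ℚ L M := IsScalarTower.of_algebraMap_smul fun _ _ => rfl
  have : IsScalarTower ℚ L N := IsScalarTower.of_algebraMap_smul fun _ _ => rfl
  obtain ⟨π, hπ⟩ := exists_ratpart (L := L)
  let M₀ := Submodule.span ℚ (Set.range P.root)
  let w (i : κ) : M₀ := P.rootSpanMem ℚ (v i)
  let f : Dual ℚ M₀ := (π.comp d.toAddMonoidHom).toRatLinearMap ∘ₗ M₀.subtype
  have hB : (P.posRootForm ℚ).posForm.toQuadraticMap.PosDef := by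
    simpa using P.posRootForm_rootFormIn_posDef ℚ
  have hf : ∀ i, 0 < f (w i) := by
    intro i
    have : f (w i) = π (d (P.root (v i))) := rfl
    rw [this, hd, hπ]; exact_mod_cast hn i
  have hn : Pairwise fun i j ↦ (P.posRootForm ℚ).posForm (w i) (w j) ≤ 0 := by
    intro i j hij
    rw [(P.posRootForm ℚ).posForm_apply_root_root_le_zero_iff, ← P.algebraMap_pairingIn' ℚ ℤ]
    simpa using hp hij
  have hli := LinearMap.BilinForm.linearIndependent_of_pairwise_le_zero
    (P.posRootForm ℚ).posForm hB f w hf hn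
  let A : Matrix κ κ ℚ := fun i j => (P.posRootForm ℚ).posForm (w i) (w j)
  have hA : A.det ≠ 0 := by
    intro h0
    obtain ⟨c, hc0, hc⟩ := Matrix.exists_mulVec_eq_zero_iff.2 h0
    apply hc0
    have h1 : ∀ i, (P.posRootForm ℚ).posForm (w i) (∑ j, c j • w j) = 0 := by
      intro i
      have := congrFun hc i
      rw [map_sum]
      simpa [Matrix.mulVec, dotProduct, A, mul_comm] using this
    have h2 : (P.posRootForm ℚ).posForm (∑ j, c j • w j) (∑ j, c j • w j) = 0 := by
      have : ∀ z, (∀ i, (P.posRootForm ℚ).posForm (w i) z = 0) →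
          (P.posRootForm ℚ).posForm (∑ j, c j • w j) z = 0 := by
        intro z hz
        rw [map_sum, LinearMap.sum_apply]
        exact Finset.sum_eq_zero fun i _ => by rw [map_smul, LinearMap.smul_apply, hz]; simp
      exact this _ h1
    have h3 : ∑ j, c j • w j = 0 := by
      by_contra h
      have := hB _ h
      exact this.ne' h2
    funext j
    exact Fintype.linearIndependent_iff.1 hli c h3 j
  rw [Fintype.linearIndependent_iff]
  intro c hc
  have h1 : Matrix.vecMul c (A.map (algebraMap ℚ L)) = 0 := by
    funext j
    have := congrArg (fun x => (P.posRootForm ℚ).form x (P.root (v j))) hc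
    simp only [map_sum, map_smul, LinearMap.sum_apply, LinearMap.smul_apply, map_zero,
      LinearMap.zero_apply] at this
    have h2 : ∀ i, (algebraMap ℚ L) (A i j) = (P.posRootForm ℚ).form (P.root (v i)) (P.root (v j)) :=
      fun i => (P.posRootForm ℚ).algebraMap_posForm
    simp only [Matrix.vecMul, dotProduct, Matrix.map_apply, h2, Pi.zero_apply]
    exact this
  have h2 : (A.map (algebraMap ℚ L)).det ≠ 0 := by
    have : (A.map (algebraMap ℚ L)) = (algebraMap ℚ L).mapMatrix A := rfl
    rw [this, ← RingHom.map_det]; simpa using hA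
  have := Matrix.eq_zero_of_vecMul_eq_zero h2 h1
  exact fun i => congrFun this i

variable {P}

lemma root_prop {i j : ι} {c : L} (h : P.root i = c • P.root j) :
    P.root i = P.root j ∨ P.root i = - P.root j := by
  apply RootPairing.IsReduced.eq_or_eq_neg
  intro hl
  have := (LinearIndependent.pair_iff.1 hl) 1 (-c) (by rw [h]; module)
  exact one_ne_zero this.1

lemma pcast (i j : ι) : P.pairing i j = ((P.pairingIn ℤ i j : ℤ) : L) := by
  rw [← P.algebraMap_pairingIn ℤ]; rfl

lemma pq (m i : ι) : P.coroot' m (P.root i) = ((P.pairingIn ℤ i m : ℤ) : L) := by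
  rw [← pcast]; exact P.root_coroot'_eq_pairing m i

lemma pself (i : ι) : P.pairingIn ℤ i i = 2 := by
  have := pcast (P := P) i i
  rw [P.pairing_same] at this
  exact_mod_cast this.symm

lemma pdiff {i j : ι} (h : 0 < P.pairingIn ℤ i j) (hne : i ≠ j) :
    ∃ m, P.root m = P.root i - P.root j := by
  have := P.root_sub_root_mem_of_pairingIn_pos h hne
  exact this

lemma psign (i j : ι) : (P.pairingIn ℤ i j, P.pairingIn ℤ j i) ∈
      ({(0, 0), (1, 1), (-1, -1), (1, 2), (2, 1), (-1, -2), (-2, -1), (1, 3), (3, 1), (-1, -3),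
        (-3, -1), (2, 2), (-2, -2)} : Set (ℤ × ℤ)) :=
  P.pairingIn_pairingIn_mem_set_of_isCrystal_of_isRed i j


lemma psgn {i j : ι} (h : P.pairingIn ℤ i j ≤ 0) : P.pairingIn ℤ j i ≤ 0 := by
  have := psign (P := P) i j
  simp only [Set.mem_insert_iff, Prod.mk.injEq, Set.mem_singleton_iff] at this
  omega

lemma pzero {i j : ι} (h : P.pairingIn ℤ i j = 0) : P.pairingIn ℤ j i = 0 := by
  have := psign (P := P) i j
  simp only [Set.mem_insert_iff, Prod.mk.injEq, Set.mem_singleton_iff] at this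
  omega

variable (P) in
/-- bound on the Cartan integers -/
def PB (c : ℤ) : Prop := ∀ i j, P.root i ≠ P.root j → P.root i ≠ - P.root j →
  |P.pairingIn ℤ i j| ≤ c

lemma psym (h : PB P 1) (i j : ι) : P.pairingIn ℤ i j = P.pairingIn ℤ j i := by
  have := psign (P := P) i j
  simp only [Set.mem_insert_iff, Prod.mk.injEq, Set.mem_singleton_iff] at this
  by_cases h1 : P.root i = P.root j
  · rw [P.root.injective h1]
  by_cases h2 : P.root i = - P.root j
  · have a := pq (P := P) j i
    have b := pq (P := P) i j
    have h3 : P.root j = - P.root i := by rw [h2, neg_neg]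
    rw [h2, map_neg, pq, pself] at a
    rw [h3, map_neg, pq, pself] at b
    have : ((P.pairingIn ℤ i j : ℤ) : L) = ((P.pairingIn ℤ j i : ℤ) : L) := by rw [← a, ← b]
    exact_mod_cast this
  · have a := abs_le.1 (h i j h1 h2)
    have b := abs_le.1 (h j i (fun h => h1 h.symm) (fun h => h2 (by rw [h, neg_neg])))
    omega

variable (P) (U : Submodule L M) (d : M →ₗ[L] L)

open Classical in
def Phi (j : ℕ) : Finset ι := Finset.univ.filter fun i => P.root i ∈ U ∧ d (P.root i) = (j : L)

variable {P U d}

lemma mPhi {j : ℕ} {i : ι} : i ∈ Phi P U d j ↔ P.root i ∈ U ∧ d (P.root i) = (j : L) := by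
  classical
  simp [Phi]

lemma Phi_sub {a b c : ℕ} (hab : a = b + c) {i j m : ι} (hi : i ∈ Phi P U d a)
    (hj : j ∈ Phi P U d b) (h : P.root m = P.root i - P.root j) : m ∈ Phi P U d c := by
  rw [mPhi] at *
  rw [h]
  exact ⟨U.sub_mem hi.1 hj.1, by rw [map_sub, hi.2, hj.2, hab]; push_cast; ring⟩

lemma Phi_neg0 {i m : ι} (hi : i ∈ Phi P U d 0) (h : P.root m = - P.root i) :
    m ∈ Phi P U d 0 := by
  rw [mPhi] at *
  rw [h]
  exact ⟨U.neg_mem hi.1, by rw [map_neg, hi.2]; simp⟩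

lemma ob_card [FiniteDimensional L M] (s : Finset ι) (hU : ∀ i ∈ s, P.root i ∈ U)
    (hd : ∀ i ∈ s, ∃ n : ℕ, 0 < n ∧ d (P.root i) = n)
    (hp : ∀ i ∈ s, ∀ j ∈ s, i ≠ j → P.pairingIn ℤ i j ≤ 0) : s.card ≤ finrank L U := by
  choose n hn using hd
  have := obtuse_li P (fun i : s => (i : ι)) d (fun i => n i i.2) (fun i => (hn i i.2).1)
    (fun i => (hn i i.2).2) (fun i j hij => hp i i.2 j j.2 (fun h => hij (Subtype.ext h)))
  have h2 := finrank_span_eq_card this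
  rw [Fintype.card_coe] at h2
  rw [← h2]
  apply Submodule.finrank_mono
  rw [Submodule.span_le]
  rintro _ ⟨i, rfl⟩
  exact hU i i.2

lemma ne_of_deg {a b : ℕ} (hab : a ≠ b) {i j : ι} (hi : i ∈ Phi P U d a) (hj : j ∈ Phi P U d b) :
    i ≠ j := by
  rintro rfl
  have := (mPhi.1 hi).2.symm.trans (mPhi.1 hj).2
  exact hab (by exact_mod_cast this)

lemma nonprop {a b : ℕ} (hab : a ≠ b) {i j : ι} (hi : i ∈ Phi P U d a) (hj : j ∈ Phi P U d b) :
    P.root i ≠ P.root j ∧ P.root i ≠ - P.root j := by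
  refine ⟨fun h => ne_of_deg hab hi hj (P.root.injective h), fun h => ?_⟩
  have := congrArg d h
  rw [map_neg, (mPhi.1 hi).2, (mPhi.1 hj).2] at this
  have : ((a + b : ℕ) : L) = 0 := by push_cast; rw [this]; ring
  have := Nat.cast_eq_zero.1 this
  omega

/-- no roots of degree zero: same degree implies obtuse -/
lemma obt_same (h0 : Phi P U d 0 = ∅) {a : ℕ} {i j : ι} (hi : i ∈ Phi P U d a)
    (hj : j ∈ Phi P U d a) (hij : i ≠ j) : P.pairingIn ℤ i j ≤ 0 := by
  by_contra h
  obtain ⟨m, hm⟩ := pdiff (not_le.1 h) hij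
  have := Phi_sub (by simp) hi hj hm (c := 0)
  simp [h0] at this

lemma decomp {a : ℕ} (ha : 0 < a) {i j : ι} (hi : i ∈ Phi P U d (a + 1))
    (hj : j ∈ Phi P U d 1) (h : 0 < P.pairingIn ℤ i j) :
    ∃ m ∈ Phi P U d a, m ≠ j ∧ P.root i = P.root j + P.root m := by
  obtain ⟨m, hm⟩ := pdiff h (ne_of_deg (by omega) hi hj)
  refine ⟨m, Phi_sub (by omega) hi hj hm, ?_, by rw [hm]; abel⟩
  rintro rfl
  have h2 : P.root i = (2 : L) • P.root m := by rw [two_smul]; exact eq_add_of_sub_eq hm.symm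
  rcases root_prop h2 with h | h
  · exact (nonprop (by omega) hi hj).1 h
  · exact (nonprop (by omega) hi hj).2 h

open Classical in
/-- indecomposable ones -/
def Ind (P : RootPairing ι L M N) [P.IsCrystallographic] (U : Submodule L M) (d : M →ₗ[L] L) :
    Finset ι := (Phi P U d 2).filter fun i => ∀ j ∈ Phi P U d 1, P.pairingIn ℤ i j ≤ 0

open Classical in
lemma ind_card [FiniteDimensional L M] (h0 : Phi P U d 0 = ∅) :
    (Phi P U d 1).card + (Ind P U d).card ≤ finrank L U := by
  have hd : Disjoint (Phi P U d 1) (Ind P U d) := by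
    rw [Finset.disjoint_left]
    intro i hi hj
    exact ne_of_deg (by omega) hi (Finset.mem_filter.1 hj).1 rfl
  rw [← Finset.card_union_of_disjoint hd]
  have hm : ∀ i ∈ Phi P U d 1 ∪ Ind P U d, i ∈ Phi P U d 1 ∨ i ∈ Phi P U d 2 := by
    intro i hi
    rcases Finset.mem_union.1 hi with h | h
    · exact Or.inl h
    · exact Or.inr (Finset.mem_filter.1 h).1
  refine ob_card (P := P) (d := d) _ (fun i hi => ?_) (fun i hi => ?_) (fun i hi j hj hij => ?_)
  · rcases hm i hi with h | h <;> exact (mPhi.1 h).1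
  · rcases hm i hi with h | h
    · exact ⟨1, by simp, (mPhi.1 h).2⟩
    · exact ⟨2, by simp, (mPhi.1 h).2⟩
  · rcases Finset.mem_union.1 hi with h | h <;> rcases Finset.mem_union.1 hj with h' | h'
    · exact obt_same h0 h h' hij
    · exact psgn ((Finset.mem_filter.1 h').2 i h)
    · exact (Finset.mem_filter.1 h).2 j h'
    · exact obt_same h0 (Finset.mem_filter.1 h).1 (Finset.mem_filter.1 h').1 hij

lemma not_ind {i : ι} (hi : i ∈ Phi P U d 2) (h : i ∉ Ind P U d) :
    ∃ j ∈ Phi P U d 1, ∃ m ∈ Phi P U d 1, m ≠ j ∧ P.root i = P.root j + P.root m := by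
  classical
  simp only [Ind, Finset.mem_filter, not_and, not_forall, not_le] at h
  obtain ⟨j, hj, hp⟩ := h hi
  obtain ⟨m, hm, hmj, hr⟩ := decomp (by omega) hi hj hp
  exact ⟨j, hj, m, hm, hmj, hr⟩

lemma sum_edge (hb : PB P 1) {i j m : ι} (h : P.root i = P.root j + P.root m)
    (hjm : P.pairingIn ℤ j m ≤ 0) : P.pairingIn ℤ j m = -1 := by
  have h1 := pq (P := P) m i
  have h2 := pq (P := P) m j
  have h3 := pself (P := P) m
  have h4 : P.pairingIn ℤ i m = P.pairingIn ℤ j m + 2 := by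
    rw [h, map_add, pq, pq, pself] at h1
    exact_mod_cast h1.symm
  have hne : P.root i ≠ P.root m := by
    intro h'; rw [h'] at h
    exact P.ne_zero j (by simpa using h.symm)
  have key : P.root i ≠ - P.root m := by
    intro h'
    have h5 : P.root j = (-2 : L) • P.root m := by
      have : P.root j = P.root i - P.root m := by rw [h]; abel
      rw [this, h']; module
    have h6 := pq (P := P) m j
    rw [h5, map_smul, pq, pself] at h6
    have h7 : P.pairingIn ℤ j m = -4 := by
      have : ((P.pairingIn ℤ j m : ℤ) : L) = ((-4 : ℤ) : L) := by rw [← h6]; push_cast; norm_num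
      exact_mod_cast this
    have := psign (P := P) j m
    simp only [Set.mem_insert_iff, Prod.mk.injEq, Set.mem_singleton_iff] at this
    omega
  have h8 := abs_le.1 (hb i m hne key)
  have h9 : P.root j ≠ P.root m := by
    intro h'; rw [P.root.injective h', pself] at hjm; omega
  have h10 : P.root j ≠ - P.root m := by
    intro h'; rw [h'] at h; exact P.ne_zero i (by simpa using h)
  have h11 := abs_le.1 (hb j m h9 h10)
  omega

end comb
end CVP

namespace CVP
open Module

section comb
variable {ι L M N : Type*} [Fintype ι] [Field L] [CharZero L] [AddCommGroup M] [Module L M]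
  [AddCommGroup N] [Module L N] {P : RootPairing ι L M N} [P.IsCrystallographic] [P.IsReduced]
  [FiniteDimensional L M] {U : Submodule L M} {d : M →ₗ[L] L}

open Classical in
lemma dec1 (h1 : (Phi P U d 1).card ≤ 1) : (Phi P U d 2 \ Ind P U d).card = 0 := by
  rw [Finset.card_eq_zero, Finset.eq_empty_iff_forall_notMem]
  intro i hi
  obtain ⟨hi, hn⟩ := Finset.mem_sdiff.1 hi
  obtain ⟨j, hj, m, hm, hmj, -⟩ := not_ind hi hn
  exact hmj (Finset.card_le_one.1 h1 m hm j hj)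

open Classical in
lemma dec2 (h1 : (Phi P U d 1).card = 2) : (Phi P U d 2 \ Ind P U d).card ≤ 1 := by
  obtain ⟨a, b, hab, he⟩ := Finset.card_eq_two.1 h1
  have key : ∀ i ∈ Phi P U d 2 \ Ind P U d, P.root i = P.root a + P.root b := by
    intro i hi
    obtain ⟨hi, hn⟩ := Finset.mem_sdiff.1 hi
    obtain ⟨j, hj, m, hm, hmj, hr⟩ := not_ind hi hn
    rw [he] at hj hm
    simp only [Finset.mem_insert, Finset.mem_singleton] at hj hm
    rcases hj with rfl | rfl <;> rcases hm with rfl | rfl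
    · exact absurd rfl hmj
    · exact hr
    · rw [hr, add_comm]
    · exact absurd rfl hmj
  rw [Finset.card_le_one]
  intro i hi j hj
  exact P.root.injective ((key i hi).trans (key j hj).symm)

open Classical in
lemma dec3 (hb : PB P 1) (h0 : Phi P U d 0 = ∅) (h1 : (Phi P U d 1).card = 3) :
    (Phi P U d 2 \ Ind P U d).card ≤ 2 := by
  obtain ⟨a, b, c, hab, hac, hbc, he⟩ := Finset.card_eq_three.1 h1
  set σ := P.root a + P.root b + P.root c with hσ
  set X := (Phi P U d 1).filter fun m => ∃ i, P.root i = σ - P.root m with hX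
  have key : ∀ i ∈ Phi P U d 2 \ Ind P U d, ∃ m ∈ X, P.root i = σ - P.root m := by
    intro i hi
    obtain ⟨hi, hn⟩ := Finset.mem_sdiff.1 hi
    obtain ⟨j, hj, m, hm, hmj, hr⟩ := not_ind hi hn
    have : ∃ m ∈ Phi P U d 1, P.root i = σ - P.root m := by
      rw [he] at hj hm ⊢
      simp only [Finset.mem_insert, Finset.mem_singleton] at hj hm
      rcases hj with rfl | rfl | rfl <;> rcases hm with rfl | rfl | rfl
      · exact absurd rfl hmj
      · exact ⟨c, by simp, by rw [hr, hσ]; abel⟩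
      · exact ⟨b, by simp, by rw [hr, hσ]; abel⟩
      · exact ⟨c, by simp, by rw [hr, hσ]; abel⟩
      · exact absurd rfl hmj
      · exact ⟨a, by simp, by rw [hr, hσ]; abel⟩
      · exact ⟨b, by simp, by rw [hr, hσ]; abel⟩
      · exact ⟨a, by simp, by rw [hr, hσ]; abel⟩
      · exact absurd rfl hmj
    obtain ⟨m, hm, h⟩ := this
    exact ⟨m, Finset.mem_filter.2 ⟨hm, i, h⟩, h⟩
  choose! f hf1 hf2 using key
  have h3 : (Phi P U d 2 \ Ind P U d).card ≤ X.card :=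
    Finset.card_le_card_of_injOn f (fun i hi => hf1 i hi) (fun i hi j hj hij =>
      P.root.injective (by rw [hf2 i hi, hf2 j hj, hij]))
  by_contra hcon
  have h4 : X = Phi P U d 1 := Finset.eq_of_subset_of_card_le (Finset.filter_subset _ _) (by omega)
  have ha : a ∈ X := by rw [h4, he]; simp
  have hb' : b ∈ X := by rw [h4, he]; simp
  have hc : c ∈ X := by rw [h4, he]; simp
  obtain ⟨ha1, i, hi⟩ := Finset.mem_filter.1 ha
  obtain ⟨hb1, j, hj⟩ := Finset.mem_filter.1 hb'
  obtain ⟨hc1, k, hk⟩ := Finset.mem_filter.1 hc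
  have e1 : P.root i = P.root b + P.root c := by rw [hi, hσ]; abel
  have e2 : P.root j = P.root a + P.root c := by rw [hj, hσ]; abel
  have e3 : P.root k = P.root a + P.root b := by rw [hk, hσ]; abel
  have p1 := sum_edge hb e1 (obt_same h0 hb1 hc1 hbc)
  have p2 := sum_edge hb e2 (obt_same h0 ha1 hc1 hac)
  have hk2 : k ∈ Phi P U d 2 := by
    rw [mPhi, e3]
    refine ⟨U.add_mem (mPhi.1 ha1).1 (mPhi.1 hb1).1, ?_⟩
    rw [map_add, (mPhi.1 ha1).2, (mPhi.1 hb1).2]; norm_num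
  have h5 := pq (P := P) c k
  rw [e3, map_add, pq, pq, p1, p2] at h5
  have h6 : P.pairingIn ℤ k c = -2 := by
    have : ((P.pairingIn ℤ k c : ℤ) : L) = ((-2 : ℤ) : L) := by rw [← h5]; norm_num
    exact_mod_cast this
  have np := nonprop (by omega) hk2 hc1
  have := abs_le.1 (hb k c np.1 np.2)
  omega

open Classical in
lemma combE (hr : finrank L U = 2 ∨ (finrank L U = 3 ∧ PB P 1)) (h0 : Phi P U d 0 = ∅)
    (h1 : Phi P U d 1 ≠ ∅) : (Phi P U d 2).card < finrank L U := by
  have hi := ind_card h0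
  have h1' := Finset.card_pos.2 (Finset.nonempty_iff_ne_empty.2 h1)
  have hs : (Phi P U d 2 \ Ind P U d).card + (Ind P U d).card = (Phi P U d 2).card :=
    Finset.card_sdiff_add_card_eq_card (Finset.filter_subset _ _)
  have a1 := dec1 (P := P) (U := U) (d := d)
  have a2 := dec2 (P := P) (U := U) (d := d)
  rcases hr with hr | ⟨hr, hb⟩
  · rcases (by omega : (Phi P U d 1).card = 1 ∨ (Phi P U d 1).card = 2) with h | h
    · have := a1 (by omega); omega
    · have := a2 (by omega); omega
  · have a3 := dec3 hb h0 
    rcases (by omega : (Phi P U d 1).card = 1 ∨ (Phi P U d 1).card = 2 ∨ (Phi P U d 1).card = 3)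
      with h | h | h
    · have := a1 (by omega); omega
    · have := a2 (by omega); omega
    · have := a3 (by omega); omega

/-- rank two, degree zero roots -/
lemma deg0_line (hr : finrank L U = 2) {β δ : ι} (hβ : β ∈ Phi P U d 0) (hδ : δ ∈ Phi P U d 2)
    {v : M} (hv : v ∈ U) (hd : d v = 0) : ∃ c : L, v = c • P.root β := by
  have hli : LinearIndependent L ![P.root β, P.root δ] := by
    have np := nonprop (by omega) hβ hδ
    by_contra h
    rcases RootPairing.IsReduced.eq_or_eq_neg (P := P) β δ h with h | h
    · exact np.1 h
    · exact np.2 h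
  have hspan : Submodule.span L (Set.range ![P.root β, P.root δ]) = U := by
    apply Submodule.eq_of_le_of_finrank_eq
    · rw [Submodule.span_le]
      rintro _ ⟨i, rfl⟩
      fin_cases i
      · exact (mPhi.1 hβ).1
      · exact (mPhi.1 hδ).1
    · rw [finrank_span_eq_card hli, hr]; rfl
  rw [← hspan, Matrix.range_cons, Matrix.range_cons, Matrix.range_empty, Set.union_empty,
    Set.singleton_union, Submodule.mem_span_pair] at hv
  obtain ⟨a, b, rfl⟩ := hv
  rw [map_add, map_smul, map_smul, (mPhi.1 hβ).2, (mPhi.1 hδ).2] at hd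
  have hb : b = 0 := by simpa using hd
  exact ⟨a, by rw [hb]; simp⟩

lemma Phi_refl0 {β δ : ι} {a : ℕ} (hβ : β ∈ Phi P U d 0) (hδ : δ ∈ Phi P U d a) :
    ∃ m ∈ Phi P U d a, P.pairingIn ℤ m β = - P.pairingIn ℤ δ β := by
  have h := P.root_reflectionPerm β δ
  rw [P.reflection_apply] at h
  refine ⟨P.reflectionPerm β δ, ?_, ?_⟩
  · rw [mPhi, h]
    refine ⟨U.sub_mem (mPhi.1 hδ).1 (U.smul_mem _ (mPhi.1 hβ).1), ?_⟩
    rw [map_sub, map_smul, (mPhi.1 hβ).2, (mPhi.1 hδ).2]; simp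
  · have h2 := congrArg (P.coroot' β) h
    rw [map_sub, map_smul, pq, pq, pq, pself] at h2
    have : ((P.pairingIn ℤ (P.reflectionPerm β δ) β : ℤ) : L) = ((- P.pairingIn ℤ δ β : ℤ) : L) := by
      rw [h2]; push_cast; simp; ring
    exact_mod_cast this

open Classical in
lemma comb0 (hb : PB P 2) (hr : finrank L U = 2) {β : ι} (hβ : β ∈ Phi P U d 0)
    (h2 : (Phi P U d 2).Nonempty) :
    (Phi P U d 0).card = 2 ∧ (Phi P U d 2).card ≤ 3 ∧ (PB P 1 → (Phi P U d 2).card ≤ 2 ∧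
      Phi P U d 1 = ∅) := by
  obtain ⟨δ₀, hδ₀⟩ := h2
  have line := fun {v : M} => deg0_line (v := v) hr hβ hδ₀
  have hdiff : ∀ i ∈ Phi P U d 2, ∀ j ∈ Phi P U d 2, ∃ c : L, P.root i - P.root j = c • P.root β ∧
      ((P.pairingIn ℤ i β - P.pairingIn ℤ j β : ℤ) : L) = 2 * c := by
    intro i hi j hj
    obtain ⟨c, hc⟩ := line (U.sub_mem (mPhi.1 hi).1 (mPhi.1 hj).1)
      (by rw [map_sub, (mPhi.1 hi).2, (mPhi.1 hj).2, sub_self])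
    refine ⟨c, hc, ?_⟩
    have := congrArg (P.coroot' β) hc
    rw [map_sub, map_smul, pq, pq, pq, pself] at this
    push_cast; rw [this]; simp; ring
  have hinj : Set.InjOn (fun i => P.pairingIn ℤ i β) (Phi P U d 2) := by
    intro i hi j hj hij
    obtain ⟨c, hc, h⟩ := hdiff i hi j hj
    rw [show P.pairingIn ℤ i β - P.pairingIn ℤ j β = 0 from sub_eq_zero.2 hij] at h
    have : c = 0 := by simpa using h.symm
    rw [this, zero_smul, sub_eq_zero] at hc
    exact P.root.injective hc
  have hbd : ∀ i ∈ Phi P U d 2, |P.pairingIn ℤ i β| ≤ 2 := by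
    intro i hi
    have np := nonprop (by omega) hi hβ
    exact hb _ _ np.1 np.2
  have hpar : ∀ i ∈ Phi P U d 2, ∀ j ∈ Phi P U d 2, P.pairingIn ℤ i β = 0 →
      P.pairingIn ℤ j β ≠ 1 := by
    intro i hi j hj h0 h1
    obtain ⟨c, hc, h⟩ := hdiff j hj i hi
    rw [h0, h1] at h
    have hji : P.root j = P.root i + c • P.root β := by rw [← hc]; abel
    have h3 := pq (P := P) i j
    rw [hji, map_add, map_smul, pq, pq, pself, pzero h0] at h3
    have h4 : P.pairingIn ℤ j i = 2 := by
      have : ((P.pairingIn ℤ j i : ℤ) : L) = ((2 : ℤ) : L) := by rw [← h3]; simp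
      exact_mod_cast this
    obtain ⟨m, hm⟩ := pdiff (P := P) (i := j) (j := i) (by omega) (by rintro rfl; omega)
    rw [hc] at hm
    have hc2 : (2 : L) * c = 1 := by rw [← h]; norm_num
    rcases root_prop hm with h5 | h5
    · rw [h5] at hm
      have := congrArg (P.coroot' β) hm
      simp only [map_smul, pq, pself, smul_eq_mul] at this
      push_cast at this
      exact one_ne_zero (α := L) (by linear_combination this + hc2)
    · rw [h5] at hm
      have := congrArg (P.coroot' β) hm
      simp only [map_neg, map_smul, pq, pself, smul_eq_mul] at this
      push_cast at this
      exact three_ne_zero (α := L) (by linear_combination -this - hc2)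
  have hpar' : ∀ i ∈ Phi P U d 2, ∀ j ∈ Phi P U d 2, P.pairingIn ℤ i β = 0 →
      P.pairingIn ℤ j β ≠ -1 := by
    intro i hi j hj h0 h1
    obtain ⟨m, hm, h⟩ := Phi_refl0 hβ hj
    exact hpar i hi m hm h0 (by rw [h, h1]; norm_num)
  have h22 : ∀ i ∈ Phi P U d 2, P.pairingIn ℤ i β = 2 → ∃ j ∈ Phi P U d 2, P.pairingIn ℤ j β = 0 := by
    intro i hi h
    obtain ⟨m, hm⟩ := pdiff (P := P) (i := i) (j := β) (by omega) (ne_of_deg (by omega) hi hβ)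
    refine ⟨m, Phi_sub (by omega) hi hβ hm, ?_⟩
    have := congrArg (P.coroot' β) hm
    rw [map_sub, pq, pq, pq, pself, h, sub_self] at this
    exact_mod_cast this
  have hcard : ((Phi P U d 2).image fun i => P.pairingIn ℤ i β).card = (Phi P U d 2).card :=
    Finset.card_image_of_injOn hinj
  have main : (∃ i ∈ Phi P U d 2, P.pairingIn ℤ i β = 0) ∨
      ((Phi P U d 2).image fun i => P.pairingIn ℤ i β) ⊆ {1, -1} := by
    by_cases h : ∃ i ∈ Phi P U d 2, P.pairingIn ℤ i β = 0
    · exact Or.inl h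
    right
    intro x hx
    obtain ⟨i, hi, rfl⟩ := Finset.mem_image.1 hx
    have h1 := abs_le.1 (hbd i hi)
    have h2 : P.pairingIn ℤ i β ≠ 0 := fun h' => h ⟨i, hi, h'⟩
    have h3 : P.pairingIn ℤ i β ≠ 2 := fun h' => h (h22 i hi h')
    have h4 : P.pairingIn ℤ i β ≠ -2 := fun h' => by
      obtain ⟨m, hm, h5⟩ := Phi_refl0 hβ hi
      exact h (h22 m hm (by omega))
    simp only [Finset.mem_insert, Finset.mem_singleton]
    omega
  refine ⟨?_, ?_, fun hb1 => ⟨?_, ?_⟩⟩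
  · obtain ⟨m, hm⟩ : ∃ m, P.root m = - P.root β := ⟨P.reflectionPerm β β, by
      rw [P.root_reflectionPerm, P.reflection_apply_self]⟩
    rw [Finset.card_eq_two]
    refine ⟨β, m, ?_, ?_⟩
    · rintro rfl
      have h2 : (2 : L) • P.root β = 0 := by
        rw [two_smul]; nth_rw 1 [hm]; simp
      exact P.ne_zero β ((smul_eq_zero.1 h2).resolve_left two_ne_zero)
    · ext i
      simp only [Finset.mem_insert, Finset.mem_singleton]
      constructor
      · intro hi
        obtain ⟨c, hc⟩ := line (mPhi.1 hi).1 (by rw [(mPhi.1 hi).2]; simp)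
        rcases root_prop hc with h | h
        · exact Or.inl (P.root.injective h)
        · exact Or.inr (P.root.injective (by rw [h, hm]))
      · rintro (rfl | rfl)
        · exact hβ
        · exact Phi_neg0 hβ hm
  · rw [← hcard]
    rcases main with ⟨i, hi, h⟩ | h
    · have : ((Phi P U d 2).image fun i => P.pairingIn ℤ i β) ⊆ {0, 2, -2} := by
        intro x hx
        obtain ⟨j, hj, rfl⟩ := Finset.mem_image.1 hx
        have h1 := abs_le.1 (hbd j hj)
        have h2 := hpar i hi j hj h
        have h3 := hpar' i hi j hj h
        simp only [Finset.mem_insert, Finset.mem_singleton]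
        omega
      exact (Finset.card_le_card this).trans Finset.card_le_three
    · exact ((Finset.card_le_card h).trans Finset.card_le_two).trans (by norm_num)
  · rw [← hcard]
    rcases main with ⟨i, hi, h⟩ | h
    · have : ((Phi P U d 2).image fun i => P.pairingIn ℤ i β) ⊆ {0} := by
        intro x hx
        obtain ⟨j, hj, rfl⟩ := Finset.mem_image.1 hx
        have np := nonprop (by omega) hj hβ
        have h1 := abs_le.1 (hb1 j β np.1 np.2)
        have h2 := hpar i hi j hj h
        have h3 := hpar' i hi j hj h
        simp only [Finset.mem_singleton]
        omega
      exact (Finset.card_le_card this).trans (by simp)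
    · exact ((Finset.card_le_card h).trans Finset.card_le_two)
  · rw [Finset.eq_empty_iff_forall_notMem]
    intro γ hγ
    obtain ⟨c, hc⟩ := line (v := P.root δ₀ - (2 : L) • P.root γ)
      (U.sub_mem (mPhi.1 hδ₀).1 (U.smul_mem _ (mPhi.1 hγ).1))
      (by rw [map_sub, map_smul, (mPhi.1 hγ).2, (mPhi.1 hδ₀).2]; simp)
    have e1 := congrArg (P.coroot' β) hc
    have e2 := congrArg (P.coroot' γ) hc
    simp only [map_sub, map_smul, pq, pself, smul_eq_mul] at e1 e2
    have n1 := nonprop (by omega) hδ₀ hβ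
    have n2 := nonprop (by omega) hγ hβ
    have n3 := nonprop (by omega) hδ₀ hγ
    have n4 := nonprop (by omega) hβ hγ
    have b1 := abs_le.1 (hb1 _ _ n1.1 n1.2)
    have b2 := abs_le.1 (hb1 _ _ n2.1 n2.2)
    have b3 := abs_le.1 (hb1 _ _ n3.1 n3.2)
    have b4 := abs_le.1 (hb1 _ _ n4.1 n4.2)
    generalize P.pairingIn ℤ δ₀ β = q1 at *
    generalize P.pairingIn ℤ γ β = q2 at *
    generalize P.pairingIn ℤ δ₀ γ = q3 at *
    generalize P.pairingIn ℤ β γ = q4 at *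
    have e3 : (((q1 - 2 * q2) * q4 : ℤ) : L) = ((2 * (q3 - 4) : ℤ) : L) := by
      push_cast at e1 e2 ⊢
      linear_combination (q4 : L) * e1 - 2 * e2
    have e4 : (q1 - 2 * q2) * q4 = 2 * (q3 - 4) := by exact_mod_cast e3
    have f1 : -1 ≤ q4 := b4.1
    have f2 := b4.2
    interval_cases q4 <;> omega


open Classical in
lemma nbr_card {a : ι} (ha : a ∈ Phi P U d 2) :
    2 * ((Phi P U d 2).filter fun i => P.pairingIn ℤ i a = 1).card ≤ (Phi P U d 0).card := by
  have key : ∀ i ∈ (Phi P U d 2).filter (fun i => P.pairingIn ℤ i a = 1),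
      ∃ m ∈ (Phi P U d 0).filter (fun i => P.pairingIn ℤ i a = -1), P.root m = P.root i - P.root a := by
    intro i hi
    obtain ⟨hi, h⟩ := Finset.mem_filter.1 hi
    have hia : i ≠ a := by rintro rfl; rw [pself] at h; omega
    obtain ⟨m, hm⟩ := pdiff (P := P) (i := i) (j := a) (by omega) hia
    refine ⟨m, Finset.mem_filter.2 ⟨Phi_sub (by omega) hi ha hm, ?_⟩, hm⟩
    have := congrArg (P.coroot' a) hm
    rw [map_sub, pq, pq, pq, pself, h] at this
    have : ((P.pairingIn ℤ m a : ℤ) : L) = ((-1 : ℤ) : L) := by rw [this]; norm_num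
    exact_mod_cast this
  choose! f hf1 hf2 using key
  have h1 : ((Phi P U d 2).filter fun i => P.pairingIn ℤ i a = 1).card ≤
      ((Phi P U d 0).filter (fun i => P.pairingIn ℤ i a = -1)).card :=
    Finset.card_le_card_of_injOn f (fun i hi => hf1 i hi) (fun i hi j hj hij => by
      have := (hf2 i hi).symm.trans ((congrArg P.root hij).trans (hf2 j hj))
      exact P.root.injective (sub_left_injective this))
  have key2 : ∀ i ∈ (Phi P U d 0).filter (fun i => P.pairingIn ℤ i a = -1),
      ∃ m ∈ (Phi P U d 0).filter (fun i => P.pairingIn ℤ i a = 1), P.root m = - P.root i := by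
    intro i hi
    obtain ⟨hi, h⟩ := Finset.mem_filter.1 hi
    obtain ⟨m, hm⟩ : ∃ m, P.root m = - P.root i := ⟨P.reflectionPerm i i, by
      rw [P.root_reflectionPerm, P.reflection_apply_self]⟩
    refine ⟨m, Finset.mem_filter.2 ⟨Phi_neg0 hi hm, ?_⟩, hm⟩
    have := congrArg (P.coroot' a) hm
    rw [map_neg, pq, pq, h] at this
    have : ((P.pairingIn ℤ m a : ℤ) : L) = ((1 : ℤ) : L) := by rw [this]; norm_num
    exact_mod_cast this
  choose! f' hf1' hf2' using key2
  have h2 : ((Phi P U d 0).filter fun i => P.pairingIn ℤ i a = -1).card ≤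
      ((Phi P U d 0).filter (fun i => P.pairingIn ℤ i a = 1)).card :=
    Finset.card_le_card_of_injOn f' (fun i hi => hf1' i hi) (fun i hi j hj hij => by
      have := (hf2' i hi).symm.trans ((congrArg P.root hij).trans (hf2' j hj))
      exact P.root.injective (neg_injective this))
  have h3 : Disjoint ((Phi P U d 0).filter fun i => P.pairingIn ℤ i a = -1)
      ((Phi P U d 0).filter fun i => P.pairingIn ℤ i a = 1) := by
    rw [Finset.disjoint_filter]; intro i _ h; omega
  have h4 : (((Phi P U d 0).filter fun i => P.pairingIn ℤ i a = -1) ∪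
      ((Phi P U d 0).filter fun i => P.pairingIn ℤ i a = 1)).card ≤ (Phi P U d 0).card :=
    Finset.card_le_card (Finset.union_subset (Finset.filter_subset _ _) (Finset.filter_subset _ _))
  rw [Finset.card_union_of_disjoint h3] at h4
  omega

set_option maxHeartbeats 2000000 in
lemma triple_arith {n01 n02 n12 q0 q1 q2 : ℤ} {c0 c1 c2 : L} (m01 : n01 = 0 ∨ n01 = -1)
    (m02 : n02 = 0 ∨ n02 = -1) (m12 : n12 = 0 ∨ n12 = -1) (p0 : -1 ≤ q0 ∧ q0 ≤ 1)
    (p1 : -1 ≤ q1 ∧ q1 ≤ 1) (p2 : -1 ≤ q2 ∧ q2 ≤ 1)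
    (e : c0 * (2 : ℕ) + c1 * (2 : ℕ) + c2 * (2 : ℕ) = ((0 : ℕ) : L))
    (eβ : c0 * q0 + c1 * q1 + c2 * q2 = ((2 : ℤ) : L))
    (e0 : c0 * (2 : ℤ) + c1 * n01 + c2 * n02 = (q0 : L))
    (e1 : c0 * n01 + c1 * (2 : ℤ) + c2 * n12 = (q1 : L))
    (e2 : c0 * n02 + c1 * n12 + c2 * (2 : ℤ) = (q2 : L)) : False := by
  have k0 : q0 = -1 ∨ q0 = 0 ∨ q0 = 1 := by omega
  have k1 : q1 = -1 ∨ q1 = 0 ∨ q1 = 1 := by omega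
  have k2 : q2 = -1 ∨ q2 = 0 ∨ q2 = 1 := by omega
  clear p0 p1 p2
  have e' : c2 = - c0 - c1 := by
    apply mul_left_cancel₀ (two_ne_zero (α := L)); push_cast at e; linear_combination e
  clear e
  subst e'
  rcases m01 with rfl | rfl <;> rcases m02 with rfl | rfl <;> rcases m12 with rfl | rfl <;>
    simp only [Int.cast_neg, Int.cast_one, Int.cast_zero, Int.cast_ofNat] at eβ e0 e1 e2 <;>
    rcases k0 with rfl | rfl | rfl <;> rcases k1 with rfl | rfl | rfl <;>
    rcases k2 with rfl | rfl | rfl <;>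
    simp only [Int.cast_neg, Int.cast_one, Int.cast_zero] at eβ e0 e1 e2 <;>
    grind

/-- no obtuse triple -/
lemma no_triple (hb : PB P 1) (hr : finrank L U = 3) {β : ι} (hβ : β ∈ Phi P U d 0)
    {a : Fin 3 → ι} (ha : ∀ i, a i ∈ Phi P U d 2)
    (hp : Pairwise fun i j => P.pairingIn ℤ (a i) (a j) ≤ 0) : False := by
  have hli := obtuse_li P a d (fun _ => 2) (by simp) (fun i => (mPhi.1 (ha i)).2) hp
  have hspan : Submodule.span L (Set.range fun i => P.root (a i)) = U := by
    apply Submodule.eq_of_le_of_finrank_eq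
    · rw [Submodule.span_le]
      rintro _ ⟨i, rfl⟩
      exact (mPhi.1 (ha i)).1
    · rw [finrank_span_eq_card hli, hr]; rfl
  have hv := (mPhi.1 hβ).1
  rw [← hspan, Submodule.mem_span_range_iff_exists_fun] at hv
  obtain ⟨c, hc⟩ := hv
  rw [Fin.sum_univ_three] at hc
  have e := congrArg d hc
  have eβ := congrArg (P.coroot' β) hc
  have e0 := congrArg (P.coroot' (a 0)) hc
  have e1 := congrArg (P.coroot' (a 1)) hc
  have e2 := congrArg (P.coroot' (a 2)) hc
  simp only [map_add, map_smul, (mPhi.1 hβ).2, (mPhi.1 (ha _)).2, pq, pself, smul_eq_mul] at e eβ e0 e1 e2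
  have np : ∀ i, |P.pairingIn ℤ β (a i)| ≤ 1 := fun i =>
    have n := nonprop (by omega) hβ (ha i)
    hb _ _ n.1 n.2
  have nq : ∀ i j, i ≠ j → P.pairingIn ℤ (a i) (a j) = 0 ∨ P.pairingIn ℤ (a i) (a j) = -1 := by
    intro i j hij
    have h1 : P.pairingIn ℤ (a i) (a j) ≤ 0 := hp hij
    have h2 : P.root (a i) ≠ P.root (a j) := by
      intro h; rw [P.root.injective h, pself] at h1; omega
    have h3 : P.root (a i) ≠ - P.root (a j) := by
      intro h
      have := congrArg d h
      rw [map_neg, (mPhi.1 (ha _)).2, (mPhi.1 (ha _)).2] at this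
      exact (by norm_num : (4 : L) ≠ 0) (by push_cast at this; linear_combination this)
    have := abs_le.1 (hb _ _ h2 h3)
    omega
  rw [psym hb (a 0) β, psym hb (a 1) β, psym hb (a 2) β] at eβ
  rw [psym hb (a 1) (a 0), psym hb (a 2) (a 0)] at e0
  rw [psym hb (a 2) (a 1)] at e1
  have m01 := nq 0 1 (by decide)
  have m02 := nq 0 2 (by decide)
  have m12 := nq 1 2 (by decide)
  have p0 := abs_le.1 (np 0)
  have p1 := abs_le.1 (np 1)
  have p2 := abs_le.1 (np 2)
  generalize P.pairingIn ℤ (a 0) (a 1) = n01 at *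
  generalize P.pairingIn ℤ (a 0) (a 2) = n02 at *
  generalize P.pairingIn ℤ (a 1) (a 2) = n12 at *
  generalize P.pairingIn ℤ β (a 0) = q0 at *
  generalize P.pairingIn ℤ β (a 1) = q1 at *
  generalize P.pairingIn ℤ β (a 2) = q2 at *
  generalize c 0 = c0 at *
  generalize c 1 = c1 at *
  generalize c 2 = c2 at *
  exact triple_arith m01 m02 m12 p0 p1 p2 e eβ e0 e1 e2

open Classical in
lemma combB (hb : PB P 1) (hr : finrank L U = 3) {β : ι} (hβ : β ∈ Phi P U d 0) :
    (Phi P U d 2).card ≤ 2 + (Phi P U d 0).card := by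
  have hne : ∀ i ∈ Phi P U d 2, ∀ j ∈ Phi P U d 2, i ≠ j → 0 < P.pairingIn ℤ i j →
      P.pairingIn ℤ i j = 1 := by
    intro i hi j hj hij h
    have h3 : P.root i ≠ - P.root j := by
      intro h
      have := congrArg d h
      rw [map_neg, (mPhi.1 hi).2, (mPhi.1 hj).2] at this
      exact (by norm_num : (4 : L) ≠ 0) (by push_cast at this; linear_combination this)
    have := abs_le.1 (hb i j (fun h => hij (P.root.injective h)) h3)
    omega
  by_cases h : ∃ i ∈ Phi P U d 2, ∃ j ∈ Phi P U d 2, i ≠ j ∧ P.pairingIn ℤ i j ≤ 0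
  · obtain ⟨i, hi, j, hj, hij, hp⟩ := h
    have hsub : Phi P U d 2 ⊆ {i, j} ∪ (((Phi P U d 2).filter fun m => P.pairingIn ℤ m i = 1) ∪
        ((Phi P U d 2).filter fun m => P.pairingIn ℤ m j = 1)) := by
      intro m hm
      simp only [Finset.mem_union, Finset.mem_insert, Finset.mem_singleton, Finset.mem_filter, hm,
        true_and]
      by_contra hcon
      push Not at hcon
      obtain ⟨⟨h1, h2⟩, h3, h4⟩ := hcon
      have g1 : P.pairingIn ℤ m i ≤ 0 := by
        by_contra h; exact h3 (hne m hm i hi h1 (not_le.1 h))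
      have g2 : P.pairingIn ℤ m j ≤ 0 := by
        by_contra h; exact h4 (hne m hm j hj h2 (not_le.1 h))
      refine no_triple hb hr hβ (a := ![i, j, m]) (fun a => ?_) (fun a b hab => ?_)
      · fin_cases a <;> assumption
      · have := psgn g1
        have := psgn g2
        have := psgn hp
        fin_cases a <;> fin_cases b <;> first | exact absurd rfl hab | assumption
    have h1 := Finset.card_le_card hsub
    have h2 := Finset.card_union_le ({i, j} : Finset ι) (((Phi P U d 2).filter fun m => P.pairingIn ℤ m i = 1) ∪
        ((Phi P U d 2).filter fun m => P.pairingIn ℤ m j = 1))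
    have h3 := Finset.card_union_le ((Phi P U d 2).filter fun m => P.pairingIn ℤ m i = 1)
        ((Phi P U d 2).filter fun m => P.pairingIn ℤ m j = 1)
    have h4 := nbr_card hi
    have h5 := nbr_card hj
    have h6 : ({i, j} : Finset ι).card ≤ 2 := Finset.card_le_two
    omega
  · push Not at h
    rcases (Phi P U d 2).eq_empty_or_nonempty with h0 | ⟨i, hi⟩
    · rw [h0]; simp
    have hsub : Phi P U d 2 ⊆ {i} ∪ ((Phi P U d 2).filter fun m => P.pairingIn ℤ m i = 1) := by
      intro m hm
      simp only [Finset.mem_union, Finset.mem_singleton, Finset.mem_filter, hm, true_and]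
      by_cases hmi : m = i
      · exact Or.inl hmi
      · exact Or.inr (hne m hm i hi hmi (h m hm i hi hmi))
    have h1 := Finset.card_le_card hsub
    have h2 := Finset.card_union_le ({i} : Finset ι) ((Phi P U d 2).filter fun m => P.pairingIn ℤ m i = 1)
    have h4 := nbr_card hi
    have h6 : ({i} : Finset ι).card = 1 := Finset.card_singleton _
    omega

open Classical in
/-- rank two simply laced, no degree zero roots, two degree one roots -/
lemma combD (hb : PB P 1) (hr : finrank L U = 2) (h0 : Phi P U d 0 = ∅) :
    (Phi P U d 1).card ≤ 2 ∧ ((Phi P U d 1).card = 2 →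
      (∃ a b, Phi P U d 1 = {a, b} ∧ (∀ i ∈ Phi P U d 2, P.root i = P.root a + P.root b) ∧
        ∀ φ : M →ₗ[L] L, φ (P.root a) = 0 → φ (P.root b) = 0 → ∀ v ∈ U, φ v = 0) ∧
      ∀ j, 3 ≤ j → Phi P U d j = ∅) := by
  have hi := ind_card h0
  refine ⟨by omega, fun h2 => ?_⟩
  obtain ⟨a, b, hab, he⟩ := Finset.card_eq_two.1 h2
  have ha : a ∈ Phi P U d 1 := by rw [he]; simp
  have hb' : b ∈ Phi P U d 1 := by rw [he]; simp
  have hpab := obt_same h0 ha hb' hab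
  have dec : ∀ n i, 2 ≤ n → i ∈ Phi P U d n → 0 < P.pairingIn ℤ i a ∨ 0 < P.pairingIn ℤ i b := by
    intro n i hn hi
    by_contra hcon
    push Not at hcon
    have hia : i ≠ a := ne_of_deg (by omega) hi ha
    have hib : i ≠ b := ne_of_deg (by omega) hi hb'
    have := ob_card (P := P) (U := U) (d := d) {a, b, i}
      (by simp [(mPhi.1 ha).1, (mPhi.1 hb').1, (mPhi.1 hi).1])
      (by
        intro j hj
        simp only [Finset.mem_insert, Finset.mem_singleton] at hj
        rcases hj with rfl | rfl | rfl
        · exact ⟨1, by simp, (mPhi.1 ha).2⟩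
        · exact ⟨1, by simp, (mPhi.1 hb').2⟩
        · exact ⟨n, by omega, (mPhi.1 hi).2⟩)
      (by
        have q1 := psgn hcon.1
        have q2 := psgn hcon.2
        have q3 := psgn hpab
        intro j hj k hk hjk
        simp only [Finset.mem_insert, Finset.mem_singleton] at hj hk
        rcases hj with rfl | rfl | rfl <;> rcases hk with rfl | rfl | rfl <;>
          first | exact absurd rfl hjk | assumption | exact hcon.1 | exact hcon.2)
    rw [Finset.card_eq_three.2 ⟨a, b, i, hab, hia.symm, hib.symm, rfl⟩] at this
    omega
  have d2 : ∀ i ∈ Phi P U d 2, P.root i = P.root a + P.root b := by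
    intro i hi
    rcases dec 2 i (by omega) hi with h | h
    · obtain ⟨m, hm, hma, e⟩ := decomp (by omega) hi ha h
      rw [he] at hm
      simp only [Finset.mem_insert, Finset.mem_singleton] at hm
      rcases hm with rfl | rfl
      · exact absurd rfl hma
      · exact e
    · obtain ⟨m, hm, hma, e⟩ := decomp (by omega) hi hb' h
      rw [he] at hm
      simp only [Finset.mem_insert, Finset.mem_singleton] at hm
      rcases hm with rfl | rfl
      · rw [e, add_comm]
      · exact absurd rfl hma
  have no3 : ∀ {x y i m : ι}, x ∈ Phi P U d 1 → y ∈ Phi P U d 1 → x ≠ y → i ∈ Phi P U d 3 →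
      P.root m = P.root x + P.root y → P.root i = P.root x + P.root m → False := by
    intro x y i m hx hy hxy hi e1 e2
    have p1 := sum_edge hb (i := m) (j := y) (m := x) (by rw [e1, add_comm])
      (obt_same h0 hy hx hxy.symm)
    have := congrArg (P.coroot' x) e2
    rw [e1, map_add, map_add, pq, pq, pq, pself, p1] at this
    have h3 : P.pairingIn ℤ i x = 3 := by
      have : ((P.pairingIn ℤ i x : ℤ) : L) = ((3 : ℤ) : L) := by rw [this]; norm_num
      exact_mod_cast this
    have np := nonprop (by omega) hi hx
    have := abs_le.1 (hb _ _ np.1 np.2)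
    omega
  refine ⟨⟨a, b, he, d2, fun φ h1 h2 v hv => ?_⟩, ?_⟩
  · have hli : LinearIndependent L ![P.root a, P.root b] := by
      by_contra h
      rcases RootPairing.IsReduced.eq_or_eq_neg (P := P) a b h with h | h
      · exact hab (P.root.injective h)
      · have := congrArg d h
        rw [map_neg, (mPhi.1 ha).2, (mPhi.1 hb').2] at this
        exact two_ne_zero (α := L) (by push_cast at this; linear_combination this)
    have hspan : Submodule.span L (Set.range ![P.root a, P.root b]) = U := by
      apply Submodule.eq_of_le_of_finrank_eq
      · rw [Submodule.span_le]
        rintro _ ⟨i, rfl⟩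
        fin_cases i
        · exact (mPhi.1 ha).1
        · exact (mPhi.1 hb').1
      · rw [finrank_span_eq_card hli, hr]; rfl
    rw [← hspan, Matrix.range_cons, Matrix.range_cons, Matrix.range_empty, Set.union_empty,
      Set.singleton_union, Submodule.mem_span_pair] at hv
    obtain ⟨x, y, rfl⟩ := hv
    simp [h1, h2]
  intro j hj
  induction j, hj using Nat.le_induction with
  | base =>
    rw [Finset.eq_empty_iff_forall_notMem]
    intro i hi
    rcases dec 3 i (by omega) hi with h | h
    · obtain ⟨m, hm, hma, e⟩ := decomp (by omega) hi ha h
      exact no3 ha hb' hab hi (d2 m hm) e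
    · obtain ⟨m, hm, hma, e⟩ := decomp (by omega) hi hb' h
      exact no3 hb' ha hab.symm hi (by rw [d2 m hm, add_comm]) e
  | succ n hn ih =>
    rw [Finset.eq_empty_iff_forall_notMem]
    intro i hi
    rcases dec (n + 1) i (by omega) hi with h | h
    · obtain ⟨m, hm, -⟩ := decomp (by omega) hi ha h
      simp [ih] at hm
    · obtain ⟨m, hm, -⟩ := decomp (by omega) hi hb' h
      simp [ih] at hm

end comb
end CVP

namespace CVP
open LieAlgebra Module

section eig
variable {L : Type*} [Field L] [CharZero L] {V : Type*} [AddCommGroup V] [Module L V]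

lemma aeval_eig {A : End L V} {v : V} {c : L} (h : A v = c • v) (q : Polynomial L) :
    Polynomial.aeval A q v = q.eval c • v := by
  induction q using Polynomial.induction_on' with
  | add p q hp hq => simp [hp, hq, add_smul]
  | monomial n a =>
    have : ∀ n : ℕ, (A ^ n) v = c ^ n • v := by
      intro n
      induction n with
      | zero => simp
      | succ n ih => rw [pow_succ', Module.End.mul_apply, ih, map_smul, h, smul_smul, pow_succ]
    simp [Polynomial.aeval_monomial, this, Module.algebraMap_end_apply, smul_smul, mul_comm]

lemma aeval_stable {A : End L V} {E : Submodule L V} (hE : ∀ v ∈ E, A v ∈ E) (q : Polynomial L)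
    {v : V} (hv : v ∈ E) : Polynomial.aeval A q v ∈ E := by
  induction q using Polynomial.induction_on' with
  | add p q hp hq => simpa using E.add_mem hp hq
  | monomial n a =>
    have : ∀ n : ℕ, (A ^ n) v ∈ E := by
      intro n
      induction n with
      | zero => simpa
      | succ n ih => rw [pow_succ', Module.End.mul_apply]; exact hE _ ih
    simpa [Polynomial.aeval_monomial, Module.algebraMap_end_apply] using E.smul_mem a (this n)

lemma eig_ind {A : End L V} {E : Submodule L V} (hE : ∀ v ∈ E, A v ∈ E) {p : V → Prop}
    (p0 : p 0) (padd : ∀ v w, p v → p w → p (v + w)) (N : ℕ)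
    (pe : ∀ i : ℕ, i < N → ∀ v ∈ E, A v = (i : L) • v → p v) :
    ∀ w ∈ E, Polynomial.aeval A
      (∏ i ∈ Finset.range N, (Polynomial.X - Polynomial.C (i : L))) w = 0 → p w := by
  induction N with
  | zero => intro w _ h; simp at h; rw [h]; exact p0
  | succ N ih =>
    intro w hw h
    set q := ∏ i ∈ Finset.range N, (Polynomial.X - Polynomial.C (i : L)) with hq
    have hqN : q.eval (N : L) ≠ 0 := by
      rw [hq, Polynomial.eval_prod, Finset.prod_ne_zero_iff]
      intro i hi
      simp only [Polynomial.eval_sub, Polynomial.eval_X, Polynomial.eval_C]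
      rw [sub_ne_zero]; exact_mod_cast (Finset.mem_range.1 hi).ne'
    rw [Finset.prod_range_succ, mul_comm, map_mul, Module.End.mul_apply] at h
    set z := Polynomial.aeval A q w with hz
    have hzE : z ∈ E := aeval_stable hE q hw
    have hAz : A z = (N : L) • z := by
      rw [map_sub, LinearMap.sub_apply, Polynomial.aeval_X, Polynomial.aeval_C,
        Module.algebraMap_end_apply, sub_eq_zero] at h
      exact h
    have h1 : p (w - (q.eval (N : L))⁻¹ • z) := by
      refine ih (fun i hi => pe i (by omega)) _ (E.sub_mem hw (E.smul_mem _ hzE)) ?_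
      rw [map_sub, map_smul, aeval_eig hAz q, smul_smul, inv_mul_cancel₀ hqN, one_smul, ← hz,
        sub_self]
    have h2 : p ((q.eval (N : L))⁻¹ • z) :=
      pe N (by omega) _ (E.smul_mem _ hzE) (by rw [map_smul, hAz, smul_comm])
    have := padd _ _ h1 h2
    rwa [sub_add_cancel] at this
end eig

section ctx
variable {L : Type*} [Field L]
  {G : Type*} [LieRing G] [LieAlgebra L G] [FiniteDimensional L G]

variable (L) in
/-- two commuting Jordan decompositions -/
structure Base (s1 s2 e f : G) : Prop where
  ss1 : (ad L G s1).IsSemisimple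
  ss2 : (ad L G s2).IsSemisimple
  ne : IsNilpotent (ad L G e)
  nf : IsNilpotent (ad L G f)
  c12 : ⁅s1, s2⁆ = 0
  c1e : ⁅s1, e⁆ = 0
  c1f : ⁅s1, f⁆ = 0
  c2e : ⁅s2, e⁆ = 0
  c2f : ⁅s2, f⁆ = 0
  cef : ⁅e, f⁆ = 0

variable (L) in
/-- the Levi subalgebra -/
def ll (s1 s2 : G) : Submodule L G := LinearMap.ker (ad L G s1) ⊓ LinearMap.ker (ad L G s2)

variable (L) in
def lw (s1 s2 h : G) (c : L) : Submodule L G :=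
  ll L s1 s2 ⊓ LinearMap.ker (ad L G h - algebraMap L (End L G) c)

lemma mll {s1 s2 v : G} : v ∈ ll L s1 s2 ↔ ⁅s1, v⁆ = 0 ∧ ⁅s2, v⁆ = 0 := by
  simp [ll]

lemma mlw {s1 s2 h v : G} {c : L} : v ∈ lw L s1 s2 h c ↔ v ∈ ll L s1 s2 ∧ ⁅h, v⁆ = c • v := by
  simp [lw, sub_eq_zero]

variable (L) in
def le (s1 s2 e : G) : Submodule L G := ll L s1 s2 ⊓ LinearMap.ker (ad L G e)

lemma mle {s1 s2 e v : G} : v ∈ le L s1 s2 e ↔ v ∈ ll L s1 s2 ∧ ⁅e, v⁆ = 0 := by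
  simp [le]

lemma brk {s a b : G} (ha : ⁅s, a⁆ = 0) (hb : ⁅s, b⁆ = 0) : ⁅s, ⁅a, b⁆⁆ = 0 := by
  rw [leibniz_lie, ha, hb]; simp

lemma sw {a b : G} (h : ⁅a, b⁆ = 0) : ⁅b, a⁆ = 0 := by rw [← lie_skew, h, neg_zero]

lemma ll_lie {s1 s2 a b : G} (ha : a ∈ ll L s1 s2) (hb : b ∈ ll L s1 s2) :
    ⁅a, b⁆ ∈ ll L s1 s2 := by
  rw [mll] at *; exact ⟨brk ha.1 hb.1, brk ha.2 hb.2⟩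

lemma kproj_ad {s a : G} (hs : (ad L G s).IsSemisimple) (h : ⁅s, a⁆ = 0) (v : G) :
    kproj hs ⁅a, v⁆ = ⁅a, kproj hs v⁆ := by
  refine kproj_comm hs (ad L G a).toAddMonoidHom (fun v => ?_) v
  show ⁅a, ⁅s, v⁆⁆ = ⁅s, ⁅a, v⁆⁆
  rw [leibniz_lie s a v, h, zero_lie, zero_add]

lemma kproj_kappa {s : G} (hs : (ad L G s).IsSemisimple) {w : G} (h : ⁅s, w⁆ = 0) (v : G) :
    killingForm L G (kproj hs v) w = killingForm L G v w := by
  obtain ⟨u, hu⟩ := kproj_sub hs v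
  have : killingForm L G (ad L G s u) w = 0 := by
    rw [ad_apply, kinv', h, map_zero, neg_zero]
  conv_rhs => rw [hu, map_add, LinearMap.add_apply, this, add_zero]

namespace Base
variable {s1 s2 e f : G} (B : Base L s1 s2 e f)
include B

/-- projection to l -/
def pl : End L G := kproj B.ss1 ∘ₗ kproj B.ss2

lemma pl_mem (v : G) : B.pl v ∈ ll L s1 s2 := by
  rw [mll]
  refine ⟨kproj_ker B.ss1 _, ?_⟩
  show ⁅s2, kproj B.ss1 _⁆ = 0
  rw [← kproj_ad B.ss1 B.c12]
  have : ⁅s2, kproj B.ss2 v⁆ = 0 := kproj_ker B.ss2 _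
  rw [this, map_zero]

lemma pl_of {v : G} (h : v ∈ ll L s1 s2) : B.pl v = v := by
  rw [mll] at h
  show kproj B.ss1 (kproj B.ss2 v) = v
  rw [kproj_of B.ss2 h.2, kproj_of B.ss1 h.1]

lemma pl_ad {a : G} (h : a ∈ ll L s1 s2) (v : G) : B.pl ⁅a, v⁆ = ⁅a, B.pl v⁆ := by
  rw [mll] at h
  show kproj B.ss1 (kproj B.ss2 _) = ⁅a, kproj B.ss1 (kproj B.ss2 _)⁆
  rw [kproj_ad B.ss2 h.2, kproj_ad B.ss1 h.1]

lemma pl_kappa {w : G} (h : w ∈ ll L s1 s2) (v : G) :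
    killingForm L G (B.pl v) w = killingForm L G v w := by
  rw [mll] at h
  show killingForm L G (kproj B.ss1 (kproj B.ss2 _)) w = _
  rw [kproj_kappa B.ss1 h.1, kproj_kappa B.ss2 h.2]

lemma e_mem : e ∈ ll L s1 s2 := mll.2 ⟨B.c1e, B.c2e⟩
lemma f_mem : f ∈ ll L s1 s2 := mll.2 ⟨B.c1f, B.c2f⟩
lemma s1_mem : s1 ∈ ll L s1 s2 := mll.2 ⟨lie_self _, sw B.c12⟩
lemma s2_mem : s2 ∈ ll L s1 s2 := mll.2 ⟨B.c12, lie_self _⟩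
lemma f_le : f ∈ le L s1 s2 e := mle.2 ⟨B.f_mem, B.cef⟩

end Base

lemma h_comm_e {e h v : G} (hhe : ⁅h, e⁆ = (2 : L) • e) : ⁅h, ⁅e, v⁆⁆ = ⁅e, ⁅h, v⁆⁆ + (2 : L) • ⁅e, v⁆ := by
  rw [leibniz_lie h e v, hhe, smul_lie, add_comm]

/-- weight projection lemma -/
lemma Base.wl {s1 s2 e f h : G} (B : Base L s1 s2 e f) (hh : (ad L G h).IsSemisimple)
    (hl : h ∈ ll L s1 s2)
    (hhe : ⁅h, e⁆ = (2 : L) • e) {c : L} {u v : G} (huv : ⁅e, u⁆ = v) (hv : v ∈ lw L s1 s2 h (c + 2)) :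
    ∃ u' ∈ lw L s1 s2 h c, ⁅e, u'⁆ = v := by
  have hA : (ad L G h - algebraMap L (End L G) c).IsSemisimple :=
    Module.End.isSemisimple_sub_algebraMap_iff.2 hh
  have hA2 : (ad L G h - algebraMap L (End L G) (c + 2)).IsSemisimple :=
    Module.End.isSemisimple_sub_algebraMap_iff.2 hh
  have hE : ∀ v ∈ ll L s1 s2, (ad L G h - algebraMap L (End L G) c) v ∈ ll L s1 s2 := by
    intro v hv
    exact Submodule.sub_mem _ (ll_lie hl hv) (Submodule.smul_mem _ c hv)
  obtain ⟨hm, w, hw, hd⟩ := ss_range_sub hA hE (B.pl_mem u)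
  have hk := kproj_ker hA (B.pl u)
  set u' := kproj hA (B.pl u)
  have hv' := mlw.1 hv
  have hu' : ⁅h, u'⁆ = c • u' := by
    simpa [sub_eq_zero, Module.algebraMap_end_apply] using hk
  have h1 : v = ⁅e, u'⁆ + ⁅e, (ad L G h - algebraMap L (End L G) c) w⁆ := by
    rw [← lie_add, ← hd, ← B.pl_ad B.e_mem, huv, B.pl_of hv'.1]
  have h2 : ⁅e, (ad L G h - algebraMap L (End L G) c) w⁆ =
      (ad L G h - algebraMap L (End L G) (c + 2)) ⁅e, w⁆ := by
    simp only [LinearMap.sub_apply, ad_apply, Module.algebraMap_end_apply, h_comm_e hhe, lie_sub,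
      lie_smul]
    module
  have h3 : (ad L G h - algebraMap L (End L G) (c + 2)) v = 0 := by
    rw [LinearMap.sub_apply, ad_apply, hv'.2, Module.algebraMap_end_apply, sub_self]
  have h4 : (ad L G h - algebraMap L (End L G) (c + 2)) ⁅e, u'⁆ = 0 := by
    simp only [LinearMap.sub_apply, ad_apply, Module.algebraMap_end_apply, h_comm_e hhe, hu',
      lie_smul]
    module
  have h5 : (ad L G h - algebraMap L (End L G) (c + 2)) ⁅e, w⁆ = 0 := by
    apply ss_ker hA2
    have := h3
    rw [h1, map_add, h4, zero_add, h2] at this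
    exact this
  refine ⟨u', mlw.2 ⟨hm, hu'⟩, ?_⟩
  rw [h1, h2, h5, add_zero]

variable (L) in
structure Trip (s1 s2 e f h u : G) : Prop extends Base L s1 s2 e f where
  ssh : (ad L G h).IsSemisimple
  hl : h ∈ ll L s1 s2
  ul : u ∈ ll L s1 s2
  he : ⁅h, e⁆ = (2 : L) • e
  eu : ⁅e, u⁆ = h
  hu : ⁅h, u⁆ = (-2 : L) • u

section
variable [CharZero L] [IsKilling L G]

lemma E_ind {s1 s2 e h u : G} (hl : h ∈ ll L s1 s2) (ne : IsNilpotent (ad L G e))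
    (eu : ⁅e, u⁆ = h) (he : ⁅h, e⁆ = (2 : L) • e) : ∃ N : ℕ, ∀ {p : G → Prop}
    (p0 : p 0) (padd : ∀ v w, p v → p w → p (v + w))
    (pe : ∀ i : ℕ, i < N → ∀ v ∈ le L s1 s2 e, ⁅h, v⁆ = (i : L) • v → p v),
    ∀ w ∈ le L s1 s2 e, p w := by
  obtain ⟨N, hN⟩ := ker_e_poly ne eu he
  refine ⟨N, fun {p} p0 padd pe w hw => ?_⟩
  refine eig_ind (A := ad L G h) (E := le L s1 s2 e) ?_ p0 padd N pe w hw (hN w (mle.1 hw).2)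
  intro v hv
  rw [mle] at hv ⊢
  refine ⟨ll_lie hl hv.1, ?_⟩
  rw [ad_apply, leibniz_lie, hv.2, ← lie_skew e h, he]; simp [hv.2]

lemma Ge_ind {e h u : G} (ne : IsNilpotent (ad L G e))
    (eu : ⁅e, u⁆ = h) (he : ⁅h, e⁆ = (2 : L) • e) {p : G → Prop}
    (p0 : p 0) (padd : ∀ v w, p v → p w → p (v + w))
    (pe : ∀ i : ℕ, ∀ v, ⁅e, v⁆ = 0 → ⁅h, v⁆ = (i : L) • v → p v) (w : G) (hw : ⁅e, w⁆ = 0) : p w := by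
  obtain ⟨N, hN⟩ := E_ind (L := L) (s1 := 0) (s2 := 0) (by simp [mll]) ne eu he
  exact hN p0 padd (fun i _ v hv => pe i v (mle.1 hv).2) w (by simp [mle, mll, hw])

variable [IsAlgClosed L]

lemma Base.exists_trip {s1 s2 e f : G} (B : Base L s1 s2 e f) : ∃ h u, Trip L s1 s2 e f h u := by
  obtain ⟨u0, hu0⟩ := CVP.e_mem (L := L) B.ne
  set u1 := B.pl ((-2 : L) • u0) with hu1
  have hu1l : u1 ∈ ll L s1 s2 := B.pl_mem _
  set h0 := ⁅e, u1⁆ with hh0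
  have hh0l : h0 ∈ ll L s1 s2 := ll_lie B.e_mem hu1l
  have hh0e : ⁅h0, e⁆ = (2 : L) • e := by
    rw [← lie_skew, hh0, hu1, ← B.pl_ad B.e_mem, ← B.pl_ad B.e_mem, lie_smul, lie_smul, hu0, map_smul,
      B.pl_of B.e_mem]; module
  obtain ⟨hs, hn, hsum, hss, hnil, hc0, hc⟩ := jordan (L := L) h0
  have hhse : ⁅hs, e⁆ = (2 : L) • e := hc _ _ hh0e
  have hhsl : hs ∈ ll L s1 s2 := by
    rw [mll] at hh0l ⊢
    exact ⟨sw (hc0 _ (sw hh0l.1)), sw (hc0 _ (sw hh0l.2))⟩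
  have hn0 : ∀ w : G, ⁅e, w⁆ = 0 → ⁅hn, w⁆ = 0 := by
    refine Ge_ind B.ne rfl hh0e (p := fun w => ⁅hn, w⁆ = 0) (by simp)
      (fun v w hv hw => by rw [lie_add, hv, hw, add_zero]) ?_
    intro i v hv hi
    have h1 := hc _ _ hi
    have : hn = h0 - hs := by rw [hsum]; abel
    rw [this, sub_lie, hi, h1, sub_self]
  obtain ⟨u2, hu2⟩ := range_perp (L := L) (e := e) (v := hn) fun w hw => nil_comm hnil (hn0 w hw)
  have h3 : ⁅e, u1 - u2⁆ = hs := by rw [lie_sub, hu2, ← hh0, hsum]; abel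
  obtain ⟨u', hu', h4⟩ := B.wl hss hhsl hhse (c := -2) h3 (mlw.2 ⟨hhsl, by simp⟩)
  rw [mlw] at hu'
  exact ⟨hs, u', { toBase := B, ssh := hss, hl := hhsl, ul := hu'.1, he := hhse, eu := h4, hu := hu'.2 }⟩
end
end ctx
end CVP

namespace CVP
open LieAlgebra Module

/-- rank-nullity on a submodule -/
lemma rn {L V W : Type*} [Field L] [AddCommGroup V] [Module L V] [FiniteDimensional L V]
    [AddCommGroup W] [Module L W] (f : V →ₗ[L] W) (M : Submodule L V) :
    finrank L ↥(M ⊓ LinearMap.ker f) + finrank L ↥(M.map f) = finrank L M := by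
  have h := LinearMap.finrank_range_add_finrank_ker (f.domRestrict M)
  rw [LinearMap.range_domRestrict, LinearMap.ker_domRestrict] at h
  have h2 : finrank L ↥((LinearMap.ker f).comap M.subtype) = finrank L ↥(M ⊓ LinearMap.ker f) := by
    rw [← Submodule.finrank_map_subtype_eq, Submodule.map_comap_subtype]
  omega

section
variable {L : Type*} [Field L] [CharZero L]
  {G : Type*} [LieRing G] [LieAlgebra L G] [FiniteDimensional L G] [IsKilling L G]

/-- eigenvectors of different weights are orthogonal -/
lemma k_orth {h v w : G} {c d : L} (hv : ⁅h, v⁆ = c • v) (hw : ⁅h, w⁆ = d • w) (hcd : c + d ≠ 0) :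
    killingForm L G v w = 0 := by
  have h1 := kinv' (L := L) h v w
  rw [hv, hw] at h1
  simp only [map_smul, LinearMap.smul_apply, smul_eq_mul] at h1
  have : (c + d) * killingForm L G v w = 0 := by rw [add_mul, h1]; ring
  exact (mul_eq_zero.1 this).resolve_left hcd

namespace Trip
variable {s1 s2 e f h u : G} (T : Trip L s1 s2 e f h u)
include T

lemma e2 : e ∈ lw L s1 s2 h 2 := mlw.2 ⟨T.e_mem, T.he⟩

lemma le_ind : ∃ N : ℕ, ∀ {p : G → Prop}
    (_ : p 0) (_ : ∀ v w, p v → p w → p (v + w))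
    (_ : ∀ i : ℕ, i < N → ∀ v ∈ le L s1 s2 e, v ∈ lw L s1 s2 h i → p v),
    ∀ w ∈ le L s1 s2 e, p w := by
  obtain ⟨N, hN⟩ := E_ind T.hl T.ne T.eu T.he
  exact ⟨N, fun p0 pa pe => hN p0 pa fun i hi v hv hi' => pe i hi v hv (mlw.2 ⟨(mle.1 hv).1, hi'⟩)⟩

lemma surj {c : L} (hc : ∀ i : ℕ, c + 2 + i ≠ 0) {v : G} (hv : v ∈ lw L s1 s2 h (c + 2)) :
    ∃ u ∈ lw L s1 s2 h c, ⁅e, u⁆ = v := by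
  obtain ⟨u0, hu0⟩ : ∃ u0, ⁅e, u0⁆ = v := by
    apply range_perp (L := L)
    refine Ge_ind T.ne T.eu T.he (by simp) (fun v w hv hw => by rw [map_add, hv, hw, add_zero]) ?_
    intro i w _ hw
    exact k_orth (mlw.1 hv).2 hw (hc i)
  exact T.wl T.ssh T.hl T.he hu0 hv

lemma e_lw {c : L} {v : G} (hv : v ∈ lw L s1 s2 h c) : ⁅e, v⁆ ∈ lw L s1 s2 h (c + 2) := by
  rw [mlw] at *
  refine ⟨ll_lie T.e_mem hv.1, ?_⟩
  rw [h_comm_e T.he, hv.2, lie_smul]; module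

lemma dim_step {c : L} (hc : ∀ i : ℕ, c + 2 + i ≠ 0) :
    finrank L ↥(le L s1 s2 e ⊓ lw L s1 s2 h c) + finrank L (lw L s1 s2 h (c + 2)) =
      finrank L (lw L s1 s2 h c) := by
  have h1 := rn (ad L G e) (lw L s1 s2 h c)
  have h2 : (lw L s1 s2 h c).map (ad L G e : End L G) = lw L s1 s2 h (c + 2) := by
    apply le_antisymm
    · rintro _ ⟨v, hv, rfl⟩; exact T.e_lw hv
    · intro v hv
      obtain ⟨u, hu, h⟩ := T.surj hc hv
      exact ⟨u, hu, h⟩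
  have h3 : le L s1 s2 e ⊓ lw L s1 s2 h c = lw L s1 s2 h c ⊓ LinearMap.ker (ad L G e) := by
    ext v
    simp only [Submodule.mem_inf, mle, mlw, LinearMap.mem_ker, ad_apply]; tauto
  rw [h2] at h1
  rw [h3, h1]

lemma nz (c : ℤ) (hc : -1 ≤ c) (i : ℕ) : (c : L) + 2 + i ≠ 0 := by
  have : ((c + 2 + i : ℤ) : L) ≠ 0 := by rw [Int.cast_ne_zero]; omega
  simpa using this

lemma dim_stepN (i : ℕ) :
    finrank L ↥(le L s1 s2 e ⊓ lw L s1 s2 h (i : L)) + finrank L (lw L s1 s2 h ((i + 2 : ℕ) : L)) =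
      finrank L (lw L s1 s2 h (i : L)) := by
  have := T.dim_step (c := (i : L)) (fun j => by simpa using T.nz i (by omega) j)
  rw [← this, Nat.cast_add, Nat.cast_ofNat]

lemma dim_le : finrank L (le L s1 s2 e) ≤
    finrank L (lw L s1 s2 h 0) + finrank L (lw L s1 s2 h 1) := by
  obtain ⟨N, hN⟩ := T.le_ind
  have h1 : ∀ n : ℕ, finrank L ↥(⨆ i ∈ Finset.range n, le L s1 s2 e ⊓ lw L s1 s2 h ((i : ℕ) : L))
     + finrank L (lw L s1 s2 h (n : L)) + finrank L (lw L s1 s2 h ((n + 1 : ℕ) : L)) ≤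
      finrank L (lw L s1 s2 h 0) + finrank L (lw L s1 s2 h 1) := by
    intro n
    induction n with
    | zero =>
      have : (⨆ i ∈ Finset.range 0, le L s1 s2 e ⊓ lw L s1 s2 h ((i : ℕ) : L)) = ⊥ := by simp
      rw [this, finrank_bot, Nat.cast_zero, zero_add, zero_add, Nat.cast_one]
    | succ n ih =>
      have h3 := T.dim_stepN n
      have h4 : (⨆ i ∈ Finset.range (n + 1), le L s1 s2 e ⊓ lw L s1 s2 h ((i : ℕ) : L)) =
        (⨆ i ∈ Finset.range n, le L s1 s2 e ⊓ lw L s1 s2 h ((i : ℕ) : L)) ⊔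
          (le L s1 s2 e ⊓ lw L s1 s2 h (n : L)) := by
        rw [Finset.range_add_one, Finset.iSup_insert, sup_comm]
      have h5 := Submodule.finrank_add_le_finrank_add_finrank
        (⨆ i ∈ Finset.range n, le L s1 s2 e ⊓ lw L s1 s2 h ((i : ℕ) : L))
          (le L s1 s2 e ⊓ lw L s1 s2 h (n : L))
      rw [h4]
      have h6 : n + 1 + 1 = n + 2 := rfl
      rw [h6]
      omega
  have h2 : le L s1 s2 e ≤ ⨆ i ∈ Finset.range N, le L s1 s2 e ⊓ lw L s1 s2 h ((i : ℕ) : L) := by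
    intro w hw
    refine hN (p := fun w => w ∈ ⨆ i ∈ Finset.range N, le L s1 s2 e ⊓ lw L s1 s2 h ((i : ℕ) : L))
      (Submodule.zero_mem _) (fun v w hv hw => Submodule.add_mem _ hv hw) ?_ w hw
    intro i hi v hv hv'
    exact Submodule.mem_iSup_of_mem i (Submodule.mem_iSup_of_mem (Finset.mem_range.2 hi) ⟨hv, hv'⟩)
  have := h1 N
  have := Submodule.finrank_mono h2
  omega

lemma dim_C0 : finrank L ↥(le L s1 s2 e ⊓ lw L s1 s2 h 0) + finrank L (lw L s1 s2 h 2) =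
      finrank L (lw L s1 s2 h 0) := by
  have := T.dim_stepN 0
  rwa [Nat.cast_zero, zero_add, Nat.cast_ofNat] at this

lemma nd0 {a : G} (ha : a ∈ le L s1 s2 e ⊓ lw L s1 s2 h 0)
    (hk : ∀ w ∈ le L s1 s2 e ⊓ lw L s1 s2 h 0, killingForm L G a w = 0) : a = 0 := by
  have h0 : ⁅h, a⁆ = 0 := by simpa using (mlw.1 ha.2).2
  refine ker_e_h_im T.ne T.eu T.he (mle.1 ha.1).2 h0 ?_
  apply range_perp (L := L)
  obtain ⟨N, hN⟩ := T.le_ind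
  have : ∀ w ∈ le L s1 s2 e, killingForm L G a w = 0 := by
    refine hN (p := fun w => killingForm L G a w = 0) (by simp)
      (fun v w hv hw => by rw [map_add, hv, hw, add_zero]) ?_
    intro i hi v hv hv'
    by_cases hi0 : i = 0
    · subst hi0; exact hk v ⟨hv, by simpa using hv'⟩
    · exact k_orth (mlw.1 ha.2).2 (mlw.1 hv').2 (by simpa using hi0)
  intro w hw
  rw [ksymm, ← T.pl_kappa (mle.1 ha.1).1, ksymm]
  apply this
  exact mle.2 ⟨T.pl_mem _, by rw [← T.pl_ad T.e_mem, hw, map_zero]⟩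

/-- perfect-ness of the pairing of weights `i` and `-i` in l -/
lemma nd {c : L} {a : G} (ha : a ∈ lw L s1 s2 h c)
    (hk : ∀ w ∈ lw L s1 s2 h (-c), killingForm L G a w = 0) : a = 0 := by
  apply knd (L := L)
  intro y
  rw [ksymm, ← T.pl_kappa (mlw.1 ha).1]
  have hA : (ad L G h - algebraMap L (End L G) (-c)).IsSemisimple :=
    Module.End.isSemisimple_sub_algebraMap_iff.2 T.ssh
  have hE : ∀ v ∈ ll L s1 s2, (ad L G h - algebraMap L (End L G) (-c)) v ∈ ll L s1 s2 := by
    intro v hv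
    exact Submodule.sub_mem _ (ll_lie T.hl hv) (Submodule.smul_mem _ _ hv)
  obtain ⟨hm, w, hw, hd⟩ := ss_range_sub hA hE (T.pl_mem y)
  have h1 := kproj_ker hA (T.pl y)
  rw [hd, map_add, LinearMap.add_apply, ksymm, hk, zero_add]
  · simp only [LinearMap.sub_apply, ad_apply, Module.algebraMap_end_apply, map_sub, map_smul, kinv',
      (mlw.1 ha).2, LinearMap.smul_apply]
    simp
  · refine mlw.2 ⟨hm, ?_⟩
    rwa [LinearMap.sub_apply, Module.algebraMap_end_apply, sub_eq_zero] at h1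

lemma ph_mem {a : G} (ha : a ∈ le L s1 s2 e) : kproj T.ssh a ∈ le L s1 s2 e ⊓ lw L s1 s2 h 0 ∧
    ∃ w ∈ le L s1 s2 e, a = kproj T.ssh a + ⁅h, w⁆ := by
  obtain ⟨hm, w, hw, hd⟩ := ss_range_sub T.ssh (M := le L s1 s2 e) (fun v hv => by
    rw [mle] at hv ⊢
    refine ⟨ll_lie T.hl hv.1, ?_⟩
    rw [ad_apply, leibniz_lie, hv.2, ← lie_skew e h, T.he]; simp [hv.2]) ha
  refine ⟨⟨hm, mlw.2 ⟨(mle.1 hm).1, ?_⟩⟩, w, hw, hd⟩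
  have := kproj_ker T.ssh a
  simpa using this

lemma ph_wt {a : G} {i : L} (ha : ⁅h, a⁆ = i • a) (hi : i ≠ 0) : kproj T.ssh a = 0 := by
  have : a = ad L G h (i⁻¹ • a) := by rw [map_smul, ad_apply, ha, smul_smul, inv_mul_cancel₀ hi, one_smul]
  rw [this, kproj_range]

/-- the weight zero projection is multiplicative on `le` -/
lemma ph_lie {a b : G} (ha : a ∈ le L s1 s2 e) (hb : b ∈ le L s1 s2 e) :
    kproj T.ssh ⁅a, b⁆ = ⁅kproj T.ssh a, kproj T.ssh b⁆ := by
  obtain ⟨N, hN⟩ := T.le_ind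
  refine hN (p := fun a => kproj T.ssh ⁅a, b⁆ = ⁅kproj T.ssh a, kproj T.ssh b⁆) (by simp)
    (fun v w hv hw => by rw [add_lie, map_add, hv, hw, map_add, add_lie]) ?_ a ha
  intro i _ v hv hi
  refine hN (p := fun b => kproj T.ssh ⁅v, b⁆ = ⁅kproj T.ssh v, kproj T.ssh b⁆) (by simp)
    (fun x w hv hw => by rw [lie_add, map_add, hv, hw, map_add, lie_add]) ?_ b hb
  intro j _ w hw hj
  have hij : ⁅h, ⁅v, w⁆⁆ = ((i + j : ℕ) : L) • ⁅v, w⁆ := by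
    rw [leibniz_lie, (mlw.1 hi).2, (mlw.1 hj).2, smul_lie, lie_smul]; push_cast; module
  by_cases h0 : i + j = 0
  · have hi0 : i = 0 := by omega
    have hj0 : j = 0 := by omega
    subst hi0; subst hj0
    rw [kproj_of, kproj_of, kproj_of]
    · simpa using (mlw.1 hj).2
    · simpa using (mlw.1 hi).2
    · simpa using hij
  · rw [T.ph_wt hij (by exact_mod_cast h0)]
    by_cases hi0 : i = 0
    · rw [T.ph_wt (mlw.1 hj).2 (by simp; omega), lie_zero]
    · rw [T.ph_wt (mlw.1 hi).2 (by simpa using hi0), zero_lie]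

end Trip
end
end CVP

namespace CVP
open LieAlgebra Module

section
variable {L : Type*} [Field L] [CharZero L]
  {G : Type*} [LieRing G] [LieAlgebra L G] [FiniteDimensional L G]

/-- semi-derivations -/
structure IsSD (δ : Derivation ℤ L L) (D : G →+ G) : Prop where
  lie : ∀ a b, D ⁅a, b⁆ = ⁅D a, b⁆ + ⁅a, D b⁆
  smul : ∀ (c : L) v, D (c • v) = δ c • v + c • D v
  kap : ∀ a b, killingForm L G (D a) b + killingForm L G a (D b) = δ (killingForm L G a b)

/-- add an inner derivation -/
def addad (L : Type*) [Field L] {G : Type*} [LieRing G] [LieAlgebra L G] (D : G →+ G) (a : G) :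
    G →+ G := D + (ad L G a).toAddMonoidHom

lemma addad_apply (D : G →+ G) (a v : G) : addad L D a v = D v + ⁅a, v⁆ := rfl

lemma IsSD.add {δ : Derivation ℤ L L} {D : G →+ G} (h : IsSD δ D) (a : G) : IsSD δ (addad L D a) where
  lie x y := by
    simp only [addad_apply, h.lie, add_lie, lie_add]
    rw [leibniz_lie a x y]; abel
  smul c v := by simp only [addad_apply, h.smul, lie_smul]; module
  kap x y := by
    simp only [addad_apply, map_add, LinearMap.add_apply]
    rw [← h.kap, kinv']; ring

variable (L) in
/-- centre of l -/
def zl (s1 s2 : G) : Submodule L G where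
  carrier := {z | z ∈ ll L s1 s2 ∧ ∀ w ∈ ll L s1 s2, ⁅z, w⁆ = 0}
  add_mem' := fun ha hb => ⟨Submodule.add_mem _ ha.1 hb.1, fun w hw => by
    rw [add_lie, ha.2 w hw, hb.2 w hw, add_zero]⟩
  zero_mem' := ⟨Submodule.zero_mem _, by simp⟩
  smul_mem' := fun c z hz => ⟨Submodule.smul_mem _ c hz.1, fun w hw => by
    rw [smul_lie, hz.2 w hw, smul_zero]⟩

lemma mzl {s1 s2 z : G} : z ∈ zl L s1 s2 ↔ z ∈ ll L s1 s2 ∧ ∀ w ∈ ll L s1 s2, ⁅z, w⁆ = 0 := Iff.rfl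

lemma IsSD.pres {δ : Derivation ℤ L L} {D : G →+ G} (h : IsSD δ D) {s1 s2 : G}
    (h1 : D s1 ∈ zl L s1 s2) (h2 : D s2 ∈ zl L s1 s2) {v : G} (hv : v ∈ ll L s1 s2) :
    D v ∈ ll L s1 s2 := by
  have hv' := mll.1 hv
  rw [mll]
  constructor
  · have := h.lie s1 v
    rw [hv'.1, map_zero, h1.2 v hv, zero_add] at this; exact this.symm
  · have := h.lie s2 v
    rw [hv'.2, map_zero, h2.2 v hv, zero_add] at this; exact this.symm

lemma IsSD.presz {δ : Derivation ℤ L L} {D : G →+ G} (h : IsSD δ D) {s1 s2 : G}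
    (h1 : D s1 ∈ zl L s1 s2) (h2 : D s2 ∈ zl L s1 s2) {v : G} (hv : v ∈ zl L s1 s2) :
    D v ∈ zl L s1 s2 := by
  refine ⟨h.pres h1 h2 hv.1, fun w hw => ?_⟩
  have := h.lie v w
  rw [hv.2 w hw, map_zero, hv.2 _ (h.pres h1 h2 hw), add_zero] at this; exact this.symm

/-- normalized derivation -/
structure Nm (L : Type*) [Field L] {G : Type*} [LieRing G] [LieAlgebra L G] [FiniteDimensional L G]
    (s1 s2 e h : G) (δ : Derivation ℤ L L) (D : G →+ G) : Prop extends IsSD δ D where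
  d1 : D s1 ∈ zl L s1 s2
  d2 : D s2 ∈ zl L s1 s2
  de : D e = 0
  dh : D h = 0

lemma Base.norm1 {s1 s2 e f : G} (B : Base L s1 s2 e f) {δ : Derivation ℤ L L} {D : G →+ G} (hD : IsSD δ D) :
    ∃ (b : G), addad L D b s1 ∈ zl L s1 s2 ∧ addad L D b s2 ∈ zl L s1 s2 := by
  obtain ⟨b1, hb1⟩ := kproj_sub B.ss1 (D s1)
  set w1 := kproj B.ss1 (D s1)
  have hw1 : ⁅s1, w1⁆ = 0 := kproj_ker B.ss1 _
  set D1 := addad L D b1 with hD1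
  have hD1s : IsSD δ D1 := hD.add b1
  have hD11 : D1 s1 = w1 := by
    rw [hD1, addad_apply, hb1, ad_apply, ← lie_skew b1 s1]; abel
  have h12 := hD1s.lie s1 s2
  rw [B.c12, map_zero, hD11] at h12
  have hws : ⁅s1, ⁅w1, s2⁆⁆ = 0 := brk hw1 B.c12
  have h1D : ⁅s1, D1 s2⁆ = 0 := by
    apply ss_ker B.ss1
    have : ⁅s1, D1 s2⁆ = - ⁅w1, s2⁆ := by rw [eq_neg_iff_add_eq_zero, add_comm]; exact h12.symm
    rw [ad_apply, ad_apply, this, lie_neg, hws, neg_zero]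
  have hws2 : ⁅w1, s2⁆ = 0 := by rw [h1D, add_zero] at h12; exact h12.symm
  obtain ⟨hm, b2, hb2, hd⟩ := ss_range_sub B.ss2 (M := LinearMap.ker (ad L G s1)) (v := D1 s2)
    (fun v hv => by
      rw [LinearMap.mem_ker, ad_apply] at hv ⊢
      exact brk B.c12 hv) h1D
  have hw2 := kproj_ker B.ss2 (D1 s2)
  set w2 := kproj B.ss2 (D1 s2)
  rw [LinearMap.mem_ker, ad_apply] at hb2 hm
  rw [ad_apply] at hd hw2
  set D2 := addad L D1 b2 with hD2
  have hD2s : IsSD δ D2 := hD1s.add b2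
  have h21 : D2 s1 = w1 := by rw [hD2, addad_apply, hD11, sw hb2, add_zero]
  have h22 : D2 s2 = w2 := by rw [hD2, addad_apply, hd, ← lie_skew b2 s2]; abel
  have hl1 : w1 ∈ ll L s1 s2 := mll.2 ⟨hw1, sw hws2⟩
  have hl2 : w2 ∈ ll L s1 s2 := mll.2 ⟨hm, hw2⟩
  have hz : ∀ s w : G, (ad L G s).IsSemisimple → D2 s = w → (∀ v ∈ ll L s1 s2, ⁅s, v⁆ = 0) →
      w ∈ ll L s1 s2 → ∀ v ∈ ll L s1 s2, ⁅w, v⁆ = 0 := by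
    intro s w hs hDs hsl hw v hv
    have := hD2s.lie s v
    rw [hsl v hv, map_zero, hDs] at this
    have h3 : ⁅s, D2 v⁆ = - ⁅w, v⁆ := by rw [eq_neg_iff_add_eq_zero, add_comm]; exact this.symm
    have h4 : ⁅s, D2 v⁆ = 0 := by
      apply ss_ker hs
      rw [ad_apply, ad_apply, h3, lie_neg, hsl _ (ll_lie hw hv), neg_zero]
    rw [h4, add_zero] at this; exact this.symm
  have e12 : ∀ v, addad L D (b1 + b2) v = D2 v := by
    intro v; simp only [hD2, hD1, addad_apply, add_lie]; abel
  refine ⟨b1 + b2, ?_, ?_⟩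
  · rw [e12, h21]
    exact ⟨hl1, hz s1 w1 B.ss1 h21 (fun v hv => (mll.1 hv).1) hl1⟩
  · rw [e12, h22]
    exact ⟨hl2, hz s2 w2 B.ss2 h22 (fun v hv => (mll.1 hv).2) hl2⟩

variable [IsKilling L G]
variable {s1 s2 e f h u : G}

lemma addad_add (D : G →+ G) (a b : G) : addad L (addad L D a) b = addad L D (a + b) := by
  ext v; simp only [addad_apply, add_lie]; abel

lemma Trip.norm (T : Trip L s1 s2 e f h u) {δ : Derivation ℤ L L} {D : G →+ G} (hD : IsSD δ D) :
    ∃ b, Nm L s1 s2 e h δ (addad L D b) := by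
  obtain ⟨b, h1, h2⟩ := T.norm1 hD
  have hsd : ∀ b, IsSD δ (addad L D b) := fun b => hD.add b
  have hb : ∀ b a, a ∈ ll L s1 s2 → addad L D b s1 ∈ zl L s1 s2 → addad L D b s2 ∈ zl L s1 s2 →
      addad L D (b + a) s1 ∈ zl L s1 s2 ∧ addad L D (b + a) s2 ∈ zl L s1 s2 := by
    intro b a ha h1 h2
    rw [mll] at ha
    rw [← addad_add, addad_apply (L := L) (addad L D b) a s1, addad_apply (L := L) (addad L D b) a s2,
      sw ha.1, sw ha.2, add_zero, add_zero]
    exact ⟨h1, h2⟩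
  have d2 : δ 2 = 0 := by
    have := δ.map_natCast 2
    simpa using this
  -- kill D e
  set D1 := addad L D b with hD1
  have hs1 : IsSD δ D1 := hsd b
  have hDe : (2 : L) • D1 e = ⁅D1 h, e⁆ + ⁅h, D1 e⁆ := by
    rw [← hs1.lie, T.he, hs1.smul, d2, zero_smul, zero_add]
  obtain ⟨a0, ha0⟩ : ∃ a0, ⁅e, a0⁆ = D1 e := by
    apply range_perp (L := L)
    refine Ge_ind T.ne T.eu T.he (by simp) (fun v w hv hw => by rw [map_add, hv, hw, add_zero]) ?_
    intro i w hw hi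
    have h3 := congrArg (fun v => killingForm L G v w) hDe
    simp only [map_smul, map_add, LinearMap.add_apply, LinearMap.smul_apply, kinv, hw, map_zero,
      zero_add] at h3
    rw [← kinv, kinv', hi, map_smul, smul_eq_mul, smul_eq_mul] at h3
    have h4 : ((2 + i : ℕ) : L) * killingForm L G (D1 e) w = 0 := by
      push_cast; rw [add_mul, h3]; ring
    exact (mul_eq_zero.1 h4).resolve_left (Nat.cast_ne_zero.2 (by omega))
  set a := T.pl a0
  have ha : a ∈ ll L s1 s2 := T.pl_mem _
  have hea : ⁅e, a⁆ = D1 e := by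
    rw [← T.pl_ad T.e_mem, ha0, T.pl_of (hs1.pres h1 h2 T.e_mem)]
  obtain ⟨h1', h2'⟩ := hb b a ha h1 h2
  have he' : addad L D (b + a) e = 0 := by
    rw [← addad_add, addad_apply, ← hD1, ← hea, ← lie_skew a e]; abel
  -- kill D h
  have hs2 : IsSD δ (addad L D (b + a)) := hsd _
  have hDh : addad L D (b + a) h ∈ le L s1 s2 e := by
    refine mle.2 ⟨hs2.pres h1' h2' T.hl, ?_⟩
    have := hs2.lie h e
    rw [T.he, hs2.smul, d2, he'] at this
    simp only [zero_smul, smul_zero, lie_zero, add_zero] at this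
    exact sw this.symm
  obtain ⟨hc, n, hn, hcn⟩ := T.ph_mem hDh
  obtain ⟨h1'', h2''⟩ := hb (b + a) n (mle.1 hn).1 h1' h2'
  have he'' : addad L D (b + a + n) e = 0 := by
    rw [← addad_add, addad_apply, he', sw (mle.1 hn).2, add_zero]
  set c := kproj T.ssh (addad L D (b + a) h)
  have hh'' : addad L D (b + a + n) h = c := by
    rw [← addad_add, addad_apply, hcn, ← lie_skew n h]; abel
  have hc0 : c = 0 := by
    refine ker_e_h_im T.ne T.eu T.he (mle.1 hc.1).2 (by simpa using (mlw.1 hc.2).2)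
      ⟨addad L D (b + a + n) u, ?_⟩
    have := (hsd (b + a + n)).lie e u
    rw [T.eu, hh'', he'', zero_lie, zero_add] at this
    exact this.symm
  exact ⟨b + a + n, { toIsSD := hsd _, d1 := h1'', d2 := h2'', de := he'', dh := by rw [hh'', hc0] }⟩

variable {δ : Derivation ℤ L L} {D : G →+ G}

lemma Nm.df (N : Nm L s1 s2 e h δ D) {v : G} (hv : v ∈ le L s1 s2 e) : D v ∈ le L s1 s2 e := by
  rw [mle] at hv ⊢
  refine ⟨N.pres N.d1 N.d2 hv.1, ?_⟩
  have := N.lie e v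
  rw [hv.2, map_zero, N.de, zero_lie, zero_add] at this; exact this.symm

lemma Nm.kz (T : Trip L s1 s2 e f h u) (N : Nm L s1 s2 e h δ D) {z : G} (hz : z ∈ zl L s1 s2) :
    killingForm L G (D f) z = 0 := by
  have hk : ∀ z ∈ zl L s1 s2, killingForm L G f z = 0 := fun z hz =>
    nil_comm T.nf (sw (hz.2 f T.f_mem))
  have := N.kap f z
  rw [hk z hz, hk _ (N.presz N.d1 N.d2 hz), map_zero, add_zero] at this
  exact this

lemma Nm.ph (T : Trip L s1 s2 e f h u) (N : Nm L s1 s2 e h δ D) (v : G) :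
    kproj T.ssh (D v) = D (kproj T.ssh v) := by
  apply kproj_comm
  intro v
  rw [ad_apply, N.lie, N.dh, zero_lie, zero_add, ad_apply]

lemma Nm.kf (T : Trip L s1 s2 e f h u) (N : Nm L s1 s2 e h δ D)
    (h0 : killingForm L G (kproj T.ssh f) (kproj T.ssh f) = 0) :
    killingForm L G (D f) (kproj T.ssh f) = 0 := by
  have hk := kproj_ker T.ssh f
  rw [ad_apply] at hk
  rw [← kproj_kappa T.ssh hk, N.ph T]
  have := N.kap (kproj T.ssh f) (kproj T.ssh f)
  rw [h0, map_zero, ksymm (kproj T.ssh f)] at this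
  exact add_self_eq_zero.1 this

lemma Nm.kc (T : Trip L s1 s2 e f h u) (N : Nm L s1 s2 e h δ D)
    (h0 : kproj T.ssh f = 0) {c : G} (hc : ⁅h, c⁆ = 0) :
    killingForm L G (D f) c = 0 := by
  rw [← kproj_kappa T.ssh hc, N.ph T, h0, map_zero, map_zero, LinearMap.zero_apply]

lemma zl_C0 (T : Trip L s1 s2 e f h u) : zl L s1 s2 ≤ le L s1 s2 e ⊓ lw L s1 s2 h 0 := by
  intro z hz
  exact ⟨mle.2 ⟨hz.1, sw (hz.2 _ T.e_mem)⟩, mlw.2 ⟨hz.1, by rw [sw (hz.2 _ T.hl), zero_smul]⟩⟩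

end
end CVP

namespace CVP
open LieAlgebra Module

section
variable {L : Type*} [Field L] [CharZero L]
  {G : Type*} [LieRing G] [LieAlgebra L G] [FiniteDimensional L G]

/-- all elements of W come from semiderivations -/
def WD (x y : G) (W : Submodule L (G × G)) : Prop :=
  ∀ w ∈ W, ∃ (δ : Derivation ℤ L L) (D : G →+ G), IsSD δ D ∧ w = (D x, D y)

variable [IsKilling L G]
variable {s1 s2 e f h u : G}

lemma fprod (p q : Submodule L G) : finrank L ↥(p.prod q) = finrank L p + finrank L q := by
  have h1 : LinearMap.range (p.subtype.prodMap q.subtype) = p.prod q := by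
    rw [LinearMap.range_prodMap, Submodule.range_subtype, Submodule.range_subtype]
  have h2 : Function.Injective (p.subtype.prodMap q.subtype) :=
    Function.Injective.prodMap p.injective_subtype q.injective_subtype
  rw [← h1, LinearMap.finrank_range_of_inj h2, finrank_prod]

lemma count1 (T : Trip L s1 s2 e f h u) {W : Submodule L (G × G)} (hW : WD (s1 + e) (s2 + f) W)
    (hz : ∀ a, ⁅s1 + e, a⁆ = 0 → ⁅s2 + f, a⁆ = 0 → a ∈ le L s1 s2 e) (N : Submodule L G)
    (hN1 : ∀ δ D, Nm L s1 s2 e h δ D → D f ∈ N) (hN2 : ∀ a ∈ le L s1 s2 e, ⁅a, f⁆ ∈ N) :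
    finrank L W + finrank L (le L s1 s2 e) ≤ finrank L G + 2 * finrank L (zl L s1 s2) + finrank L N := by
  let τ : G →ₗ[L] G × G := (ad L G (s1 + e)).prod (ad L G (s2 + f))
  have hWle : W ≤ (LinearMap.range τ ⊔ Submodule.prod ⊥ N) ⊔ (zl L s1 s2).prod (zl L s1 s2) := by
    intro w hw
    obtain ⟨δ, D, hD, rfl⟩ := hW w hw
    obtain ⟨b, hb⟩ := T.norm hD
    have hD' : ∀ v, D v = ⁅v, b⁆ + addad L D b v := by
      intro v; rw [addad_apply, ← lie_skew b v]; abel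
    have : (D (s1 + e), D (s2 + f)) = τ b + ((0, addad L D b f) + (addad L D b s1, addad L D b s2)) := by
      rw [hD', hD', map_add, map_add, hb.de]
      show _ = (⁅s1 + e, b⁆, ⁅s2 + f, b⁆) + _
      simp only [Prod.mk_add_mk, Prod.mk.injEq]
      constructor <;> abel
    rw [this, ← add_assoc]
    refine Submodule.add_mem_sup (Submodule.add_mem_sup ⟨b, rfl⟩ ?_) ?_
    · exact ⟨Submodule.zero_mem _, hN1 _ _ hb⟩
    · exact ⟨hb.d1, hb.d2⟩
  have h1 := Submodule.finrank_mono hWle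
  have h2 := Submodule.finrank_add_le_finrank_add_finrank (LinearMap.range τ ⊔ Submodule.prod ⊥ N)
    ((zl L s1 s2).prod (zl L s1 s2))
  have h3 := Submodule.finrank_sup_add_finrank_inf_eq (LinearMap.range τ) (Submodule.prod ⊥ N)
  have h4 : (le L s1 s2 e).map τ ≤ LinearMap.range τ ⊓ Submodule.prod ⊥ N := by
    rintro _ ⟨a, ha, rfl⟩
    refine ⟨⟨a, rfl⟩, ?_⟩
    have ha' := mle.1 ha
    have ha'' := mll.1 ha'.1
    have : τ a = (0, - ⁅a, f⁆) := by
      show (⁅s1 + e, a⁆, ⁅s2 + f, a⁆) = _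
      rw [add_lie, add_lie, ha''.1, ha''.2, ha'.2, lie_skew]; simp
    rw [this]
    exact ⟨Submodule.zero_mem _, Submodule.neg_mem _ (hN2 a ha)⟩
  have h5 := Submodule.finrank_mono h4
  have h6 := rn τ (le L s1 s2 e)
  have h7 : le L s1 s2 e ⊓ LinearMap.ker τ = LinearMap.ker τ := by
    apply inf_eq_right.2
    intro a ha
    have ha' : (⁅s1 + e, a⁆, ⁅s2 + f, a⁆) = (0 : G × G) := ha
    rw [Prod.mk_eq_zero] at ha'
    exact hz a ha'.1 ha'.2
  have h8 := LinearMap.finrank_range_add_finrank_ker τ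
  rw [h7] at h6
  rw [fprod] at h2
  rw [fprod, finrank_bot] at h3
  omega

lemma perpdim (T : Trip L s1 s2 e f h u) (K : Submodule L G)
    (hK : K ≤ le L s1 s2 e ⊓ lw L s1 s2 h 0) : ∃ N : Submodule L G,
    (∀ v, v ∈ N ↔ v ∈ le L s1 s2 e ∧ ∀ k ∈ K, killingForm L G v k = 0) ∧
    finrank L N + finrank L K = finrank L (le L s1 s2 e) := by
  let φ : G →ₗ[L] Dual L K := K.subtype.dualMap ∘ₗ killingForm L G
  refine ⟨le L s1 s2 e ⊓ LinearMap.ker φ, ?_, ?_⟩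
  · intro v
    rw [Submodule.mem_inf, LinearMap.mem_ker]
    refine and_congr_right fun _ => ?_
    rw [LinearMap.ext_iff]
    exact ⟨fun h k hk => h ⟨k, hk⟩, fun h k => h k k.2⟩
  · have h1 := rn φ (le L s1 s2 e)
    have h2 : (le L s1 s2 e).map φ = ⊤ := by
      by_contra hne
      obtain ⟨ψ, hψ, hb⟩ := Submodule.exists_dual_map_eq_bot_of_lt_top (lt_top_iff_ne_top.2 hne) inferInstance
      apply hψ
      obtain ⟨k, rfl⟩ := (Module.evalEquiv L K).surjective ψ
      have hk : ∀ v ∈ le L s1 s2 e, killingForm L G v k = 0 := by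
        intro v hv
        have : (Module.evalEquiv L K k) (φ v) ∈ (⊥ : Submodule L L) := by
          rw [← hb]; exact ⟨_, ⟨v, hv, rfl⟩, rfl⟩
        exact (Submodule.mem_bot L).1 this
      have : (k : G) = 0 := T.nd0 (hK k.2) fun w hw => by rw [ksymm]; exact hk w hw.1
      have : k = 0 := Subtype.ext this
      rw [this, map_zero]
    rw [h2, finrank_top, Subspace.dual_finrank_eq] at h1
    exact h1

lemma count2 (T : Trip L s1 s2 e f h u) {W : Submodule L (G × G)} (hW : WD (s1 + e) (s2 + f) W)
    (hz : ∀ a, ⁅s1 + e, a⁆ = 0 → ⁅s2 + f, a⁆ = 0 → a ∈ le L s1 s2 e) (K : Submodule L G)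
    (hK : K ≤ le L s1 s2 e ⊓ lw L s1 s2 h 0)
    (hN1 : ∀ δ D, Nm L s1 s2 e h δ D → ∀ k ∈ K, killingForm L G (D f) k = 0)
    (hN2 : ∀ a ∈ le L s1 s2 e, ∀ k ∈ K, killingForm L G ⁅a, f⁆ k = 0) :
    finrank L W + finrank L K ≤ finrank L G + 2 * finrank L (zl L s1 s2) := by
  obtain ⟨N, hN, hd⟩ := perpdim T K hK
  have := count1 T hW hz N (fun δ D hD => (hN _).2 ⟨hD.df T.f_le, hN1 δ D hD⟩)
    (fun a ha => (hN _).2 ⟨?_, hN2 a ha⟩)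
  · omega
  · exact mle.2 ⟨ll_lie (mle.1 ha).1 T.f_mem, brk (mle.1 ha).2 T.cef⟩

/-- K = z(l) -/
lemma countZ (T : Trip L s1 s2 e f h u) {W : Submodule L (G × G)} (hW : WD (s1 + e) (s2 + f) W)
    (hz : ∀ a, ⁅s1 + e, a⁆ = 0 → ⁅s2 + f, a⁆ = 0 → a ∈ le L s1 s2 e) :
    finrank L W ≤ finrank L G + finrank L (zl L s1 s2) := by
  have := count2 T hW hz (zl L s1 s2) (zl_C0 T) (fun δ D hD k hk => hD.kz T hk)
    (fun a ha k hk => by rw [kinv, sw (hk.2 f T.f_mem), map_zero])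
  omega

/-- f_0 = 0, K = C0 -/
lemma countC (T : Trip L s1 s2 e f h u) {W : Submodule L (G × G)} (hW : WD (s1 + e) (s2 + f) W)
    (hz : ∀ a, ⁅s1 + e, a⁆ = 0 → ⁅s2 + f, a⁆ = 0 → a ∈ le L s1 s2 e) (h0 : kproj T.ssh f = 0) :
    finrank L W + finrank L ↥(le L s1 s2 e ⊓ lw L s1 s2 h 0) ≤
      finrank L G + 2 * finrank L (zl L s1 s2) := by
  have h00 : ∀ c ∈ le L s1 s2 e ⊓ lw L s1 s2 h 0, ⁅h, c⁆ = 0 := fun c hc => by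
    simpa using (mlw.1 hc.2).2
  refine count2 T hW hz _ le_rfl (fun δ D hD k hk => hD.kc T h0 (h00 k hk)) (fun a ha k hk => ?_)
  rw [← kproj_kappa T.ssh (h00 k hk), T.ph_lie ha T.f_le, h0, lie_zero, map_zero, LinearMap.zero_apply]

/-- f_0 ≠ 0, K = z(l) + L f_0 -/
lemma countF (T : Trip L s1 s2 e f h u) {W : Submodule L (G × G)} (hW : WD (s1 + e) (s2 + f) W)
    (hz : ∀ a, ⁅s1 + e, a⁆ = 0 → ⁅s2 + f, a⁆ = 0 → a ∈ le L s1 s2 e)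
    (h0 : killingForm L G (kproj T.ssh f) (kproj T.ssh f) = 0) (hnz : kproj T.ssh f ∉ zl L s1 s2) :
    finrank L W + 1 ≤ finrank L G + finrank L (zl L s1 s2) := by
  set f0 := kproj T.ssh f with hf0
  have hf0m := (T.ph_mem T.f_le).1
  have hhf : ⁅h, f0⁆ = 0 := by simpa using (mlw.1 hf0m.2).2
  have hKm : ∀ k ∈ zl L s1 s2 ⊔ Submodule.span L {f0}, ∃ z ∈ zl L s1 s2, ∃ c : L, k = z + c • f0 := by
    intro k hk
    obtain ⟨z, hz, y, hy, rfl⟩ := Submodule.mem_sup.1 hk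
    obtain ⟨c, rfl⟩ := Submodule.mem_span_singleton.1 hy
    exact ⟨z, hz, c, rfl⟩
  have h1 := count2 T hW hz (zl L s1 s2 ⊔ Submodule.span L {f0})
    (sup_le (zl_C0 T) (by rw [Submodule.span_singleton_le_iff_mem]; exact hf0m))
    (fun δ D hD k hk => by
      obtain ⟨z, hz, c, rfl⟩ := hKm k hk
      rw [map_add, map_smul, hD.kz T hz, hD.kf T h0]; simp)
    (fun a ha k hk => by
      obtain ⟨z, hz, c, rfl⟩ := hKm k hk
      have h3 : killingForm L G ⁅a, f⁆ f0 = 0 := by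
        rw [← kproj_kappa T.ssh hhf, T.ph_lie ha T.f_le, ← hf0, kinv, lie_self, map_zero]
      rw [map_add, map_smul, h3, kinv, sw (hz.2 f T.f_mem)]; simp)
  have h2 : zl L s1 s2 < zl L s1 s2 ⊔ Submodule.span L {f0} := by
    refine lt_of_le_of_ne le_sup_left fun h => hnz ?_
    rw [h]; exact Submodule.mem_sup_right (Submodule.mem_span_singleton_self _)
  have h3 := Submodule.finrank_lt_finrank_of_lt h2
  omega

variable [IsAlgClosed L]

lemma ss_top {A : End L G} (hA : A.IsSemisimple) : ⨆ c, Module.End.eigenspace A c = ⊤ := by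
  exact hA.iSup_eigenspace_eq_top

/-- the weight zero part of f is nilpotent -/
lemma f0_nil (T : Trip L s1 s2 e f h u) : IsNilpotent (ad L G (kproj T.ssh f)) := by
  set f0 := kproj T.ssh f with hf0
  have hf0m := (T.ph_mem T.f_le).1
  have hhf : ⁅h, f0⁆ = 0 := by simpa using (mlw.1 hf0m.2).2
  let S : L → Submodule L G := fun c => ⨆ i : ℕ, Module.End.eigenspace (ad L G h) (c + (i + 1 : ℕ))
  have hS1 : ∀ (c : L) (i : ℕ), S (c + i) ≤ S c := by
    intro c i
    refine iSup_le fun j => ?_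
    refine le_trans (le_of_eq ?_) (le_iSup _ (i + j))
    congr 1; push_cast; ring
  have hQ : ∀ c v, ⁅h, v⁆ = c • v → ⁅f - f0, v⁆ ∈ S c := by
    obtain ⟨N, hN⟩ := T.le_ind
    refine hN (p := fun a => ∀ c v, ⁅h, v⁆ = c • v → ⁅a - kproj T.ssh a, v⁆ ∈ S c) (by simp)
      (fun a b ha hb c v hv => ?_) ?_ f T.f_le
    · have := Submodule.add_mem _ (ha c v hv) (hb c v hv)
      rw [← add_lie] at this
      convert this using 2
      rw [map_add]; abel
    · intro i _ a ha hi c v hv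
      by_cases h0 : i = 0
      · subst h0
        rw [kproj_of T.ssh (by simpa using (mlw.1 hi).2)]; simp
      · rw [T.ph_wt (mlw.1 hi).2 (by simpa using h0), sub_zero]
        refine Submodule.mem_iSup_of_mem (i - 1) ?_
        rw [Module.End.mem_eigenspace_iff, ad_apply, leibniz_lie, (mlw.1 hi).2, hv, smul_lie, lie_smul,
          Nat.sub_add_cancel (by omega)]
        module
  have hf0w : ∀ (c : L) (v : G), ⁅h, v⁆ = c • v → ⁅h, ⁅f0, v⁆⁆ = c • ⁅f0, v⁆ := by
    intro c v hv
    rw [leibniz_lie, hhf, hv]; simp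
  have hfS : ∀ c v, v ∈ S c → ⁅f, v⁆ ∈ S c := by
    intro c v hv
    have : S c ≤ (S c).comap (ad L G f : End L G) := by
      refine iSup_le fun i w hw => ?_
      rw [Module.End.mem_eigenspace_iff] at hw
      have h1 := hS1 c (i + 1) (hQ _ _ hw)
      have h2 : ⁅f0, w⁆ ∈ S c :=
        Submodule.mem_iSup_of_mem i (Module.End.mem_eigenspace_iff.2 (hf0w _ _ hw))
      have h3 := Submodule.add_mem _ h1 h2
      rw [← add_lie, sub_add_cancel] at h3
      exact h3
    exact this hv
  have key : ∀ (c : L) (v : G), ⁅h, v⁆ = c • v → ∀ n : ℕ, ⁅h, ((ad L G f0) ^ n) v⁆ = c • ((ad L G f0) ^ n) v ∧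
      ((ad L G f) ^ n) v - ((ad L G f0) ^ n) v ∈ S c := by
    intro c v hv n
    induction n with
    | zero => simpa using hv
    | succ n ih =>
      rw [pow_succ', pow_succ', Module.End.mul_apply, Module.End.mul_apply]
      refine ⟨hf0w _ _ ih.1, ?_⟩
      have h1 := hQ _ _ ih.1
      have h2 := Submodule.add_mem _ (hfS _ _ ih.2) h1
      rw [sub_lie, lie_sub] at h2
      convert h2 using 1
      simp only [ad_apply]; abel
  obtain ⟨N, hN⟩ := T.nf
  refine ⟨N, ?_⟩
  apply LinearMap.ext
  intro v
  have : v ∈ LinearMap.ker ((ad L G f0) ^ N) := by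
    refine mem_top_of_iSup (ss_top T.ssh) _ ?_ v
    intro c v hv
    rw [Module.End.mem_eigenspace_iff] at hv
    obtain ⟨h1, h2⟩ := key c v hv N
    rw [hN, LinearMap.zero_apply, zero_sub] at h2
    have h2 := (Submodule.neg_mem_iff _).1 h2
    have hind := Module.End.eigenspaces_iSupIndep (ad L G h) c
    have h3 : S c ≤ ⨆ j, ⨆ (_ : j ≠ c), Module.End.eigenspace (ad L G h) j := by
      refine iSup_le fun i => ?_
      refine le_iSup₂_of_le (c + (i + 1 : ℕ)) ?_ le_rfl
      intro hc
      have : ((i + 1 : ℕ) : L) = 0 := by linear_combination hc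
      exact (Nat.cast_ne_zero.2 (by omega)) this
    exact Submodule.disjoint_def.1 hind _ (Module.End.mem_eigenspace_iff.2 h1) (h3 h2)
  exact this

end
end CVP

namespace CVP
open LieAlgebra Module

/-- The joint eigenspace in a basis of joint eigenvectors. -/
lemma eig_span {L V ι J : Type*} [Field L] [AddCommGroup V] [Module L V] [Fintype ι]
    (b : Basis ι L V) (A : J → V →ₗ[L] V) (w : ι → J → L) (hw : ∀ i j, A j (b i) = w i j • b i)
    (c : J → L) {v : V} (hv : ∀ j, A j v = c j • v) (i : ι) (hi : b.repr v i ≠ 0) (j : J) :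
    w i j = c j := by
  have h1 : b.repr (A j v) i = w i j * b.repr v i := by
    conv_lhs => rw [← b.sum_repr v]
    rw [map_sum]
    simp only [map_smul, hw, map_sum, Finsupp.coe_finset_sum, Finset.sum_apply, Finsupp.smul_apply,
      Basis.repr_self, smul_eq_mul]
    rw [Finset.sum_eq_single i]
    · simp [mul_comm]
    · intro k _ hk; simp [hk]
    · simp
  rw [hv j, map_smul, Finsupp.smul_apply, smul_eq_mul] at h1
  exact (mul_right_cancel₀ hi h1).symm

lemma eig_dim {L V ι J : Type*} [Field L] [AddCommGroup V] [Module L V] [Fintype ι]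
    (b : Basis ι L V) (A : J → V →ₗ[L] V) (w : ι → J → L) (hw : ∀ i j, A j (b i) = w i j • b i)
    (c : J → L) (M : Submodule L V) (hM : ∀ v, v ∈ M ↔ ∀ j, A j v = c j • v) :
    finrank L M = Nat.card {i // ∀ j, w i j = c j} := by
  classical
  have : M = Submodule.span L (Set.range fun i : {i // ∀ j, w i j = c j} => b i.1) := by
    apply le_antisymm
    · intro v hv
      rw [← b.sum_repr v]
      refine Submodule.sum_mem _ fun i _ => ?_
      by_cases hi : b.repr v i = 0
      · rw [hi, zero_smul]; exact Submodule.zero_mem _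
      · exact Submodule.smul_mem _ _ (Submodule.subset_span
          ⟨⟨i, eig_span b A w hw c ((hM v).1 hv) i hi⟩, rfl⟩)
    · rw [Submodule.span_le]
      rintro _ ⟨i, rfl⟩
      exact (hM _).2 fun j => by rw [hw, i.2 j]
  rw [this, finrank_span_eq_card, Nat.card_eq_fintype_card]
  exact b.linearIndependent.comp _ Subtype.val_injective

section
variable {L : Type*} [Field L] [CharZero L] [IsAlgClosed L]
  {G : Type*} [LieRing G] [LieAlgebra L G] [FiniteDimensional L G] [IsKilling L G]

/-- joint centralizer of a set -/
def zsub (L : Type*) [Field L] {G : Type*} [LieRing G] [LieAlgebra L G] (S : Set G) :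
    LieSubalgebra L G where
  carrier := {x | ∀ a ∈ S, ⁅a, x⁆ = 0}
  add_mem' := by intro x y hx hy a ha; rw [lie_add, hx a ha, hy a ha, add_zero]
  zero_mem' := by intro a _; exact lie_zero a
  smul_mem' := by intro c x hx a ha; rw [lie_smul, hx a ha, smul_zero]
  lie_mem' := by intro x y hx hy a ha; exact brk (hx a ha) (hy a ha)

lemma exists_cartan (S : Set G) (hS : ∀ a ∈ S, (ad L G a).IsSemisimple)
    (hc : ∀ a ∈ S, ∀ b ∈ S, ⁅a, b⁆ = 0) :
    ∃ H : LieSubalgebra L G, H.IsCartanSubalgebra ∧ S ⊆ H := by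
  set Z := zsub L S with hZ
  obtain ⟨x, hx⟩ := LieAlgebra.exists_isCartanSubalgebra_engel L Z
  set t := LieSubalgebra.engel L x
  have hSZ : ∀ a ∈ S, a ∈ Z := fun a ha b hb => hc b hb a ha
  have hcen : ∀ a (ha : a ∈ S), ∀ z : Z, ⁅(⟨a, hSZ a ha⟩ : Z), z⁆ = 0 := by
    intro a ha z; ext; exact z.2 a ha
  have hSt : ∀ a (ha : a ∈ S), (⟨a, hSZ a ha⟩ : Z) ∈ t := by
    intro a ha
    rw [← hx.self_normalizing, LieSubalgebra.mem_normalizer_iff]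
    intro y _
    rw [hcen a ha y]; exact t.zero_mem
  refine ⟨t.map Z.incl, ⟨?_, ?_⟩, ?_⟩
  · have := hx.nilpotent
    exact (LieEquiv.nilpotent_iff_equiv_nilpotent
      (LieSubalgebra.equivMapOfInjective Z.incl t Subtype.val_injective)).1 this
  · apply le_antisymm _ (LieSubalgebra.le_normalizer _)
    intro y hy
    rw [LieSubalgebra.mem_normalizer_iff] at hy
    have hyZ : y ∈ Z := by
      intro a ha
      have h1 := hy a ⟨_, hSt a ha, rfl⟩
      obtain ⟨w, hw, hw2⟩ := h1
      have h2 : ⁅a, ⁅a, y⁆⁆ = 0 := by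
        rw [← lie_skew a y, ← hw2, lie_neg, neg_eq_zero]
        exact w.2 a ha
      exact ss_ker (hS a ha) (v := y) h2
    refine ⟨⟨y, hyZ⟩, ?_, rfl⟩
    rw [SetLike.mem_coe]
    change _ ∈ t
    rw [← hx.self_normalizing, LieSubalgebra.mem_normalizer_iff]
    intro z hz
    obtain ⟨w, hw, hw2⟩ := hy z ⟨z, hz, rfl⟩
    have : w = ⁅(⟨y, hyZ⟩ : Z), z⁆ := by ext; exact hw2
    rw [← this]; exact hw
  · intro a ha; exact ⟨_, hSt a ha, rfl⟩
end
end CVP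

namespace CVP
open LieAlgebra Module LieAlgebra.IsKilling

section
variable {L : Type*} [Field L] [CharZero L] [IsAlgClosed L]
  {G : Type*} [LieRing G] [LieAlgebra L G] [FiniteDimensional L G] [IsKilling L G]
  (H : LieSubalgebra L G) [H.IsCartanSubalgebra]

lemma exists_ab : ∃ b : Basis (Fin (finrank L H) ⊕ H.root) L G,
    (∀ i, b (Sum.inl i) ∈ H) ∧ ∀ α, b (Sum.inr α) ∈ rootSpace H α.1 := by
  classical
  let wf : Option H.root → (H → L) := fun o => o.elim 0 fun α => α.1
  have hinj : Function.Injective wf := by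
    intro a b hab
    rcases a with _ | a <;> rcases b with _ | b
    · rfl
    · exact absurd hab.symm (LieSubalgebra.isNonZero_coe_root b)
    · exact absurd hab (LieSubalgebra.isNonZero_coe_root a)
    · simp only [wf, Option.elim] at hab
      rw [Subtype.ext (DFunLike.coe_injective hab)]
  let A : Option H.root → Submodule L G := fun o => (rootSpace H (wf o)).toSubmodule
  have hind : iSupIndep A := by
    have := (LieModule.iSupIndep_genWeightSpace L H G).comp hinj
    exact LieSubmodule.iSupIndep_toSubmodule.2 this
  have hz : rootSpace H (0 : H → L) = H.toLieSubmodule := rootSpace_zero_eq L G H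
  have htop : iSup A = ⊤ := by
    have h1 := LieModule.iSup_genWeightSpace_eq_top' L H G
    have h2 : ∀ χ : LieModule.Weight L H G, (LieModule.genWeightSpace G χ).toSubmodule ≤ iSup A := by
      intro χ
      by_cases hχ : χ.IsNonZero
      · have : χ ∈ H.root := by simpa [LieSubalgebra.root] using hχ
        exact le_iSup A (some ⟨χ, this⟩)
      · have hχ : (χ : H → L) = 0 := by
          by_contra h; exact hχ h
        rw [hχ]
        exact le_iSup A none
    rw [eq_top_iff, ← LieSubmodule.top_toSubmodule (R := L) (L := H) (M := G), ← h1,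
      LieSubmodule.iSup_toSubmodule]
    exact iSup_le h2
  have hI := DirectSum.isInternal_submodule_of_iSupIndep_of_iSup_eq_top hind htop
  let β : Option H.root → Type := fun o => o.elim (Fin (finrank L H)) fun _ => Unit
  have hb : ∀ o, Nonempty (Basis (β o) L (A o)) := by
    intro o
    rcases o with _ | α
    · have : finrank L (A none) = finrank L H := by
        change finrank L (rootSpace H (0 : H → L)) = _
        rw [hz]; rfl
      exact ⟨finBasisOfFinrankEq L (A none) this⟩
    · have : finrank L (A (some α)) = 1 := finrank_rootSpace_eq_one α.1 (LieSubalgebra.isNonZero_coe_root α)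
      exact ⟨basisUnique Unit this⟩
  let v := fun o => (hb o).some
  let b := hI.collectedBasis v
  let E : (Σ o, β o) ≃ Fin (finrank L H) ⊕ H.root :=
    { toFun := fun s => match s with
        | ⟨none, i⟩ => Sum.inl i
        | ⟨some α, _⟩ => Sum.inr α
      invFun := fun s => match s with
        | Sum.inl i => ⟨none, i⟩
        | Sum.inr α => ⟨some α, ()⟩
      left_inv := by rintro ⟨_ | α, i⟩ <;> rfl
      right_inv := by rintro (i | α) <;> rfl }
  refine ⟨b.reindex E, ?_, ?_⟩
  · intro i
    rw [Basis.reindex_apply]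
    have := hI.collectedBasis_mem v (⟨none, i⟩ : Σ o, β o)
    have h2 : (hI.collectedBasis v) (⟨none, i⟩ : Σ o, β o) ∈ rootSpace H (0 : H → L) := this
    rw [hz] at h2
    exact h2
  · intro α
    rw [Basis.reindex_apply]
    exact hI.collectedBasis_mem v (⟨some α, ()⟩ : Σ o, β o)

variable {H}

/-- joint eigenspaces inside a Cartan-adapted decomposition -/
lemma joint_dim {J : Type*} (a : J → H) (c : J → L) (M : Submodule L G)
    (hM : ∀ v, v ∈ M ↔ ∀ j, ⁅(a j : G), v⁆ = c j • v) [DecidablePred fun α : H.root => ∀ j, (rootSystem H).root α (a j) = c j] :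
    ((∀ j, c j = 0) → finrank L M = finrank L H +
      (Finset.univ.filter fun α : H.root => ∀ j, (rootSystem H).root α (a j) = c j).card) ∧
    ((¬∀ j, c j = 0) → finrank L M = 
      (Finset.univ.filter fun α : H.root => ∀ j, (rootSystem H).root α (a j) = c j).card) := by
  classical
  obtain ⟨b, hb1, hb2⟩ := exists_ab H
  let w : Fin (finrank L H) ⊕ H.root → J → L := fun i j =>
    Sum.elim (fun _ => 0) (fun α => (rootSystem H).root α (a j)) i
  have hw : ∀ i j, (ad L G (a j)) (b i) = w i j • b i := by
    rintro (i | α) j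
    · have := LieSubalgebra.coe_bracket H (a j) ⟨_, hb1 i⟩
      simp only [w, Sum.elim_inl, zero_smul, ad_apply]
      rw [← this, trivial_lie_zero]; rfl
    · exact lie_eq_smul_of_mem_rootSpace (hb2 α) (a j)
  have h1 := eig_dim b (fun j => ad L G (a j)) w hw c M hM
  have h2 : Nat.card {i // ∀ j, w i j = c j} =
      Nat.card {i : Fin (finrank L H) // ∀ j, 0 = c j} + 
      (Finset.univ.filter fun α : H.root => ∀ j, (rootSystem H).root α (a j) = c j).card := by
    rw [← Fintype.card_subtype, ← Nat.card_eq_fintype_card, ← Nat.card_sum]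
    exact Nat.card_congr Equiv.subtypeSum
  constructor
  · intro hc
    have : Nat.card {i : Fin (finrank L H) // ∀ j, 0 = c j} = finrank L H := by
      simp [hc]
    omega
  · intro hc
    have : Nat.card {i : Fin (finrank L H) // ∀ j, 0 = c j} = 0 := by
      have : IsEmpty {i : Fin (finrank L H) // ∀ j, 0 = c j} := ⟨fun i => hc fun j => (i.2 j).symm⟩
      simp
    omega

/-- a nonzero joint eigenvector that is not in `H` gives a root -/
lemma cartan_self {v : G} (hv : ∀ x : H, ⁅(x : G), v⁆ = 0) : v ∈ H := by
  have h := (inferInstance : H.IsCartanSubalgebra).self_normalizing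
  rw [← h, LieSubalgebra.mem_normalizer_iff]
  intro y hy
  rw [← lie_skew, hv ⟨y, hy⟩, neg_zero]; exact H.zero_mem

lemma cartan_comm {x y : G} (hx : x ∈ H) (hy : y ∈ H) : ⁅x, y⁆ = 0 := by
  have := LieSubalgebra.coe_bracket H ⟨x, hx⟩ ⟨y, hy⟩
  rw [trivial_lie_zero] at this
  exact this.symm

/-- generalized induction: every element is a sum of an element of `H` and root vectors -/
lemma joint_eig {J : Type*} (a : J → H) (c : J → L) {v : G} (hv : ∀ j, ⁅(a j : G), v⁆ = c j • v)
    (N : Submodule L G) (hH : (∀ j, c j = 0) → ∀ x ∈ H, x ∈ N)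
    (hN : ∀ α : H.root, (∀ j, (rootSystem H).root α (a j) = c j) → ∀ x ∈ rootSpace H α.1, x ∈ N) :
    v ∈ N := by
  obtain ⟨b, hb1, hb2⟩ := exists_ab H
  let w : Fin (finrank L H) ⊕ H.root → J → L := fun i j =>
    Sum.elim (fun _ => 0) (fun α => (rootSystem H).root α (a j)) i
  have hw : ∀ i j, (ad L G (a j)) (b i) = w i j • b i := by
    rintro (i | α) j
    · simp only [w, Sum.elim_inl, zero_smul, ad_apply]
      exact cartan_comm (a j).2 (hb1 i)
    · exact lie_eq_smul_of_mem_rootSpace (hb2 α) (a j)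
  rw [← b.sum_repr v]
  refine Submodule.sum_mem _ fun i _ => ?_
  by_cases hi : b.repr v i = 0
  · rw [hi, zero_smul]; exact Submodule.zero_mem _
  have h3 := eig_span b (fun j => ad L G (a j)) w hw c hv i hi
  apply Submodule.smul_mem
  rcases i with i | α
  · exact hH (fun j => (h3 j).symm) _ (hb1 i)
  · exact hN α h3 _ (hb2 α)
end
end CVP

namespace CVP
open LieAlgebra Module LieAlgebra.IsKilling

section
variable {L : Type*} [Field L] [CharZero L] [IsAlgClosed L]
  {G : Type*} [LieRing G] [LieAlgebra L G] [FiniteDimensional L G] [IsKilling L G]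
  {H : LieSubalgebra L G} [H.IsCartanSubalgebra]

/-- span of the roots vanishing on s1, s2 -/
def UU (s1 s2 : H) : Submodule L (Dual L H) :=
  Submodule.span L {φ | φ ∈ Set.range (rootSystem H).root ∧ φ s1 = 0 ∧ φ s2 = 0}

lemma mUU {s1 s2 : H} {α : H.root} : (rootSystem H).root α ∈ UU s1 s2 ↔
    (rootSystem H).root α s1 = 0 ∧ (rootSystem H).root α s2 = 0 := by
  constructor
  · intro h
    have : UU s1 s2 ≤ LinearMap.ker (Dual.eval L H s1) ⊓ LinearMap.ker (Dual.eval L H s2) := by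
      rw [UU, Submodule.span_le]
      rintro φ ⟨-, h1, h2⟩
      exact ⟨h1, h2⟩
    exact this h
  · rintro ⟨h1, h2⟩
    exact Submodule.subset_span ⟨⟨α, rfl⟩, h1, h2⟩

/-- degree -/
abbrev dd (h : H) : Dual L H →ₗ[L] L := Dual.eval L H h

lemma lw_pre (s1 s2 h : H) (c : L) (v : G) : v ∈ lw L (s1 : G) s2 h c ↔
    ∀ j : Fin 3, ⁅((![s1, s2, h] j : H) : G), v⁆ = ![0, 0, c] j • v := by
  rw [mlw, mll, Fin.forall_fin_succ, Fin.forall_fin_two]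
  simp [and_assoc]

lemma dim_lw (s1 s2 h : H) (j : ℕ) (hj : j ≠ 0) :
    finrank L (lw L (s1 : G) s2 h (j : L)) = (Phi (rootSystem H) (UU s1 s2) (dd h) j).card := by
  classical
  have h1 := (joint_dim ![s1, s2, h] ![0, 0, (j : L)] _ (lw_pre s1 s2 h j)).2 (fun h => by
    have := h 2; simp at this; exact hj this)
  rw [h1]
  congr 1
  ext α
  rw [mPhi, mUU]
  simp [Fin.forall_fin_succ, and_assoc]

lemma dim_lw0 (s1 s2 h : H) : finrank L (lw L (s1 : G) s2 h 0) =
    finrank L H + (Phi (rootSystem H) (UU s1 s2) (dd h) 0).card := by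
  classical
  have h1 := (joint_dim ![s1, s2, h] ![0, 0, (0 : L)] _ (lw_pre s1 s2 h 0)).1 (fun j => by
    fin_cases j <;> rfl)
  rw [h1]
  congr 2
  ext α
  rw [mPhi, mUU]
  simp [Fin.forall_fin_succ, and_assoc]

lemma H_ll (s1 s2 : H) {x : G} (hx : x ∈ H) : x ∈ ll L (s1 : G) s2 :=
  mll.2 ⟨cartan_comm s1.2 hx, cartan_comm s2.2 hx⟩

lemma zl_H {s1 s2 : H} {v : G} (hv : v ∈ zl L (s1 : G) s2) : v ∈ H :=
  cartan_self fun x => sw (hv.2 x (H_ll s1 s2 x.2))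

lemma mzl' {s1 s2 : H} {v : H} : (v : G) ∈ zl L (s1 : G) s2 ↔ v ∈ (UU s1 s2).dualCoannihilator := by
  rw [Submodule.mem_dualCoannihilator]
  constructor
  · intro hv φ hφ
    have : UU s1 s2 ≤ LinearMap.ker (Dual.eval L H v) := by
      rw [UU, Submodule.span_le]
      rintro _ ⟨⟨α, rfl⟩, h1, h2⟩
      obtain ⟨b, -, hb⟩ := exists_ab H
      have hbα := hb α
      have h3 := hv.2 (b (Sum.inr α)) (mll.2 ⟨by
        have := lie_eq_smul_of_mem_rootSpace hbα s1
        rw [show (α.1 : H → L) s1 = 0 from h1, zero_smul] at this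
        exact this, by
        have := lie_eq_smul_of_mem_rootSpace hbα s2
        rw [show (α.1 : H → L) s2 = 0 from h2, zero_smul] at this
        exact this⟩)
      have h4 := lie_eq_smul_of_mem_rootSpace hbα v
      have h5 : ⁅v, b (Sum.inr α)⁆ = ⁅(v : G), b (Sum.inr α)⁆ := rfl
      rw [h5, h3] at h4
      exact (smul_eq_zero.1 h4.symm).resolve_right (b.ne_zero _)
    exact this hφ
  · intro hv
    refine ⟨H_ll s1 s2 v.2, fun w hw => ?_⟩
    rw [mll] at hw
    have := joint_eig ![s1, s2] ![0, 0] (v := w) (by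
      rw [Fin.forall_fin_two]; simpa using hw) (LinearMap.ker (ad L G (v : G)))
      (fun _ x hx => cartan_comm v.2 hx) (fun α hα x hx => by
        have h4 := lie_eq_smul_of_mem_rootSpace hx v
        have h6 := hv ((rootSystem H).root α) (mUU.2 (by
          rw [Fin.forall_fin_two] at hα; simpa using hα))
        rw [show (α.1 : H → L) v = 0 from h6, zero_smul] at h4
        exact h4)
    exact this

lemma dim_zl (s1 s2 : H) : finrank L (UU s1 s2) + finrank L (zl L (s1 : G) s2) = finrank L H := by
  rw [← Subspace.finrank_add_finrank_dualCoannihilator_eq (UU s1 s2)]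
  congr 1
  have : zl L (s1 : G) s2 = (UU s1 s2).dualCoannihilator.map H.toSubmodule.subtype := by
    ext v
    constructor
    · intro hv
      exact ⟨⟨v, zl_H hv⟩, mzl'.1 hv, rfl⟩
    · rintro ⟨w, hw, rfl⟩
      exact mzl'.2 hw
  rw [this]
  exact Submodule.finrank_map_subtype_eq _ _

open Classical in
lemma dim_ll (s1 s2 : H) : finrank L (ll L (s1 : G) s2) = finrank L H +
    (Finset.univ.filter fun α : H.root => (rootSystem H).root α ∈ UU s1 s2).card := by
  have h1 := (joint_dim ![s1, s2] ![0, 0] (ll L (s1 : G) s2) (fun v => by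
    rw [mll, Fin.forall_fin_two]; simp)).1 (fun j => by fin_cases j <;> rfl)
  rw [h1]
  congr 2
  ext α
  rw [Finset.mem_filter, Finset.mem_filter, mUU, Fin.forall_fin_two]
  simp

/-- every weight vector has a visible root -/
lemma lw_root (s1 s2 h c : H) (j : ℕ) (hj : j ≠ 0) {v : G} (hv : v ∈ lw L (s1 : G) s2 h (j : L))
    (hv0 : v ≠ 0) (hcv : ⁅(c : G), v⁆ = 0) :
    ∃ α ∈ Phi (rootSystem H) (UU s1 s2) (dd h) j, (rootSystem H).root α c = 0 := by
  by_contra hcon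
  push Not at hcon
  apply hv0
  rw [mlw, mll] at hv
  have := joint_eig ![s1, s2, h, c] ![0, 0, (j : L), 0] (v := v) (by
      simp [Fin.forall_fin_succ, hv, hcv]) ⊥
    (fun h => absurd (h 2) (by simpa using hj)) (fun α hα x hx => by
      exfalso
      simp [Fin.forall_fin_succ] at hα
      exact hcon α (mPhi.2 ⟨mUU.2 ⟨hα.1, hα.2.1⟩, hα.2.2.1⟩) hα.2.2.2)
  simpa using this

end
end CVP

namespace CVP
open LieAlgebra Module LieAlgebra.IsKilling

lemma rank2 {L V W : Type*} [Field L] [AddCommGroup V] [Module L V] [FiniteDimensional L V]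
    [AddCommGroup W] [Module L W] (φ : V →ₗ[L] W) (M : Submodule L V) {a b : V} (ha : a ∈ M)
    (hb : b ∈ M) (h : ∀ s t : L, s • φ a + t • φ b = 0 → s = 0 ∧ t = 0) :
    finrank L ↥(M ⊓ LinearMap.ker φ) + 2 ≤ finrank L M := by
  have h1 := rn φ M
  have h2 : LinearIndependent L ![φ a, φ b] := LinearIndependent.pair_iff.2 h
  have h3 := finrank_span_eq_card h2
  have h4 : Submodule.span L (Set.range ![φ a, φ b]) ≤ M.map φ := by
    rw [Submodule.span_le]
    rintro _ ⟨i, rfl⟩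
    fin_cases i
    · exact ⟨a, ha, rfl⟩
    · exact ⟨b, hb, rfl⟩
  have : FiniteDimensional L (M.map φ) := inferInstance
  have h5 := Submodule.finrank_mono h4
  rw [Fintype.card_fin] at h3
  omega

section
variable {L : Type*} [Field L] [CharZero L] [IsAlgClosed L]
  {G : Type*} [LieRing G] [LieAlgebra L G] [FiniteDimensional L G] [IsKilling L G]
  {H : LieSubalgebra L G} [H.IsCartanSubalgebra]
  {s1 s2 h : H} {e f u : G} (T : Trip L (s1 : G) s2 e f h u)
include T

lemma phi2_ne (he : e ≠ 0) : (Phi (rootSystem H) (UU s1 s2) (dd h) 2).Nonempty := by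
  obtain ⟨α, hα, -⟩ := lw_root s1 s2 h 0 2 (by norm_num) (v := e) (by exact_mod_cast T.e2) he (by simp)
  exact ⟨α, hα⟩

lemma dim_z (hZ : finrank L H < finrank L ↥(le L (s1 : G) s2 e ⊓ LinearMap.ker (ad L G f))) :
    finrank L H < finrank L (le L (s1 : G) s2 e) ∧ finrank L (le L (s1 : G) s2 e) ≤ finrank L H +
     (Phi (rootSystem H) (UU s1 s2) (dd h) 0).card + (Phi (rootSystem H) (UU s1 s2) (dd h) 1).card := by
  have h1 : finrank L ↥(le L (s1 : G) s2 e ⊓ LinearMap.ker (ad L G f)) ≤ finrank L (le L (s1 : G) s2 e) :=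
    Submodule.finrank_mono inf_le_left
  have h2 := T.dim_le
  have h3 := dim_lw0 s1 s2 h
  have h4 := dim_lw s1 s2 h 1 (by norm_num)
  rw [Nat.cast_one] at h4
  omega

lemma r_ge (he : e ≠ 0) (hZ : finrank L H < finrank L ↥(le L (s1 : G) s2 e ⊓ LinearMap.ker (ad L G f))) :
    2 ≤ finrank L (UU s1 s2) := by
  classical
  obtain ⟨α, hα⟩ := phi2_ne T he
  have hd := dim_z T hZ
  obtain ⟨β, hβU, hβ⟩ : ∃ β, (rootSystem H).root β ∈ UU s1 s2 ∧ (dd h ((rootSystem H).root β) = 0 ∨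
      dd h ((rootSystem H).root β) = 1) := by
    by_cases h0 : (Phi (rootSystem H) (UU s1 s2) (dd h) 0).card = 0
    · obtain ⟨β, hβ⟩ := Finset.card_pos.1
        (show 0 < (Phi (rootSystem H) (UU s1 s2) (dd h) 1).card by omega)
      rw [mPhi] at hβ
      exact ⟨β, hβ.1, Or.inr (by simpa using hβ.2)⟩
    · obtain ⟨β, hβ⟩ := Finset.card_pos.1 (Nat.pos_of_ne_zero h0)
      rw [mPhi] at hβ
      exact ⟨β, hβ.1, Or.inl (by simpa using hβ.2)⟩
  rw [mPhi] at hα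
  have hli : LinearIndependent L ![(rootSystem H).root α, (rootSystem H).root β] := by
    by_contra hn
    have h2 : dd h ((rootSystem H).root α) = 2 := by simpa using hα.2
    have hαβ : α ≠ β := by
      rintro rfl
      rw [h2] at hβ
      rcases hβ with hβ | hβ <;> norm_num at hβ
    have := RootPairing.IsReduced.eq_or_eq_neg (P := rootSystem H) α β hn
    rcases this with h1 | h1
    · exact hαβ ((rootSystem H).root.injective h1)
    · have h3 := congrArg (dd h) h1
      rw [map_neg, h2] at h3
      rcases hβ with hβ | hβ
      · rw [hβ] at h3; norm_num at h3
      · rw [hβ] at h3; norm_num at h3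
  have h3 := finrank_span_eq_card hli
  have h4 : Submodule.span L (Set.range ![(rootSystem H).root α, (rootSystem H).root β]) ≤ UU s1 s2 := by
    rw [Submodule.span_le]
    rintro _ ⟨i, rfl⟩
    fin_cases i
    · exact hα.1
    · exact hβU
  have h5 := Submodule.finrank_mono h4
  rw [Fintype.card_fin] at h3
  omega

lemma f0_zl (h0 : kproj T.ssh f ≠ 0) : kproj T.ssh f ∉ zl L (s1 : G) s2 := fun hm =>
  h0 (eq_zero_of_isNilpotent_ad_of_mem_isCartanSubalgebra L G H (zl_H hm) (f0_nil T))

lemma gain1 {W : Submodule L (G × G)} (hW : WD ((s1 : G) + e) ((s2 : G) + f) W)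
    (hz : ∀ a, ⁅(s1 : G) + e, a⁆ = 0 → ⁅(s2 : G) + f, a⁆ = 0 → a ∈ le L (s1 : G) s2 e)
    (he : e ≠ 0) (hZ : finrank L H < finrank L ↥(le L (s1 : G) s2 e ⊓ LinearMap.ker (ad L G f)))
    (hr : (finrank L (UU s1 s2) = 2 ∧ PB (rootSystem H) 2) ∨
      (finrank L (UU s1 s2) = 3 ∧ PB (rootSystem H) 1)) :
    finrank L W + 1 ≤ finrank L G + finrank L (zl L (s1 : G) s2) := by
  by_cases h0 : kproj T.ssh f = 0
  · have h1 := countC T hW hz h0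
    have h2 := T.dim_C0
    have h3 := dim_lw0 s1 s2 h
    have h4 := dim_lw s1 s2 h 2 (by norm_num)
    rw [Nat.cast_ofNat] at h4
    have h5 := dim_zl s1 s2
    have h6 := dim_z T hZ
    have h7 : (Phi (rootSystem H) (UU s1 s2) (dd h) 2).card <
        (Phi (rootSystem H) (UU s1 s2) (dd h) 0).card + finrank L (UU s1 s2) := by
      by_cases hΦ : Phi (rootSystem H) (UU s1 s2) (dd h) 0 = ∅
      · have h8 : Phi (rootSystem H) (UU s1 s2) (dd h) 1 ≠ ∅ := by
          intro h9
          rw [hΦ, h9] at h6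
          simp at h6
          omega
        have := combE (P := rootSystem H) (U := UU s1 s2) (d := dd h)
          (hr.imp (fun h => h.1) id) hΦ h8
        omega
      · obtain ⟨β, hβ⟩ := Finset.nonempty_iff_ne_empty.2 hΦ
        rcases hr with ⟨hr, hb⟩ | ⟨hr, hb⟩
        · have := comb0 hb hr hβ (phi2_ne T he)
          omega
        · have := combB hb hr hβ
          omega
    omega
  · have hm := (T.ph_mem T.f_le).1
    exact countF T hW hz (nil_comm (f0_nil T) (lie_self _)) (f0_zl T h0)


/-- case I of gain 2 -/
lemma gain2a {W : Submodule L (G × G)} (hW : WD ((s1 : G) + e) ((s2 : G) + f) W)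
    (hz : ∀ a, ⁅(s1 : G) + e, a⁆ = 0 → ⁅(s2 : G) + f, a⁆ = 0 → a ∈ le L (s1 : G) s2 e)
    (he : e ≠ 0) (hZ : finrank L H < finrank L ↥(le L (s1 : G) s2 e ⊓ LinearMap.ker (ad L G f)))
    (hr : finrank L (UU s1 s2) = 2) (hb : PB (rootSystem H) 1)
    (hΦ : Phi (rootSystem H) (UU s1 s2) (dd h) 0 ≠ ∅) :
    finrank L W + 2 ≤ finrank L G + finrank L (zl L (s1 : G) s2) := by
  obtain ⟨β, hβ⟩ := Finset.nonempty_iff_ne_empty.2 hΦ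
  obtain ⟨c1, -, c3⟩ := comb0 (fun i j h1 h2 => (hb i j h1 h2).trans (by norm_num)) hr hβ (phi2_ne T he)
  obtain ⟨c2, c3⟩ := c3 hb
  have h2 := T.dim_C0
  have h3 := dim_lw0 s1 s2 h
  have h4 := dim_lw s1 s2 h 2 (by norm_num)
  rw [Nat.cast_ofNat] at h4
  have h5 := dim_zl s1 s2
  have h6 := dim_z T hZ
  by_cases h0 : kproj T.ssh f = 0
  · have h1 := countC T hW hz h0
    omega
  · exfalso
    set f0 := kproj T.ssh f with hf0
    set C := le L (s1 : G) s2 e ⊓ lw L (s1 : G) s2 h 0 with hC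
    have hm : f0 ∈ C := (T.ph_mem T.f_le).1
    have hCh : ∀ c ∈ C, ⁅(h : G), c⁆ = 0 := fun c hc => by simpa using (mlw.1 hc.2).2
    have hlie : ∀ a ∈ C, ∀ b ∈ C, ⁅a, b⁆ ∈ C := by
      intro a ha b hb
      have h1 := (mle.1 ha.1)
      have h2 := (mle.1 hb.1)
      refine ⟨mle.2 ⟨ll_lie h1.1 h2.1, brk h1.2 h2.2⟩, mlw.2 ⟨ll_lie h1.1 h2.1, ?_⟩⟩
      rw [zero_smul]; exact brk (hCh a ha) (hCh b hb)
    obtain ⟨a, ha, b, hb, hab⟩ : ∃ a ∈ C, ∃ b ∈ C, killingForm L G f0 ⁅a, b⁆ ≠ 0 := by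
      by_contra hcon
      push Not at hcon
      apply h0
      apply T.nd0 hm
      intro w hw
      apply nil_comm (f0_nil T)
      apply T.nd0 (hlie _ hm _ hw)
      intro w' hw'
      rw [kinv]
      exact hcon w hw w' hw'
    have hk : ∀ a ∈ C, ∀ b ∈ C, killingForm L G ⁅f, a⁆ b = killingForm L G f0 ⁅a, b⁆ := by
      intro a ha b hb
      rw [kinv, hf0, kproj_kappa T.ssh (hCh _ (hlie a ha b hb))]
    let φ : G →ₗ[L] L × L := (((killingForm L G).flip a) ∘ₗ (ad L G f : End L G)).prod
      (((killingForm L G).flip b) ∘ₗ (ad L G f : End L G))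
    have e0 : ∀ x, φ x = (killingForm L G ⁅f, x⁆ a, killingForm L G ⁅f, x⁆ b) := fun x => rfl
    have e1 : φ a = (0, killingForm L G f0 ⁅a, b⁆) := by
      rw [e0, hk a ha a ha, hk a ha b hb, lie_self, map_zero]
    have e2 : φ b = (- killingForm L G f0 ⁅a, b⁆, 0) := by
      rw [e0, hk b hb a ha, hk b hb b hb, lie_self, map_zero, ← lie_skew a b, map_neg, neg_neg]
    have h7 := rank2 φ (le L (s1 : G) s2 e) ha.1 hb.1 (by
      intro s t hst
      rw [e1, e2] at hst
      simp [hab] at hst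
      exact ⟨hst.2, hst.1⟩)
    have h8 : finrank L ↥(le L (s1 : G) s2 e ⊓ LinearMap.ker (ad L G f)) ≤
      finrank L ↥(le L (s1 : G) s2 e ⊓ LinearMap.ker φ) := Submodule.finrank_mono (by
        refine inf_le_inf_left _ fun x hx => ?_
        have hx' : ⁅f, x⁆ = 0 := hx
        rw [LinearMap.mem_ker]
        simp [φ, hx'])
    rw [c3] at h6
    simp at h6
    omega


/-- case II of gain 2 -/
lemma gain2b {W : Submodule L (G × G)} (hW : WD ((s1 : G) + e) ((s2 : G) + f) W)
    (hz : ∀ a, ⁅(s1 : G) + e, a⁆ = 0 → ⁅(s2 : G) + f, a⁆ = 0 → a ∈ le L (s1 : G) s2 e)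
    (he : e ≠ 0) (hZ : finrank L H < finrank L ↥(le L (s1 : G) s2 e ⊓ LinearMap.ker (ad L G f)))
    (hr : finrank L (UU s1 s2) = 2) (hb : PB (rootSystem H) 1)
    (hΦ : Phi (rootSystem H) (UU s1 s2) (dd h) 0 = ∅) :
    finrank L W + 2 ≤ finrank L G + finrank L (zl L (s1 : G) s2) := by
  classical
  have h2 := T.dim_C0
  have h3 := dim_lw0 s1 s2 h
  have h4 := dim_lw s1 s2 h 2 (by norm_num)
  have h41 := dim_lw s1 s2 h 1 (by norm_num)
  rw [Nat.cast_ofNat] at h4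
  rw [Nat.cast_one] at h41
  have h5 := dim_zl s1 s2
  have h6 := dim_z T hZ
  rw [hΦ, Finset.card_empty, add_zero] at h3 h6
  have hlw0 : ∀ v ∈ lw L (s1 : G) s2 h 0, v ∈ H := by
    have : H.toSubmodule = lw L (s1 : G) s2 h 0 := by
      apply Submodule.eq_of_le_of_finrank_eq
      · intro x hx
        exact mlw.2 ⟨H_ll s1 s2 hx, by rw [zero_smul]; exact cartan_comm h.2 hx⟩
      · rw [h3]; rfl
    intro v hv
    rw [← this] at hv
    exact hv
  have hf0 : kproj T.ssh f = 0 :=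
    eq_zero_of_isNilpotent_ad_of_mem_isCartanSubalgebra L G H (hlw0 _ (T.ph_mem T.f_le).1.2) (f0_nil T)
  have hD := combD hb hr hΦ
  have hne1 : (Phi (rootSystem H) (UU s1 s2) (dd h) 1).card ≠ 1 := by
    intro h1
    rw [h1] at h41
    obtain ⟨b, hb0, hbs⟩ := finrank_eq_one_iff'.1 h41
    have hc : ∀ i : ℕ, (-1 : L) + 2 + i ≠ 0 := by
      intro i; simpa using T.nz (-1) (by norm_num) i
    obtain ⟨a, ha, hab⟩ := T.surj (c := -1) hc (v := b) (by
      have := b.2; rwa [show (-1 : L) + 2 = 1 by norm_num])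
    have ha0 : a = 0 := by
      apply T.nd ha
      intro w hw
      rw [neg_neg] at hw
      obtain ⟨c, hc⟩ := hbs ⟨w, hw⟩
      have hc : c • (b : G) = w := congrArg Subtype.val hc
      rw [← hc, map_smul, ksymm, ← hab, kinv, lie_self, map_zero, smul_zero]
    apply hb0
    ext
    rw [← hab, ha0, lie_zero]; rfl
  have hc2 : (Phi (rootSystem H) (UU s1 s2) (dd h) 1).card = 2 := by
    have := hD.1
    omega
  obtain ⟨⟨A, B, hAB, hAB2, hABU⟩, hge3⟩ := hD.2 hc2
  have hE := combE (Or.inl hr) hΦ (by rw [← Finset.nonempty_iff_ne_empty, ← Finset.card_pos]; omega)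
  have hP2 := Finset.card_pos.2 (phi2_ne T he)
  have hlw2 : finrank L (lw L (s1 : G) s2 h 2) = 1 := by omega
  have hlw2s : ∀ v ∈ lw L (s1 : G) s2 h 2, ∃ c : L, v = c • e := by
    have := (finrank_eq_one_iff_of_nonzero' (⟨e, T.e2⟩ : lw L (s1 : G) s2 h 2) (by
      intro h; exact he (congrArg Subtype.val h))).1 hlw2
    intro v hv
    obtain ⟨c, hc⟩ := this ⟨v, hv⟩
    exact ⟨c, (congrArg Subtype.val hc).symm⟩
  have hlw3 : ∀ j : ℕ, 3 ≤ j → ∀ v ∈ lw L (s1 : G) s2 h (j : L), v = 0 := by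
    intro j hj v hv
    have := dim_lw s1 s2 h j (by omega)
    rw [hge3 j hj, Finset.card_empty, Submodule.finrank_eq_zero] at this
    rw [this] at hv
    simpa using hv
  have hee : ⁅e, e⁆ = 0 := lie_self e
  have hele : e ∈ le L (s1 : G) s2 e := mle.2 ⟨T.e_mem, hee⟩
  obtain ⟨w0, hw0, f1, hf1, c, hfd⟩ : ∃ w0 ∈ lw L (s1 : G) s2 h 0, ∃ f1 ∈ lw L (s1 : G) s2 h 1,
      ∃ c : L, f = w0 + f1 + c • e := by
    obtain ⟨N, hN⟩ := T.le_ind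
    refine hN (p := fun f => ∃ w0 ∈ lw L (s1 : G) s2 h 0, ∃ f1 ∈ lw L (s1 : G) s2 h 1,
      ∃ c : L, f = w0 + f1 + c • e) ⟨0, Submodule.zero_mem _, 0, Submodule.zero_mem _, 0, by simp⟩ ?_ ?_
      f T.f_le
    · rintro _ _ ⟨a1, ha1, a2, ha2, a3, rfl⟩ ⟨b1, hb1, b2, hb2, b3, rfl⟩
      exact ⟨_, Submodule.add_mem _ ha1 hb1, _, Submodule.add_mem _ ha2 hb2, a3 + b3, by module⟩
    · intro i _ v _ hv
      match i, hv with
      | 0, hv => exact ⟨v, by simpa using hv, 0, Submodule.zero_mem _, 0, by simp⟩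
      | 1, hv => exact ⟨0, Submodule.zero_mem _, v, by simpa using hv, 0, by simp⟩
      | 2, hv =>
        obtain ⟨c, hc⟩ := hlw2s v (by simpa using hv)
        exact ⟨0, Submodule.zero_mem _, 0, Submodule.zero_mem _, c, by simp [hc]⟩
      | n + 3, hv =>
        exact ⟨0, Submodule.zero_mem _, 0, Submodule.zero_mem _, 0, by
          simp [hlw3 (n + 3) (by omega) v hv]⟩
  have hw00 : w0 = 0 := by
    have hk := congrArg (kproj T.ssh) hfd
    rw [hf0, map_add, map_add, map_smul, T.ph_wt (mlw.1 hf1).2 one_ne_zero,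
      T.ph_wt T.he (by norm_num), smul_zero, add_zero, add_zero, kproj_of] at hk
    · exact hk.symm
    · simpa using (mlw.1 hw0).2
  rw [hw00, zero_add] at hfd
  have hf1le : f1 ∈ le L (s1 : G) s2 e := by
    have : f1 = f - c • e := by rw [hfd]; abel
    rw [this]
    exact Submodule.sub_mem _ T.f_le (Submodule.smul_mem _ _ hele)
  have hae : ∀ a ∈ le L (s1 : G) s2 e, ⁅a, e⁆ = 0 := fun a ha => sw (mle.1 ha).2
  by_cases hf10 : f1 = 0
  · rw [hf10, zero_add] at hfd
    have := count1 T hW hz (Submodule.span L {e}) (fun δ D hD => by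
      rw [hfd, hD.smul, hD.de, smul_zero, add_zero]
      exact Submodule.smul_mem _ _ (Submodule.mem_span_singleton_self e)) (fun a ha => by
      rw [hfd, lie_smul, hae a ha, smul_zero]; exact Submodule.zero_mem _)
    rw [finrank_span_singleton he] at this
    omega
  · exfalso
    have hhf1 : ⁅(h : G), f1⁆ = f1 := by simpa using (mlw.1 hf1).2
    obtain ⟨a1, ha1, ha1f⟩ : ∃ a1 ∈ lw L (s1 : G) s2 h 1, ⁅a1, f1⁆ ≠ 0 := by
      by_contra hcon
      push Not at hcon
      have huf : ⁅u, f1⁆ = 0 := by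
        apply T.nd (c := -1)
        · refine mlw.2 ⟨ll_lie T.ul (mlw.1 hf1).1, ?_⟩
          rw [leibniz_lie, T.hu, hhf1, smul_lie]
          module
        · intro w hw
          rw [neg_neg] at hw
          rw [kinv, sw (hcon w hw), map_zero]
      apply hf10
      rw [← hhf1, ← T.eu, lie_lie, huf, (mle.1 hf1le).2, lie_zero, lie_zero, sub_zero]
    obtain ⟨a0, ha0, ha0f⟩ : ∃ a0 ∈ le L (s1 : G) s2 e ⊓ lw L (s1 : G) s2 h 0, ⁅a0, f1⁆ ≠ 0 := by
      by_contra hcon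
      push Not at hcon
      have : le L (s1 : G) s2 e ⊓ lw L (s1 : G) s2 h 0 ≤ zl L (s1 : G) s2 := by
        intro c hc
        have hcH := hlw0 c hc.2
        obtain ⟨α, hα, hαc⟩ := lw_root s1 s2 h ⟨c, hcH⟩ 2 (by norm_num) (v := e)
          (by exact_mod_cast T.e2) he (hae c hc.1)
        obtain ⟨γ, hγ, hγc⟩ := lw_root s1 s2 h ⟨c, hcH⟩ 1 (by norm_num) (v := f1)
          (by simpa using hf1) hf10 (hcon c hc)
        rw [hAB2 α hα, LinearMap.add_apply] at hαc
        have hcc : (rootSystem H).root A ⟨c, hcH⟩ = 0 ∧ (rootSystem H).root B ⟨c, hcH⟩ = 0 := by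
          rw [hAB] at hγ
          have hγ' : γ = A ∨ γ = B := by
            rcases (@Finset.mem_insert _ (_) _ _ _).1 hγ with hγ | hγ
            · exact Or.inl hγ
            · exact Or.inr (Finset.mem_singleton.1 hγ)
          rcases hγ' with rfl | rfl
          · exact ⟨hγc, by rwa [hγc, zero_add] at hαc⟩
          · exact ⟨by rwa [hγc, add_zero] at hαc, hγc⟩
        refine (mzl' (v := ⟨c, hcH⟩)).2 ?_
        rw [Submodule.mem_dualCoannihilator]
        intro φ hφ
        exact hABU (Dual.eval L H ⟨c, hcH⟩) hcc.1 hcc.2 φ hφ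
      have := Submodule.finrank_mono this
      omega
    have ha1le : a1 ∈ le L (s1 : G) s2 e := mle.2 ⟨(mlw.1 ha1).1, hlw3 3 le_rfl _ (by
      have := T.e_lw ha1
      rwa [show (1 : L) + 2 = ((3 : ℕ) : L) by norm_num] at this)⟩
    have hha0 : ⁅(h : G), a0⁆ = 0 := by simpa using (mlw.1 ha0.2).2
    have hha1 : ⁅(h : G), a1⁆ = a1 := by simpa using (mlw.1 ha1).2
    have r1 : ⁅(h : G), ⁅a1, f1⁆⁆ = (2 : L) • ⁅a1, f1⁆ := by
      rw [leibniz_lie, hha1, hhf1]; module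
    have r0 : ⁅(h : G), ⁅a0, f1⁆⁆ = ⁅a0, f1⁆ := by
      rw [leibniz_lie, hha0, hhf1, zero_lie, zero_add]
    have q1 : ⁅f, a1⁆ = - ⁅a1, f1⁆ := by
      rw [← lie_skew, hfd, lie_add, lie_smul, hae a1 ha1le, smul_zero, add_zero]
    have q0 : ⁅f, a0⁆ = - ⁅a0, f1⁆ := by
      rw [← lie_skew, hfd, lie_add, lie_smul, hae a0 ha0.1, smul_zero, add_zero]
    have := rank2 (ad L G f : End L G) (le L (s1 : G) s2 e) ha1le ha0.1 (by
      intro s t hst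
      rw [ad_apply, ad_apply, q1, q0] at hst
      have hst2 := congrArg (fun v => ⁅(h : G), v⁆) hst
      simp only [lie_add, lie_smul, lie_neg, r1, r0, lie_zero] at hst2
      have hs : s • ⁅a1, f1⁆ = 0 := by
        have : s • ⁅a1, f1⁆ = (s • -⁅a1, f1⁆ + t • -⁅a0, f1⁆) - (s • -((2 : L) • ⁅a1, f1⁆) + t • -⁅a0, f1⁆) := by
          module
        rw [this, hst, hst2, sub_zero]
      have hs := (smul_eq_zero.1 hs).resolve_right ha1f
      refine ⟨hs, ?_⟩
      rw [hs, zero_smul, zero_add, smul_neg, neg_eq_zero] at hst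
      exact (smul_eq_zero.1 hst).resolve_right ha0f)
    omega

end
end CVP

namespace CVP
open LieAlgebra Module LieAlgebra.IsKilling

section
variable {L : Type*} [Field L] [CharZero L] [IsAlgClosed L]
  {G : Type*} [LieRing G] [LieAlgebra L G] [FiniteDimensional L G] [IsKilling L G]

/-- the numerical hypothesis -/
def Lace (L G : Type*) [Field L] [CharZero L] [IsAlgClosed L] [LieRing G] [LieAlgebra L G]
    [FiniteDimensional L G] [IsKilling L G] (c : ℕ) : Prop :=
  c = 2 ∨ (c = 3 ∧ ∀ (H : LieSubalgebra L G) [H.IsCartanSubalgebra], PB (rootSystem H) 2) ∨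
    (c = 4 ∧ ∀ (H : LieSubalgebra L G) [H.IsCartanSubalgebra], PB (rootSystem H) 1)

lemma base_cartan {s1 s2 h e f u : G} (T : Trip L s1 s2 e f h u) :
    ∃ H : LieSubalgebra L G, H.IsCartanSubalgebra ∧ s1 ∈ H ∧ s2 ∈ H ∧ h ∈ H := by
  have h1 := mll.1 T.hl
  obtain ⟨H, hH, hS⟩ := exists_cartan (L := L) {s1, s2, h} (by
    rintro a (rfl | rfl | rfl)
    · exact T.ss1
    · exact T.ss2
    · exact T.ssh) (by
    rintro a (rfl | rfl | rfl) b (rfl | rfl | rfl)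
    · exact lie_self _
    · exact T.c12
    · exact h1.1
    · exact sw T.c12
    · exact lie_self _
    · exact h1.2
    · exact sw h1.1
    · exact sw h1.2
    · exact lie_self _)
  exact ⟨H, hH, hS (by simp), hS (by simp), hS (by simp)⟩

lemma K_e {s1 s2 e f : G} (B : Base L s1 s2 e f) {W : Submodule L (G × G)} (hW : WD (s1 + e) (s2 + f) W)
    (hz : ∀ a, ⁅s1 + e, a⁆ = 0 → ⁅s2 + f, a⁆ = 0 → a ∈ le L s1 s2 e) {ρ : ℕ}
    (hρ : ∀ (H : LieSubalgebra L G) [H.IsCartanSubalgebra], finrank L H = ρ)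
    (hZ : ρ < finrank L ↥(le L s1 s2 e ⊓ LinearMap.ker (ad L G f))) {c : ℕ} (hc : Lace L G c)
    (he : e ≠ 0) : finrank L W + c ≤ finrank L G + ρ := by
  obtain ⟨h, u, T⟩ := B.exists_trip
  obtain ⟨H, hH, m1, m2, m3⟩ := base_cartan T
  lift s1 to H using m1
  lift s2 to H using m2
  lift h to H using m3
  rw [← hρ H] at hZ ⊢
  have h1 := r_ge T he hZ
  have h2 := countZ T hW hz
  have h3 := dim_zl s1 s2
  rcases hc with rfl | ⟨rfl, hb⟩ | ⟨rfl, hb⟩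
  · omega
  · by_cases hr : finrank L (UU s1 s2) = 2
    · have := gain1 T hW hz he hZ (Or.inl ⟨hr, hb H⟩)
      omega
    · omega
  · by_cases hr : finrank L (UU s1 s2) = 2
    · have : finrank L W + 2 ≤ finrank L G + finrank L (zl L (s1 : G) s2) := by
        by_cases hΦ : Phi (rootSystem H) (UU s1 s2) (dd h) 0 = ∅
        · exact gain2b T hW hz he hZ hr (hb H) hΦ
        · exact gain2a T hW hz he hZ hr (hb H) hΦ
      omega
    · by_cases hr3 : finrank L (UU s1 s2) = 3
      · have := gain1 T hW hz he hZ (Or.inr ⟨hr3, hb H⟩)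
        omega
      · omega

lemma K_0 {s1 s2 : G} (B : Base L s1 s2 0 0) {W : Submodule L (G × G)} (hW : WD (s1 + 0) (s2 + 0) W)
    (hz : ∀ a, ⁅s1 + 0, a⁆ = 0 → ⁅s2 + 0, a⁆ = 0 → a ∈ le L s1 s2 0) {ρ : ℕ}
    (hρ : ∀ (H : LieSubalgebra L G) [H.IsCartanSubalgebra], finrank L H = ρ)
    (hZ : ρ < finrank L ↥(le L s1 s2 0 ⊓ LinearMap.ker (ad L G (0 : G)))) : 
    finrank L W + 4 ≤ finrank L G + ρ := by
  classical
  obtain ⟨h, u, T⟩ := B.exists_trip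
  obtain ⟨H, hH, m1, m2, m3⟩ := base_cartan T
  lift s1 to H using m1
  lift s2 to H using m2
  lift h to H using m3
  rw [← hρ H] at hZ ⊢
  have h1 := count1 T hW hz ⊥ (fun δ D _ => by simp) (by simp)
  have h2 : le L (s1 : G) s2 0 = ll L (s1 : G) s2 := by
    ext v; rw [mle]; simp
  have h3 := dim_ll s1 s2
  have h4 := dim_zl s1 s2
  rw [h2] at h1 hZ
  have h5 : finrank L ↥(ll L (s1 : G) s2 ⊓ LinearMap.ker (ad L G (0 : G))) ≤
    finrank L (ll L (s1 : G) s2) := Submodule.finrank_mono inf_le_left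
  obtain ⟨α, hα⟩ := Finset.card_pos.1 (show 0 < (Finset.univ.filter fun α : H.root => 
    (rootSystem H).root α ∈ UU s1 s2).card by omega)
  rw [Finset.mem_filter] at hα
  obtain ⟨α', hneg⟩ : ∃ α', (rootSystem H).root α' = - (rootSystem H).root α :=
    ⟨(rootSystem H).reflectionPerm α α, by rw [RootPairing.root_reflectionPerm, RootPairing.reflection_apply_self]⟩
  have hneq : α ≠ α' := by
    intro h
    have h6 := hneg
    rw [← h] at h6
    have h7 : (2:L) • (rootSystem H).root α = 0 := by
      rw [two_smul]; nth_rewrite 1 [h6]; exact neg_add_cancel _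
    exact (rootSystem H).ne_zero α ((smul_eq_zero.1 h7).resolve_left two_ne_zero)
  have h6 : 2 ≤ (Finset.univ.filter fun α : H.root => (rootSystem H).root α ∈ UU s1 s2).card := by
    rw [← Finset.card_pair hneq]
    apply Finset.card_le_card
    intro x hx
    rw [Finset.mem_filter]
    refine ⟨Finset.mem_univ _, ?_⟩
    rw [Finset.mem_insert, Finset.mem_singleton] at hx
    rcases hx with rfl | rfl
    · exact hα.2
    · rw [hneg]; exact Submodule.neg_mem _ hα.2
  have h7 : 1 ≤ finrank L (UU s1 s2) := by
    rw [Nat.one_le_iff_ne_zero]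
    intro h0
    rw [Submodule.finrank_eq_zero] at h0
    have := hα.2
    rw [h0] at this
    simp at this
  rw [finrank_bot] at h1
  omega

lemma Base.swap {s1 s2 e f : G} (B : Base L s1 s2 e f) : Base L s2 s1 f e :=
  ⟨B.ss2, B.ss1, B.nf, B.ne, sw B.c12, B.c2f, B.c2e, B.c1f, B.c1e, sw B.cef⟩

/-- Theorem K -/
theorem thmK {x y : G} (hxy : ⁅x, y⁆ = 0) {W : Submodule L (G × G)} (hW : WD x y W) {ρ : ℕ}
    (hρ : ∀ (H : LieSubalgebra L G) [H.IsCartanSubalgebra], finrank L H = ρ)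
    (hZ : ρ < finrank L ↥(LinearMap.ker (ad L G x) ⊓ LinearMap.ker (ad L G y))) {c : ℕ}
    (hc : Lace L G c) : finrank L W + c ≤ finrank L G + ρ := by
  obtain ⟨s1, e, rfl, ss1, ne, hs1, -⟩ := jordan (L := L) x
  obtain ⟨s2, f, rfl, ss2, nf, hs2, -⟩ := jordan (L := L) y
  have he : ∀ w : G, ⁅s1 + e, w⁆ = 0 → ⁅e, w⁆ = 0 := fun w hw => by
    have := hs1 w hw
    rwa [add_lie, this, zero_add] at hw
  have hf : ∀ w : G, ⁅s2 + f, w⁆ = 0 → ⁅f, w⁆ = 0 := fun w hw => by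
    have := hs2 w hw
    rwa [add_lie, this, zero_add] at hw
  have hyx := sw hxy
  have c1x := hs1 _ (lie_self (s1 + e))
  have c1y := hs1 _ hxy
  have cex := he _ (lie_self (s1 + e))
  have cey := he _ hxy
  have k1 := hs2 _ (sw c1y)
  have k2 := hf _ (sw c1y)
  have k3 := hs2 _ (sw cey)
  have k4 := hf _ (sw cey)
  have c1e : ⁅s1, e⁆ = 0 := by simpa using c1x
  have B : Base L s1 s2 e f := ⟨ss1, ss2, ne, nf, sw k1, c1e, sw k2, k3, by
    have := hs2 _ (lie_self (s2 + f)); simpa using this, sw k4⟩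
  have hZeq : LinearMap.ker (ad L G (s1 + e)) ⊓ LinearMap.ker (ad L G (s2 + f)) ≤
      le L s1 s2 e ⊓ LinearMap.ker (ad L G f) := by
    rintro v ⟨h1, h2⟩
    have h1 : ⁅s1 + e, v⁆ = 0 := h1
    have h2 : ⁅s2 + f, v⁆ = 0 := h2
    exact ⟨mle.2 ⟨mll.2 ⟨hs1 v h1, hs2 v h2⟩, he v h1⟩, hf v h2⟩
  have hZ' := hZ.trans_le (Submodule.finrank_mono hZeq)
  have hz : ∀ a, ⁅s1 + e, a⁆ = 0 → ⁅s2 + f, a⁆ = 0 → a ∈ le L s1 s2 e := fun a h1 h2 =>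
    mle.2 ⟨mll.2 ⟨hs1 a h1, hs2 a h2⟩, he a h1⟩
  by_cases he0 : e = 0
  · by_cases hf0 : f = 0
    · subst he0 hf0
      have := K_0 B hW hz hρ hZ'
      have : c ≤ 4 := by rcases hc with h | h | h <;> omega
      omega
    · let E : (G × G) ≃ₗ[L] (G × G) := LinearEquiv.prodComm L G G
      have hW' : WD (s2 + f) (s1 + e) (W.map (E : (G × G) →ₗ[L] G × G)) := by
        rintro _ ⟨w, hw, rfl⟩
        obtain ⟨δ, D, hD, rfl⟩ := hW w hw
        exact ⟨δ, D, hD, rfl⟩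
      have h3 := K_e B.swap hW' (fun a h1 h2 => mle.2 ⟨mll.2 ⟨hs2 a h1, hs1 a h2⟩, hf a h1⟩) hρ
        (hZ.trans_le (Submodule.finrank_mono (by
          rintro v ⟨h1, h2⟩
          have h1 : ⁅s1 + e, v⁆ = 0 := h1
          have h2 : ⁅s2 + f, v⁆ = 0 := h2
          exact ⟨mle.2 ⟨mll.2 ⟨hs2 v h2, hs1 v h1⟩, hf v h2⟩, he v h1⟩))) hc hf0
      rwa [LinearEquiv.finrank_map_eq] at h3
  · exact K_e B hW hz hρ hZ' hc he0

end
end CVP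

namespace CVP
open LieAlgebra Module LieAlgebra.IsKilling

section
variable {L : Type*} [Field L] [CharZero L] [IsAlgClosed L]
  {G : Type*} [LieRing G] [LieAlgebra L G] [FiniteDimensional L G] [IsKilling L G]
  (H : LieSubalgebra L G) [H.IsCartanSubalgebra]

/-- roots together with zero -/
def rz : Option H.root → Dual L H
  | none => 0
  | some α => α.1.toLinear

lemma rz_sep : ∃ x : H, ∀ a b : Option H.root, a ≠ b → rz H a x ≠ rz H b x := by
  have := Module.Dual.exists_forall_ne_zero_of_forall_exists
    (f := fun p : {p : Option H.root × Option H.root // p.1 ≠ p.2} => rz H p.1.1 - rz H p.1.2) (by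
      rintro ⟨⟨a, b⟩, hab⟩
      by_contra! h
      have h1 : rz H a = rz H b := by
        ext v; have := h v; simpa [sub_eq_zero] using this
      rcases a with _ | α <;> rcases b with _ | β
      · exact hab rfl
      · have := (rootSystem H).ne_zero β
        exact this h1.symm
      · exact (rootSystem H).ne_zero α h1
      · apply hab
        have := (rootSystem H).root.injective (a₁ := α) (a₂ := β) h1
        rw [this])
  obtain ⟨x, hx⟩ := this
  refine ⟨x, fun a b hab h => hx ⟨(a, b), hab⟩ ?_⟩
  simp [h]

lemma rz_ad (x : H) {b : Basis (Fin (finrank L H) ⊕ H.root) L G} (hb1 : ∀ i, b (Sum.inl i) ∈ H)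
    (hb2 : ∀ α, b (Sum.inr α) ∈ rootSpace H α.1) (i) :
    ad L G (x : G) (b i) = rz H (Sum.elim (fun _ => none) some i) x • b i := by
  rcases i with i | α
  · simp only [Sum.elim_inl, rz]
    rw [LinearMap.zero_apply, zero_smul]
    exact cartan_comm x.2 (hb1 i)
  · simp only [Sum.elim_inr, rz]
    exact lie_eq_smul_of_mem_rootSpace (hb2 α) x

lemma rz_poly {x : H} (hx : ∀ a b : Option H.root, a ≠ b → rz H a x ≠ rz H b x) (w : H) :
    ∃ p : Polynomial L, ad L G (w : G) = Polynomial.aeval (ad L G (x : G)) p := by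
  obtain ⟨b, hb1, hb2⟩ := exists_ab H
  classical
  let p := Lagrange.interpolate (Finset.univ : Finset (Option H.root)) (fun a => rz H a x) (fun a => rz H a w)
  have hp : ∀ a, p.eval (rz H a x) = rz H a w := fun a =>
    Lagrange.eval_interpolate_at_node (v := fun a => rz H a x) (r := fun a => rz H a w)
      (fun a _ b _ h => by_contra fun h' => hx a b h' h) (Finset.mem_univ a)
  refine ⟨p, b.ext fun i => ?_⟩
  rw [rz_ad H w hb1 hb2, Module.End.aeval_apply_of_hasEigenvector (μ := rz H (Sum.elim (fun _ => none) some i) x), hp]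
  exact ⟨Module.End.mem_eigenspace_iff.2 (rz_ad H x hb1 hb2 i), b.ne_zero i⟩

lemma rz_trace {x : H} (hx : ∀ a b : Option H.root, a ≠ b → rz H a x ≠ rz H b x) (v : H)
    (hv : ∀ n : ℕ, LinearMap.trace L G (ad L G (x : G) ^ n * ad L G (v : G)) = 0) : v = 0 := by
  refine (traceForm_cartan_nondegenerate L G H).1 v fun w => ?_
  rw [LieModule.traceForm_comm, LieModule.traceForm_apply_apply]
  obtain ⟨p, hp⟩ := rz_poly H hx w
  have h1 : (LieModule.toEnd L H G w) ∘ₗ (LieModule.toEnd L H G v) =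
    Polynomial.aeval (ad L G (x : G)) p * ad L G (v : G) := by rw [← hp]; rfl
  rw [h1, Polynomial.aeval_eq_sum_range, Finset.sum_mul, map_sum]
  refine Finset.sum_eq_zero fun n _ => ?_
  rw [smul_mul_assoc, map_smul, hv, smul_zero]

lemma rz_engel {x : H} (hx : ∀ a b : Option H.root, a ≠ b → rz H a x ≠ rz H b x) :
    finrank L (LieSubalgebra.engel L (x : G)) ≤ finrank L H := by
  have h1 : (LieSubalgebra.engel L (x : G)).toSubmodule ≤ H.toSubmodule := by
    intro v hv
    obtain ⟨b, hb1, hb2⟩ := exists_ab H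
    obtain ⟨n, hn⟩ := (LieSubalgebra.mem_engel_iff L (x : G) v).1 hv
    have h2 : ∀ v, (ad L G (x : G) ^ n) v = ∑ i, b.repr v i • rz H (Sum.elim (fun _ => none) some i) x ^ n • b i := by
      intro v
      conv_lhs => rw [← b.sum_repr v, map_sum]
      refine Finset.sum_congr rfl fun i _ => ?_
      rw [map_smul]
      congr 1
      have h3 := Module.End.aeval_apply_of_hasEigenvector (f := ad L G (x : G)) (p := Polynomial.X ^ n)
        (μ := rz H (Sum.elim (fun _ => none) some i) x) (x := b i)
        ⟨Module.End.mem_eigenspace_iff.2 (rz_ad H x hb1 hb2 i), b.ne_zero i⟩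
      simpa using h3
    have h3 := h2 v
    rw [hn] at h3
    rw [← b.sum_repr v]
    refine Submodule.sum_mem _ fun i _ => ?_
    rcases i with i | α
    · exact Submodule.smul_mem _ _ (hb1 i)
    · have h4 : b.repr v (Sum.inr α) * rz H (some α) x ^ n = 0 := by
        simp_rw [smul_smul] at h3
        exact (Fintype.linearIndependent_iff.1 b.linearIndependent _ h3.symm (Sum.inr α))
      rcases mul_eq_zero.1 h4 with h5 | h5
      · rw [h5, zero_smul]; exact Submodule.zero_mem _
      · exact absurd (eq_zero_of_pow_eq_zero h5) (hx (some α) none (by simp))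
  exact Submodule.finrank_mono h1

lemma trace_range (z : G) (n : ℕ) (u : G) :
    LinearMap.trace L G (ad L G z ^ n * ad L G ⁅z, u⁆) = 0 := by
  have h : ad L G ⁅z, u⁆ = ad L G z * ad L G u - ad L G u * ad L G z := by
    ext v; simp
  rw [h, mul_sub, map_sub, ← mul_assoc, ← mul_assoc, LinearMap.trace_mul_comm L (ad L G z ^ n * ad L G u),
    ← mul_assoc, ← pow_succ, ← pow_succ', sub_self]

/-- All Cartan subalgebras have the same dimension. -/
theorem cartan_rank : finrank L H = LieAlgebra.rank L G := by
  obtain ⟨x, hx⟩ := rz_sep H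
  apply le_antisymm _ ((rank_le_finrank_engel L (x : G)).trans (rz_engel H hx))
  obtain ⟨x', hx'⟩ := LieAlgebra.exists_isRegular L G
  let φ (z : G) (n : ℕ) : G →ₗ[L] L :=
    LinearMap.trace L G ∘ₗ LinearMap.mulLeft L (ad L G z ^ n) ∘ₗ (ad L G : G →ₗ[L] _)
  have hφ : ∀ z n u, φ z n u = LinearMap.trace L G (ad L G z ^ n * ad L G u) := fun _ _ _ => rfl
  let ψ : ℕ → Dual L H := fun n => φ x n ∘ₗ H.toSubmodule.subtype
  have hspan : Submodule.span L (Set.range ψ) = ⊤ := by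
    rw [← Subspace.dualCoannihilator_dualAnnihilator_eq (W := Submodule.span L (Set.range ψ))]
    have : (Submodule.span L (Set.range ψ)).dualCoannihilator = ⊥ := by
      rw [eq_bot_iff]
      intro v hv
      rw [Submodule.mem_dualCoannihilator] at hv
      exact rz_trace H hx v fun n => hv (ψ n) (Submodule.subset_span ⟨n, rfl⟩)
    rw [this, Submodule.dualAnnihilator_bot]
  obtain ⟨f, hf1, -, hf3⟩ := Submodule.exists_fun_fin_finrank_span_eq L (Set.range ψ)
  choose n hn using hf1
  have hd : finrank L H = finrank L (Submodule.span L (Set.range ψ)) := by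
    rw [hspan, finrank_top, Subspace.dual_finrank_eq]
  generalize finrank L (Submodule.span L (Set.range ψ)) = d at *
  let b := Module.finBasisOfFinrankEq L H hd
  let B := Module.finBasis L G
  let X := LinearMap.toMatrix B B (ad L G (x : G))
  let X' := LinearMap.toMatrix B B (ad L G x')
  let V := fun j => LinearMap.toMatrix B B (ad L G (b j : G))
  let A : Matrix _ _ (Polynomial L) := X.map Polynomial.C + (Polynomial.X : Polynomial L) • (X' - X).map Polynomial.C
  have hA : ∀ s : L, A.map (Polynomial.evalRingHom s) = LinearMap.toMatrix B B (ad L G ((x : G) + s • (x' - x))) := by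
    intro s
    ext i j
    simp [A, X, X']
  let F : Polynomial L := Matrix.det (Matrix.of fun i j => Matrix.trace (A ^ n i * (V j).map Polynomial.C))
  let E : Polynomial L := A.charpoly.coeff (LieAlgebra.rank L G)
  have hF : ∀ s : L, F.eval s = Matrix.det (Matrix.of fun i j => φ ((x : G) + s • (x' - x)) (n i) (b j)) := by
    intro s
    change Polynomial.evalRingHom s F = _
    rw [RingHom.map_det]
    congr 1
    ext i j
    simp only [RingHom.mapMatrix_apply, Matrix.map_apply, Matrix.of_apply]
    have h1 : (Polynomial.evalRingHom s) (Matrix.trace (A ^ n i * (V j).map Polynomial.C)) =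
      Matrix.trace ((Polynomial.evalRingHom s).mapMatrix (A ^ n i * (V j).map Polynomial.C)) := by
      exact AddMonoidHom.map_trace (Polynomial.evalRingHom s).toAddMonoidHom _
    rw [h1, map_mul, map_pow, hφ, LinearMap.trace_eq_matrix_trace L B, LinearMap.toMatrix_mul, ← LinearMap.toMatrix_pow]
    congr 2
    · rw [RingHom.mapMatrix_apply, hA]
    · ext i j; simp [V]
  have hE : ∀ s : L, E.eval s = (ad L G ((x : G) + s • (x' - x))).charpoly.coeff (LieAlgebra.rank L G) := by
    intro s
    rw [← LinearMap.charpoly_toMatrix _ B, ← hA, Matrix.charpoly_map, Polynomial.coeff_map]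
    rfl
  have hF0 : F ≠ 0 := by
    intro h
    have h1 := hF 0
    rw [h, Polynomial.eval_zero, zero_smul, add_zero] at h1
    obtain ⟨c, hc, hc'⟩ := Matrix.exists_vecMul_eq_zero_iff.2 h1.symm
    apply hc
    have h2 : ∑ i, c i • f i = 0 := by
      apply b.ext
      intro j
      have := congrFun hc' j
      simp only [Matrix.vecMul, dotProduct, Matrix.of_apply, Pi.zero_apply] at this
      rw [LinearMap.zero_apply, ← this, LinearMap.sum_apply]
      refine Finset.sum_congr rfl fun i _ => ?_
      rw [← hn]; rfl
    funext i
    exact Fintype.linearIndependent_iff.1 hf3 c h2 i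
  have hE0 : E ≠ 0 := by
    intro h
    have h1 := hE 1
    rw [h, Polynomial.eval_zero, one_smul, add_sub_cancel] at h1
    exact (LieAlgebra.isRegular_def L x').1 hx' h1.symm
  obtain ⟨s, hs⟩ : ∃ s, (F * E).eval s ≠ 0 := by
    by_contra! h
    exact mul_ne_zero hF0 hE0 (Polynomial.funext (by simpa using h))
  rw [Polynomial.eval_mul, hF, hE] at hs
  obtain ⟨hs1, hs2⟩ := mul_ne_zero_iff.1 hs
  set z := (x : G) + s • (x' - x)
  have hz := (isRegular_iff_finrank_engel_eq_rank L z).1 ((LieAlgebra.isRegular_def L z).2 hs2)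
  rw [← hz, hd]
  have h1 : finrank L (LinearMap.ker (ad L G z)) ≤ finrank L (LieSubalgebra.engel L z) := by
    apply Submodule.finrank_mono
    intro v hv
    exact (LieSubalgebra.mem_engel_iff L z v).2 ⟨1, by simpa using hv⟩
  refine le_trans ?_ h1
  have h2 := LinearMap.finrank_range_add_finrank_ker (ad L G z)
  have h3 := Subspace.finrank_add_finrank_dualAnnihilator_eq (LinearMap.range (ad L G z))
  have h4' : LinearIndependent L (fun i : Fin d => (φ z (n i) : Dual L G)) := by
    rw [Fintype.linearIndependent_iff]
    intro c hc
    by_contra! h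
    apply hs1
    rw [← Matrix.exists_vecMul_eq_zero_iff]
    refine ⟨c, fun h' => ?_, ?_⟩
    · obtain ⟨i, hi⟩ := h; exact hi (congrFun h' i)
    · funext j
      have := congrArg (fun u : Dual L G => u (b j)) hc
      simpa [Matrix.vecMul, dotProduct, LinearMap.sum_apply] using this
  have hmem : ∀ i, φ z (n i) ∈ (LinearMap.range (ad L G z)).dualAnnihilator := by
    intro i
    rw [Submodule.mem_dualAnnihilator]
    rintro _ ⟨u, rfl⟩
    exact trace_range z (n i) u
  have h4 : LinearIndependent L (fun i : Fin d =>
      (⟨φ z (n i), hmem i⟩ : (LinearMap.range (ad L G z)).dualAnnihilator)) :=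
    LinearIndependent.of_comp (Submodule.subtype _) h4'
  have h5 := h4.fintype_card_le_finrank
  rw [Fintype.card_fin] at h5
  omega
end

open scoped TensorProduct in
/-- The rank is invariant under base change. -/
theorem rank_bc (K L : Type*) [Field K] [Field L] [Algebra K L] (q : Type*) [LieRing q]
    [LieAlgebra K q] [FiniteDimensional K q] :
    LieAlgebra.rank L (L ⊗[K] q) = LieAlgebra.rank K q := by
  classical
  let b := Module.finBasis K q
  have h := LinearMap.polyCharpoly_baseChange (ad K q : q →ₗ[K] Module.End K q) b L
  rw [LieAlgebra.rank_eq_natTrailingDegree K q b,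
    LieAlgebra.rank_eq_natTrailingDegree L (L ⊗[K] q) (Algebra.TensorProduct.basis L b)]
  have h1 : (ad L (L ⊗[K] q) : (L ⊗[K] q) →ₗ[L] Module.End L (L ⊗[K] q)) =
      LinearMap.tensorProduct K L q q ∘ₗ (ad K q : q →ₗ[K] Module.End K q).baseChange L := by
    ext x y
    simp [LinearMap.tensorProduct]
  rw [h1, h]
  unfold Polynomial.natTrailingDegree Polynomial.trailingDegree
  rw [Polynomial.support_map_of_injective _ (MvPolynomial.map_injective _ (algebraMap K L).injective)]
end CVP

namespace CVP
open LieAlgebra Module LieAlgebra.IsKilling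

/-- two root vectors for a torus with Cartan integer `c` -/
structure QN (K q : Type*) [Field K] [LieRing q] [LieAlgebra K q] (c : K)
    (T : Submodule K q) (e f h a : q) (α β : q → K) : Prop where
  ab : ∀ x ∈ T, ∀ y ∈ T, ⁅x, y⁆ = 0
  ss : ∀ x ∈ T, ∀ v : q, ⁅x, ⁅x, v⁆⁆ = 0 → ⁅x, v⁆ = 0
  self : ∀ v : q, (∀ x ∈ T, ⁅x, v⁆ = 0) → v ∈ T
  hT : h ∈ T
  sl : IsSl2Triple h e f
  ha : a ≠ 0
  wa : ∀ x ∈ T, ⁅x, a⁆ = α x • a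
  we : ∀ x ∈ T, ⁅x, e⁆ = β x • e
  wf : ∀ x ∈ T, ⁅x, f⁆ = - (β x • f)
  hc : α h = c
  np : ∃ x ∈ T, ∃ y ∈ T, α x * β y ≠ α y * β x

section
variable {K q : Type*} [Field K] [CharZero K] [LieRing q] [LieAlgebra K q]
  {I Φ : Type*} [Fintype I] [Fintype Φ]

/-- from explicit data to `QN` -/
lemma QN_of (b : Basis (I ⊕ Φ) K q) {lam : I → Φ → K} {inx : Φ → I} (hinx : ∀ γ, lam (inx γ) γ ≠ 0)
    (R1 : ∀ i j, ⁅b (Sum.inl i), b (Sum.inl j)⁆ = 0)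
    (R2 : ∀ i γ, ⁅b (Sum.inl i), b (Sum.inr γ)⁆ = lam i γ • b (Sum.inr γ))
    {e f h x : q} (R4a : ⁅e, f⁆ = h) (R4b : ⁅h, e⁆ = 2 • e) (R4c : ⁅h, f⁆ = - (2 • f))
    {C C' : I → K} (R5 : h = ∑ i, C i • b (Sum.inl i)) (R5' : x = ∑ i, C' i • b (Sum.inl i))
    {α β : Φ}
    (R6 : ∀ i, ⁅b (Sum.inl i), e⁆ = lam i β • e) (R6' : ∀ i, ⁅b (Sum.inl i), f⁆ = - (lam i β • f))
    {N : K} (hN : N ≠ 0) (R8 : ∑ i, C i * lam i α = N) (R8a : ∑ i, C i * lam i β = 2)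
    (R8b : 2 * ∑ i, C' i * lam i α ≠ N * ∑ i, C' i * lam i β) :
    ∃ T a α' β', QN K q N T e f h a α' β' := by
  let χ : Φ → q → K := fun γ v => ∑ i, b.repr v (Sum.inl i) * lam i γ
  have hrep : ∀ (t : I → K) j, b.repr (∑ i, t i • b (Sum.inl i)) j = Sum.elim t 0 j := by
    classical
    intro t j
    have h1 : ∑ i, t i • b (Sum.inl i) = ∑ j, (Sum.elim t 0 j : K) • b j := by
      simp [Fintype.sum_sum_type]
    rw [h1, b.repr_sum_self]
  have hχ : ∀ γ (t : I → K), χ γ (∑ i, t i • b (Sum.inl i)) = ∑ i, t i * lam i γ := by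
    intro γ t
    simp only [χ, hrep, Sum.elim_inl]
  let T := Submodule.span K (Set.range fun i => b (Sum.inl i))
  have hT : ∀ v, v ∈ T ↔ ∃ t : I → K, ∑ i, t i • b (Sum.inl i) = v := fun v =>
    Submodule.mem_span_range_iff_exists_fun K
  have hgen : ∀ γ (u : q), (∀ i, ⁅b (Sum.inl i), u⁆ = lam i γ • u) → ∀ x ∈ T, ⁅x, u⁆ = χ γ x • u := by
    intro γ u hu x hx
    obtain ⟨t, rfl⟩ := (hT x).1 hx
    rw [hχ, sum_lie, Finset.sum_smul]
    refine Finset.sum_congr rfl fun i _ => ?_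
    rw [smul_lie, hu, smul_smul]
  have hex : ∀ x ∈ T, ∀ v : q, ⁅x, v⁆ = ∑ γ, (b.repr v (Sum.inr γ) * χ γ x) • b (Sum.inr γ) := by
    intro x hx v
    conv_lhs => rw [← b.sum_repr v]
    rw [lie_sum, Fintype.sum_sum_type, Finset.sum_eq_zero, zero_add]
    · refine Finset.sum_congr rfl fun γ _ => ?_
      rw [lie_smul, hgen γ _ (fun i => R2 i γ) x hx, smul_smul]
    · intro i _
      obtain ⟨t, rfl⟩ := (hT x).1 hx
      rw [lie_smul, sum_lie, Finset.sum_eq_zero, smul_zero]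
      intro j _
      rw [smul_lie, R1, smul_zero]
  have hind : LinearIndependent K fun γ => b (Sum.inr γ) :=
    b.linearIndependent.comp Sum.inr Sum.inr_injective
  have hz : ∀ c : Φ → K, ∑ γ, c γ • b (Sum.inr γ) = 0 → ∀ γ, c γ = 0 := fun c hc γ =>
    Fintype.linearIndependent_iff.1 hind c hc γ
  have hbT : ∀ i, b (Sum.inl i) ∈ T := fun i => Submodule.subset_span ⟨i, rfl⟩
  have hhT : h ∈ T := (hT h).2 ⟨C, R5.symm⟩
  have hxT : x ∈ T := (hT x).2 ⟨C', R5'.symm⟩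
  have hχ1 : χ α h = N := by rw [R5, hχ, R8]
  have hχ2 : χ β h = 2 := by rw [R5, hχ, R8a]
  have hχb : ∀ γ i, χ γ (b (Sum.inl i)) = lam i γ := by
    classical
    intro γ i
    have := hχ γ (Pi.single i 1)
    simpa [Pi.single_apply, ite_smul] using this
  refine ⟨T, b (Sum.inr α), χ α, χ β, ?_, ?_, ?_, hhT, ⟨?_, R4a, R4b, R4c⟩, b.ne_zero _, 
    hgen α _ fun i => R2 i α, hgen β _ R6, ?_, hχ1, ?_⟩
  · intro x hx y hy
    obtain ⟨t, rfl⟩ := (hT y).1 hy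
    rw [hex x hx]
    refine Finset.sum_eq_zero fun γ _ => ?_
    rw [hrep]; simp
  · intro x hx v hv
    rw [hex x hx, hex x hx v] at hv
    have h1 := hz _ hv
    rw [hex x hx]
    refine Finset.sum_eq_zero fun γ _ => ?_
    have h2 := h1 γ
    have h3 : ∀ c : Φ → K, b.repr (∑ γ, c γ • b (Sum.inr γ)) (Sum.inr γ) = c γ := by
      intro c
      have h1 : ∑ i, c i • b (Sum.inr i) = ∑ j, (Sum.elim 0 c j : K) • b j := by
        simp [Fintype.sum_sum_type]
      rw [h1, b.repr_sum_self]; rfl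
    rw [h3, mul_assoc, ← sq] at h2
    rcases mul_eq_zero.1 h2 with h4 | h4
    · rw [h4]; simp
    · rw [eq_zero_of_pow_eq_zero h4]; simp
  · intro v hv
    rw [hT]
    refine ⟨fun i => b.repr v (Sum.inl i), ?_⟩
    conv_rhs => rw [← b.sum_repr v, Fintype.sum_sum_type]
    symm
    rw [add_eq_left]
    refine Finset.sum_eq_zero fun γ _ => ?_
    have h1 := hv _ (hbT (inx γ))
    rw [hex _ (hbT _)] at h1
    have h2 := hz _ h1 γ
    rw [hχb] at h2
    rw [(mul_eq_zero.1 h2).resolve_right (hinx γ), zero_smul]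
  · intro h0
    have h1 := hgen α _ (fun i => R2 i α) h hhT
    rw [hχ1, h0, zero_lie] at h1
    exact (smul_ne_zero hN (b.ne_zero _)) h1.symm
  · intro x hx
    obtain ⟨t, rfl⟩ := (hT x).1 hx
    rw [hχ, sum_lie, Finset.sum_smul, ← Finset.sum_neg_distrib]
    refine Finset.sum_congr rfl fun i _ => ?_
    rw [smul_lie, R6', smul_neg, smul_smul]
  · refine ⟨x, hxT, h, hhT, ?_⟩
    rw [hχ1, hχ2, R5', hχ, hχ, mul_comm _ (2:K)]
    exact R8b
end

section
variable {K : Type*} [Field K] [IsAlgClosed K]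

/-- Nullstellensatz -/
lemma exists_point (A : Type*) [CommRing A] [Algebra K A] [Algebra.FiniteType K A] [Nontrivial A] :
    Nonempty (A →ₐ[K] K) := by
  obtain ⟨m, hm⟩ := Ideal.exists_maximal A
  letI : Field (A ⧸ m) := Ideal.Quotient.field m
  have h1 : Algebra.FiniteType K (A ⧸ m) := inferInstance
  have h2 : Module.Finite K (A ⧸ m) := finite_of_finite_type_of_isJacobsonRing K (A ⧸ m)
  have h3 := IsAlgClosed.algebraMap_bijective_of_isIntegral (k := K) (K := A ⧸ m)
  let ε : K ≃ₐ[K] (A ⧸ m) := AlgEquiv.ofBijective (Algebra.ofId K (A ⧸ m)) h3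
  exact ⟨ε.symm.toAlgHom.comp (Ideal.Quotient.mkₐ K m)⟩
end

end CVP

namespace CVP
open LieAlgebra Module LieAlgebra.IsKilling
open scoped TensorProduct

section
variable {L : Type*} [Field L] [CharZero L] [IsAlgClosed L]
  {G : Type*} [LieRing G] [LieAlgebra L G] [FiniteDimensional L G] [IsKilling L G]
  (H : LieSubalgebra L G) [H.IsCartanSubalgebra]

lemma repr_H {b : Basis (Fin (finrank L H) ⊕ H.root) L G} (hb1 : ∀ i, b (Sum.inl i) ∈ H)
    (hb2 : ∀ α, b (Sum.inr α) ∈ rootSpace H α.1) (x : H) :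
    (x : G) = ∑ i, b.repr x (Sum.inl i) • b (Sum.inl i) := by
  obtain ⟨y, hy⟩ := rz_sep H
  have h1 : ⁅(y : G), (x : G)⁆ = 0 := cartan_comm y.2 x.2
  have h2 : ⁅(y : G), (x : G)⁆ = ∑ i, (b.repr x i * rz H (Sum.elim (fun _ => none) some i) y) • b i := by
    conv_lhs => rw [← b.sum_repr (x : G), lie_sum]
    refine Finset.sum_congr rfl fun i _ => ?_
    rw [lie_smul, mul_smul, ← rz_ad H y hb1 hb2]; rfl
  rw [h1] at h2
  have h3 := Fintype.linearIndependent_iff.1 b.linearIndependent _ h2.symm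
  conv_lhs => rw [← b.sum_repr (x : G), Fintype.sum_sum_type]
  rw [add_eq_left]
  refine Finset.sum_eq_zero fun γ _ => ?_
  have h4 : b.repr x (Sum.inr γ) * rz H (some γ) y = 0 := h3 (Sum.inr γ)
  rw [(mul_eq_zero.1 h4).resolve_right (hy (some γ) none (by simp)), zero_smul]
end

section
variable {K L : Type*} [Field K] [Field L] [Algebra K L] {q : Type*} [LieRing q] [LieAlgebra K q]

/-- change of scalars along an algebra homomorphism -/
def bcm {A B : Type*} [CommRing A] [CommRing B] [Algebra K A] [Algebra K B] (φ : A →ₐ[K] B) :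
    A ⊗[K] q →ₗ[K] B ⊗[K] q := LinearMap.rTensor q φ.toLinearMap

variable {A B : Type*} [CommRing A] [CommRing B] [Algebra K A] [Algebra K B] (φ : A →ₐ[K] B)

lemma bcm_tmul (a : A) (v : q) : bcm φ (a ⊗ₜ[K] v) = φ a ⊗ₜ[K] v := rfl

lemma bcm_smul (a : A) (v : A ⊗[K] q) : bcm φ (a • v) = φ a • bcm φ v := by
  induction v with
  | zero => simp
  | tmul c v => simp [bcm_tmul, TensorProduct.smul_tmul']
  | add x y hx hy => simp [smul_add, hx, hy]

lemma bcm_lie (u v : A ⊗[K] q) : bcm φ ⁅u, v⁆ = ⁅bcm φ u, bcm φ v⁆ := by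
  induction u with
  | zero => simp
  | tmul c u =>
    induction v with
    | zero => simp
    | tmul d v => simp [bcm_tmul]
    | add x y hx hy => simp [hx, hy]
  | add x y hx hy => simp [hx, hy]

end

/-- specialisation of scalars -/
def spm {K A q : Type*} [Field K] [CommRing A] [Algebra K A] [LieRing q] [LieAlgebra K q] (φ : A →ₐ[K] K) :
    A ⊗[K] q →ₗ[K] q := (TensorProduct.lid K q).toLinearMap ∘ₗ LinearMap.rTensor q φ.toLinearMap

section
variable {K A q : Type*} [Field K] [CommRing A] [Algebra K A] [LieRing q] [LieAlgebra K q] (φ : A →ₐ[K] K)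

lemma spm_tmul (a : A) (v : q) : spm φ (a ⊗ₜ[K] v) = φ a • v := by simp [spm]

lemma spm_smul (a : A) (v : A ⊗[K] q) : spm φ (a • v) = φ a • spm φ v := by
  induction v with
  | zero => simp
  | tmul c v => simp [spm_tmul, TensorProduct.smul_tmul', mul_smul]
  | add x y hx hy => simp [smul_add, hx, hy]

lemma spm_lie (u v : A ⊗[K] q) : spm φ ⁅u, v⁆ = ⁅spm φ u, spm φ v⁆ := by
  induction u with
  | zero => simp
  | tmul c u =>
    induction v with
    | zero => simp
    | tmul d v => simp [spm_tmul, smul_smul, mul_comm]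
    | add x y hx hy => simp [hx, hy]
  | add x y hx hy => simp [hx, hy]
end

section
variable {K L : Type*} [Field K] [CharZero K] [IsAlgClosed K] [Field L] [CharZero L] [IsAlgClosed L] [Algebra K L]
  {q : Type*} [LieRing q] [LieAlgebra K q] [FiniteDimensional K q] [IsKilling L (L ⊗[K] q)]

set_option maxHeartbeats 1000000 in
theorem spec (H : LieSubalgebra L (L ⊗[K] q)) [H.IsCartanSubalgebra] (α β : H.root)
    (h1 : (rootSystem H).root α ≠ (rootSystem H).root β)
    (h2 : (rootSystem H).root α ≠ - (rootSystem H).root β) {N : ℤ} (hN : (rootSystem H).pairingIn ℤ α β = N)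
    (hN0 : N ≠ 0) : ∃ T e f h a α' β', QN K q (N : K) T e f h a α' β' := by
  classical
  obtain ⟨b, hb1, hb2⟩ := exists_ab H
  have hβ : β.1.IsNonZero := (Finset.mem_filter.mp β.2).2
  obtain ⟨h, e, f, hsl, he, hf⟩ := exists_isSl2Triple_of_weight_isNonZero hβ
  have hh : h = (coroot β.1 : H) := hsl.h_eq_coroot hβ he hf
  have hpair : α.1 (coroot β.1) = (N : L) := by
    rw [← hN, ← rootSystem_pairing_apply]
    exact ((rootSystem H).algebraMap_pairingIn ℤ α β).symm
  -- an element on which the roots are not proportional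
  obtain ⟨x, hx⟩ : ∃ x : H, 2 * α.1 x ≠ N * β.1 x := by
    by_contra! hcon
    have h3 := RootPairing.IsReduced.eq_or_eq_neg (P := rootSystem H) α β (by
      rw [LinearIndependent.pair_iff]
      intro h4
      have h5 := h4 2 (-N) (by
        ext x
        have := hcon x
        simp only [LinearMap.add_apply, LinearMap.smul_apply, rootSystem_root_apply, LieModule.Weight.toLinear_apply,
          smul_eq_mul, LinearMap.zero_apply]
        linear_combination this)
      exact two_ne_zero h5.1)
    exact h3.elim h1 h2
  let bH : Fin (finrank L H) → H := fun i => ⟨b (Sum.inl i), hb1 i⟩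
  let e0 := Module.finBasis K q
  let E := Algebra.TensorProduct.basis L e0
  have hsum : ∀ (y : H) (γ : H.root), ∑ i, b.repr (y : L ⊗[K] q) (Sum.inl i) * γ.1 (bH i) = γ.1 y := by
    intro y γ
    have h4 : y = ∑ i, b.repr (y : L ⊗[K] q) (Sum.inl i) • bH i := by
      apply Subtype.ext
      conv_lhs => rw [repr_H H hb1 hb2 y]
      simp [bH]
    have h5 := congrArg γ.1.toLinear h4
    simp only [map_sum, map_smul, LieModule.Weight.toLinear_apply, smul_eq_mul] at h5
    exact h5.symm
  have hnz : ∀ γ : H.root, ∃ i, γ.1 (bH i) ≠ 0 := by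
    intro γ
    by_contra! hcon
    obtain ⟨y, hy⟩ := rz_sep H
    apply hy (some γ) none (by simp)
    change γ.1 y = 0
    rw [← hsum]
    simp [hcon]
  choose inx hinx using hnz
  let vec : (Fin (finrank L H) ⊕ H.root) ⊕ Bool → L ⊗[K] q := Sum.elim b (fun c => if c then e else f)
  -- the finite set of scalars
  let S : Set L := (Set.range fun p : ((Fin (finrank L H) ⊕ H.root) ⊕ Bool) × Fin (finrank K q) => E.repr (vec p.1) p.2)
    ∪ (Set.range fun p : Fin (finrank K q) × (Fin (finrank L H) ⊕ H.root) => b.repr (E p.1) p.2)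
    ∪ (Set.range fun p : Fin (finrank L H) × H.root => p.2.1 (bH p.1))
    ∪ (Set.range fun γ : H.root => (γ.1 (bH (inx γ)))⁻¹)
    ∪ (Set.range fun p : Fin (finrank L H) => b.repr (coroot β.1 : H) (Sum.inl p))
    ∪ (Set.range fun p : Fin (finrank L H) => b.repr (x : L ⊗[K] q) (Sum.inl p))
    ∪ {(2 * α.1 x - N * β.1 x)⁻¹}
  have hS : S.Finite := by
    refine ((((((Set.finite_range _).union ?_).union ?_).union ?_).union ?_).union ?_).union (Set.finite_singleton _)
    all_goals exact Set.finite_range _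
  let A : Subalgebra K L := Algebra.adjoin K S
  have hfg : Algebra.FiniteType K A := by
    rw [← Subalgebra.fg_iff_finiteType]
    have := Subalgebra.fg_adjoin_finset (R := K) hS.toFinset
    rwa [Set.Finite.coe_toFinset] at this
  obtain ⟨φ⟩ := exists_point (K := K) A
  have hSA : ∀ s ∈ S, s ∈ A := fun s hs => Algebra.subset_adjoin hs
  let F : A ⊗[K] q →ₗ[K] L ⊗[K] q := bcm A.val
  have hF : Function.Injective F := Module.Flat.rTensor_preserves_injective_linearMap _ Subtype.val_injective
  have hFs : ∀ (a : A) v, F (a • v) = (a : L) • F v := fun a v => bcm_smul _ _ _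
  have hFl : ∀ u v, F ⁅u, v⁆ = ⁅F u, F v⁆ := bcm_lie _
  obtain ⟨g, hgs, hgl, hg1⟩ : ∃ g : A ⊗[K] q →ₗ[K] q, (∀ (a : A) v, g (a • v) = φ a • g v) ∧
      (∀ u v, g ⁅u, v⁆ = ⁅g u, g v⁆) ∧ ∀ v, g ((1 : A) ⊗ₜ[K] v) = v :=
    ⟨spm φ, spm_smul φ, spm_lie φ, fun v => by rw [spm_tmul, map_one, one_smul]⟩
  -- lifts
  have hlift : ∀ p, ∃ v, F v = vec p := by
    intro p
    refine ⟨∑ l, (⟨E.repr (vec p) l, hSA _ (by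
      iterate 6 left
      exact ⟨(p, l), rfl⟩)⟩ : A) ⊗ₜ[K] e0 l, ?_⟩
    rw [map_sum]
    conv_rhs => rw [← E.sum_repr (vec p)]
    refine Finset.sum_congr rfl fun l _ => ?_
    simp only [F, bcm_tmul, E, Algebra.TensorProduct.basis_apply, TensorProduct.smul_tmul', smul_eq_mul, mul_one]
    rfl
  choose lif hlif using hlift
  let B := fun i => lif (Sum.inl i)
  have hB : ∀ i, F (B i) = b i := fun i => hlif (Sum.inl i)
  let e' := lif (Sum.inr true)
  let f' := lif (Sum.inr false)
  have he' : F e' = e := hlif (Sum.inr true)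
  have hf' : F f' = f := hlif (Sum.inr false)
  let lam : Fin (finrank L H) → H.root → A := fun i γ => ⟨γ.1 (bH i), hSA _ (by
    iterate 4 left
    right; exact ⟨(i, γ), rfl⟩)⟩
  let M : Fin (finrank K q) → (Fin (finrank L H) ⊕ H.root) → A := fun l i => ⟨b.repr (E l) i, hSA _ (by
    iterate 5 left
    right; exact ⟨(l, i), rfl⟩)⟩
  let mu : H.root → A := fun γ => ⟨(γ.1 (bH (inx γ)))⁻¹, hSA _ (by
    iterate 3 left
    right; exact ⟨γ, rfl⟩)⟩
  let C : Fin (finrank L H) → A := fun i => ⟨b.repr (coroot β.1 : H) (Sum.inl i), hSA _ (by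
    iterate 2 left
    right; exact ⟨i, rfl⟩)⟩
  let C' : Fin (finrank L H) → A := fun i => ⟨b.repr (x : L ⊗[K] q) (Sum.inl i), hSA _ (by
    left; right; exact ⟨i, rfl⟩)⟩
  let m : A := ⟨(2 * α.1 x - N * β.1 x)⁻¹, hSA _ (by right; rfl)⟩
  have hbr : ∀ i γ (u : L ⊗[K] q), u ∈ rootSpace H γ → ⁅b (Sum.inl i), u⁆ = γ (bH i) • u := by
    intro i γ u hu
    exact lie_eq_smul_of_mem_rootSpace hu (bH i)
  have R1 : ∀ i j, ⁅B (Sum.inl i), B (Sum.inl j)⁆ = 0 := by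
    intro i j; apply hF; rw [hFl, hB, hB, map_zero]; exact cartan_comm (hb1 i) (hb1 j)
  have R2 : ∀ i γ, ⁅B (Sum.inl i), B (Sum.inr γ)⁆ = lam i γ • B (Sum.inr γ) := by
    intro i γ; apply hF; rw [hFl, hFs, hB, hB]; exact hbr i γ.1 _ (hb2 γ)
  have R3 : ∀ l, (1 : A) ⊗ₜ[K] e0 l = ∑ i, M l i • B i := by
    intro l; apply hF; rw [map_sum]
    simp only [hFs, hB]
    change _ = ∑ i, b.repr (E l) i • b i
    rw [b.sum_repr]
    simp [F, bcm_tmul, E]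
  let h' := ⁅e', f'⁆
  have hh' : F h' = h := by rw [hFl, he', hf', hsl.lie_e_f]
  have R4b : ⁅h', e'⁆ = 2 • e' := by
    apply hF; rw [hFl, map_nsmul, hh', he', hsl.lie_h_e_nsmul]
  have R4c : ⁅h', f'⁆ = - (2 • f') := by
    apply hF; rw [hFl, map_neg, map_nsmul, hh', hf', hsl.lie_h_f_nsmul]
  have R5 : h' = ∑ i, C i • B (Sum.inl i) := by
    apply hF; rw [hh', map_sum, hh]
    simp only [hFs, hB]
    exact repr_H H hb1 hb2 _
  have R6 : ∀ i, ⁅B (Sum.inl i), e'⁆ = lam i β • e' := by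
    intro i; apply hF; rw [hFl, hFs, hB, he']; exact hbr i β.1 _ he
  have R6' : ∀ i, ⁅B (Sum.inl i), f'⁆ = - (lam i β • f') := by
    intro i; apply hF; rw [hFl, map_neg, hFs, hB, hf', ← neg_smul]; exact hbr i _ _ hf
  have R7 : ∀ γ, lam (inx γ) γ * mu γ = 1 := fun γ => Subtype.ext (mul_inv_cancel₀ (hinx γ))
  have R8 : ∑ i, C i * lam i α = (N : A) := by
    apply Subtype.ext
    rw [AddSubmonoidClass.coe_finset_sum]
    change ∑ i, b.repr (coroot β.1 : H) (Sum.inl i) * α.1 (bH i) = _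
    rw [hsum, hpair]; simp
  have R8a : ∑ i, C i * lam i β = 2 := by
    apply Subtype.ext
    rw [AddSubmonoidClass.coe_finset_sum]
    change ∑ i, b.repr (coroot β.1 : H) (Sum.inl i) * β.1 (bH i) = _
    rw [hsum, root_apply_coroot hβ]; rfl
  have R8b : (2 * ∑ i, C' i * lam i α - N * ∑ i, C' i * lam i β) * m = 1 := by
    apply Subtype.ext
    have h5 : (((2 * ∑ i, C' i * lam i α - N * ∑ i, C' i * lam i β) * m : A) : L) =
      (2 * ∑ i, b.repr (x : L ⊗[K] q) (Sum.inl i) * α.1 (bH i) - N * ∑ i, b.repr (x : L ⊗[K] q) (Sum.inl i) * β.1 (bH i))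
       * (2 * α.1 x - N * β.1 x)⁻¹ := by
      have h2 : ((2 : A) : L) = 2 := rfl
      simp [C', lam, m, h2]
    rw [h5, hsum, hsum, mul_inv_cancel₀ (sub_ne_zero.2 hx)]; rfl
  -- the specialised basis
  have hspan : ⊤ ≤ Submodule.span K (Set.range fun i => g (B i)) := by
    rw [← e0.span_eq, Submodule.span_le]
    rintro _ ⟨l, rfl⟩
    have := congrArg g (R3 l)
    rw [map_sum] at this
    simp only [hgs] at this
    have h6 : g ((1 : A) ⊗ₜ[K] e0 l) = e0 l := hg1 _
    rw [h6] at this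
    rw [this]
    exact Submodule.sum_mem _ fun i _ => Submodule.smul_mem _ _ (Submodule.subset_span ⟨i, rfl⟩)
  let b' : Basis (Fin (finrank L H) ⊕ H.root) K q := basisOfTopLeSpanOfCardEqFinrank _ hspan (by
    rw [← Module.finrank_eq_card_basis b, Module.finrank_baseChange])
  have hb' : ∀ i, b' i = g (B i) := fun i => by simp [b']
  obtain ⟨T, a, α', β', hQ⟩ := QN_of b' (lam := fun i γ => φ (lam i γ)) (inx := inx) (fun γ => by
      intro h0
      have := congrArg φ (R7 γ)
      rw [map_mul, map_one, h0, zero_mul] at this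
      exact zero_ne_one this)
    (fun i j => by rw [hb', hb', ← hgl, R1, map_zero])
    (fun i j => by rw [hb', hb', ← hgl, R2, hgs])
    (e := g e') (f := g f') (h := g h') (x := ∑ i, φ (C' i) • b' (Sum.inl i)) (by rw [← hgl]) (by rw [← hgl, R4b, map_nsmul])
    (by rw [← hgl, R4c, map_neg, map_nsmul]) (C := fun i => φ (C i)) (C' := fun i => φ (C' i)) (by
      rw [R5, map_sum]; simp only [hgs, hb']) rfl (α := α) (β := β)
    (fun i => by rw [hb', ← hgl, R6, hgs]) (fun i => by rw [hb', ← hgl, R6', map_neg, hgs])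
    (N := (N : K)) (by exact_mod_cast hN0) (by
      have := congrArg φ R8; simpa using this) (by
      have := congrArg φ R8a
      have h2 : φ 2 = 2 := map_ofNat φ 2
      simpa [h2] using this) (by
      intro h0
      have := congrArg φ R8b
      simp only [map_mul, map_sub, map_sum, map_ofNat, map_intCast, map_one] at this
      rw [sub_eq_zero.2 h0, zero_mul] at this
      exact zero_ne_one this)
  exact ⟨T, _, _, _, a, α', β', hQ⟩
end
end CVP

namespace CVP
open LieAlgebra Module LieAlgebra.IsKilling

section
variable {K : Type*} [Field K] [CharZero K] [IsAlgClosed K]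
  {q : Type*} [LieRing q] [LieAlgebra K q]
  {M : Type*} [LieRing M] [LieAlgebra K M] [FiniteDimensional K M] [IsKilling K M]

lemma lacety_ge (p : M →ₗ⁅K⁆ q) (hp : Function.Injective p)
    (hJ : ∀ x : q, ∃ j j', x = p j + j' ∧ ∀ m, ⁅p m, j'⁆ = 0)
    {N : ℤ} (hN : N ≠ 0) {T : Submodule K q} {e f h a : q} {α β : q → K}
    (Q : QN K q (N : K) T e f h a α β) {e' : M} (he' : p e' = e) :
    ∃ (t' : LieSubalgebra K M) (_ : t'.IsCartanSubalgebra), N.natAbs ≤ lacety K M t' := by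
  have hideal : ∀ (y : q) (m : M), ∃ m', ⁅y, p m⁆ = p m' := by
    intro y m
    obtain ⟨i, i', rfl, hi⟩ := hJ y
    refine ⟨⁅i, m⁆, ?_⟩
    rw [add_lie, LieHom.map_lie, ← lie_skew i', hi, neg_zero, add_zero]
  have hcen : ∀ m : M, (∀ m', ⁅p m', p m⁆ = 0) → m = 0 := by
    intro m hm
    have h1 : m ∈ LieAlgebra.center K M := by
      rw [LieModule.mem_maxTrivSubmodule]
      intro x; apply hp; rw [LieHom.map_lie, hm, map_zero]
    rw [LieAlgebra.center_eq_bot] at h1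
    simpa using h1
  have hT : ∀ x ∈ T, ∃ j, p j ∈ T ∧ ∀ m, ⁅x, p m⁆ = ⁅p j, p m⁆ := by
    intro x hx
    obtain ⟨j, j', rfl, hj⟩ := hJ x
    have h0 : ∀ m, ⁅p j + j', p m⁆ = ⁅p j, p m⁆ := by
      intro m
      rw [add_lie, ← lie_skew j', hj, neg_zero, add_zero]
    refine ⟨j, Q.self _ fun y hy => ?_, h0⟩
    obtain ⟨m, hm⟩ := hideal y j
    rw [hm]
    have h1 : p m = - ⁅y, j'⁆ := by
      rw [← hm, eq_neg_iff_add_eq_zero, ← lie_add]; exact Q.ab y hy _ hx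
    have h2 : m = 0 := by
      apply hcen
      intro m'
      obtain ⟨m2, hm2⟩ := hideal y m'
      rw [h1, lie_neg, leibniz_lie, hj, lie_zero, add_zero, ← lie_skew (p m') y, hm2, neg_lie, hj]; simp
    rw [h2, map_zero]
  -- pull everything back
  have hh1 := Q.sl.lie_e_f
  have h2K : (2 : K) ≠ 0 := two_ne_zero
  have hNK : (N : K) ≠ 0 := by exact_mod_cast hN
  obtain ⟨h', hh'⟩ : ∃ h', p h' = h := by
    obtain ⟨m, hm⟩ := hideal f e'
    refine ⟨-m, ?_⟩
    rw [map_neg, ← hm, he', lie_skew, hh1]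
  obtain ⟨f', hf'⟩ : ∃ f', p f' = f := by
    obtain ⟨m, hm⟩ := hideal f h'
    refine ⟨(2 : K)⁻¹ • m, ?_⟩
    rw [map_smul, ← hm, hh', ← lie_skew, Q.sl.lie_h_f_nsmul, neg_neg, ← ofNat_smul_eq_nsmul K, smul_smul, inv_mul_cancel₀ h2K, one_smul]
  obtain ⟨a', ha'⟩ : ∃ a', p a' = a := by
    obtain ⟨m, hm⟩ := hideal a h'
    refine ⟨-((N : K)⁻¹ • m), ?_⟩
    rw [map_neg, map_smul, ← hm, hh', ← smul_neg, lie_skew, Q.wa h Q.hT, Q.hc, smul_smul,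
      inv_mul_cancel₀ hNK, one_smul]
  let t' : LieSubalgebra K M :=
    { T.comap (p : M →ₗ[K] q) with
      lie_mem' := fun {x y} hx hy => by
        change p ⁅x, y⁆ ∈ T
        rw [LieHom.map_lie, Q.ab (p x) hx (p y) hy]; exact T.zero_mem }
  have ht' : ∀ x : M, x ∈ t' ↔ p x ∈ T := fun x => Iff.rfl
  have hab : ∀ x y : t', ⁅x, y⁆ = 0 := by
    intro x y
    apply Subtype.ext; apply hp
    change p ⁅(x : M), (y : M)⁆ = p 0
    rw [LieHom.map_lie, map_zero, Q.ab (p x) x.2 (p y) y.2]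
  haveI : IsLieAbelian t' := ⟨hab⟩
  haveI hCar : t'.IsCartanSubalgebra :=
    { nilpotent := inferInstance
      self_normalizing := by
        apply le_antisymm _ t'.le_normalizer
        intro v hv
        rw [LieSubalgebra.mem_normalizer_iff] at hv
        rw [ht']
        apply Q.self
        intro x hx
        obtain ⟨j, hjT, hj⟩ := hT x hx
        rw [hj]
        apply Q.ss _ hjT
        have := hv j hjT
        rw [ht', LieHom.map_lie] at this
        have h3 := Q.ab _ hjT _ this
        rw [← lie_skew (p v), lie_neg, neg_eq_zero] at h3
        exact h3 }
  have mkw : ∀ (γ : q → K) (b : M), b ≠ 0 → (∀ x ∈ T, ⁅x, p b⁆ = γ x • p b) →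
      ∃ w : LieModule.Weight K t' M, (∀ x, w x = γ (p x)) ∧ b ∈ rootSpace t' w := by
    intro γ b hb hw
    have h1 : b ∈ LieModule.weightSpace M (fun x : t' => γ (p x)) := by
      rw [LieModule.mem_weightSpace]
      intro x
      apply hp
      change p ⁅(x : M), b⁆ = _
      rw [LieHom.map_lie, map_smul, hw (p x) x.2]
    have h2 := LieModule.weightSpace_le_genWeightSpace M (fun x : t' => γ (p x)) h1
    refine ⟨⟨fun x => γ (p x), fun h0 => hb ?_⟩, fun x => rfl, h2⟩
    rw [h0] at h2; simpa using h2
  have hane : a' ≠ 0 := by rintro rfl; rw [map_zero] at ha'; exact Q.ha ha'.symm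
  have hene : e' ≠ 0 := by rintro rfl; rw [map_zero] at he'; exact Q.sl.e_ne_zero he'.symm
  obtain ⟨A, hA, -⟩ := mkw α a' hane (by rw [ha']; exact Q.wa)
  obtain ⟨B, hB, heB⟩ := mkw β e' hene (by rw [he']; exact Q.we)
  have hfB : f' ∈ rootSpace t' (-B) := by
    apply LieModule.weightSpace_le_genWeightSpace
    rw [LieModule.mem_weightSpace]
    intro x
    apply hp
    change p ⁅(x : M), f'⁆ = _
    rw [LieHom.map_lie, map_smul, hf', Q.wf (p x) x.2]
    simp [hB]
  have hsl : IsSl2Triple h' e' f' :=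
    { h_ne_zero := by rintro rfl; rw [map_zero] at hh'; exact Q.sl.h_ne_zero hh'.symm
      lie_e_f := by apply hp; rw [LieHom.map_lie, he', hf', hh', hh1]
      lie_h_e_nsmul := by apply hp; rw [LieHom.map_lie, map_nsmul, he', hh', Q.sl.lie_h_e_nsmul]
      lie_h_f_nsmul := by apply hp; rw [LieHom.map_lie, map_neg, map_nsmul, hf', hh', Q.sl.lie_h_f_nsmul] }
  have hhT : h' ∈ t' := by rw [ht', hh']; exact Q.hT
  have hAh : A ⟨h', hhT⟩ = N := by rw [hA, hh', Q.hc]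
  have hBh : B ⟨h', hhT⟩ = 2 := by
    rw [hB, hh']
    have := Q.we h Q.hT
    rw [Q.sl.lie_h_e_smul K] at this
    exact smul_left_injective K Q.sl.e_ne_zero this.symm
  have hAn : A.IsNonZero := by
    intro h0
    have h0' : (A : t' → K) = 0 := h0
    rw [h0'] at hAh; exact hNK hAh.symm
  have hBn : B.IsNonZero := by
    intro h0
    have h0' : (B : t' → K) = 0 := h0
    rw [h0'] at hBh; exact h2K hBh.symm
  have hco : (coroot B : M) = h' := (hsl.h_eq_coroot hBn heB hfB).symm
  have hco' : coroot B = ⟨h', hhT⟩ := Subtype.ext hco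
  obtain ⟨x0, hx0, y0, hy0, hnp0⟩ := Q.np
  obtain ⟨x, hx, y, hy, hnp⟩ : ∃ x, ∃ hx : x ∈ t', ∃ y, ∃ hy : y ∈ t', A ⟨x, hx⟩ * B ⟨y, hy⟩ ≠ A ⟨y, hy⟩ * B ⟨x, hx⟩ := by
    obtain ⟨x, hx, hxx⟩ := hT x0 hx0
    obtain ⟨y, hy, hyy⟩ := hT y0 hy0
    refine ⟨x, hx, y, hy, ?_⟩
    rw [hA, hA, hB, hB]
    have e1 : ∀ z0 ∈ T, ∀ z, p z ∈ T → (∀ m, ⁅z0, p m⁆ = ⁅p z, p m⁆) → α (p z) = α z0 ∧ β (p z) = β z0 := by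
      intro z0 hz0 z hz hzz
      constructor
      · have := hzz a'
        rw [ha', Q.wa _ hz0, Q.wa _ hz] at this
        exact smul_left_injective K Q.ha this.symm
      · have := hzz e'
        rw [he', Q.we _ hz0, Q.we _ hz] at this
        exact smul_left_injective K Q.sl.e_ne_zero this.symm
    rw [(e1 x0 hx0 x hx hxx).1, (e1 x0 hx0 x hx hxx).2, (e1 y0 hy0 y hy hyy).1, (e1 y0 hy0 y hy hyy).2]
    exact hnp0
  refine ⟨t', hCar, ?_⟩
  have hfr : finrank K t' ≠ 1 := by
    intro h1
    obtain ⟨v, hv, hv'⟩ := finrank_eq_one_iff'.1 h1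
    obtain ⟨c, hc⟩ := hv' ⟨x, hx⟩
    obtain ⟨d, hd⟩ := hv' ⟨y, hy⟩
    apply hnp
    rw [← hc, ← hd]
    have e1 : ∀ (w : LieModule.Weight K t' M) (c : K) (z : t'), w (c • z) = c * w z := fun w c z => by
      have := (LieModule.Weight.toLinear K t' M w).map_smul c z
      simpa using this
    rw [e1, e1, e1, e1]; ring
  unfold lacety
  rw [if_neg hfr]
  apply le_csSup
  · apply Set.Finite.bddAbove
    have hsub : {n : ℕ | ∃ α β : LieModule.Weight K ↥t' M, α.IsNonZero ∧ β.IsNonZero ∧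
        (∀ c : K, (α : ↥t' → K) ≠ c • (β : ↥t' → K)) ∧
        (α (LieAlgebra.IsKilling.coroot β) = (n : K) ∨ α (LieAlgebra.IsKilling.coroot β) = -(n : K))} ⊆
        ⋃ w : LieModule.Weight K ↥t' M × LieModule.Weight K ↥t' M,
          ({n : ℕ | w.1 (coroot w.2) = (n : K)} ∪ {n : ℕ | w.1 (coroot w.2) = - (n : K)}) := by
      rintro n ⟨α, β, -, -, -, h⟩
      exact Set.mem_iUnion.2 ⟨(α, β), h⟩
    refine Set.Finite.subset (Set.finite_iUnion fun w => Set.Finite.union ?_ ?_) hsub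
    · apply Set.Subsingleton.finite
      intro n hn m hm
      have : (n : K) = m := hn.symm.trans hm
      exact_mod_cast this
    · apply Set.Subsingleton.finite
      intro n hn m hm
      have : -(n : K) = - m := hn.symm.trans hm
      exact_mod_cast (neg_injective this)
  · refine ⟨A, B, hAn, hBn, ?_, ?_⟩
    · intro c hc
      apply hnp
      rw [hc]; simp only [Pi.smul_apply, smul_eq_mul]; ring
    · rw [hco', hAh]
      rcases Int.natAbs_eq N with h | h
      · left; nth_rw 1 [h]; simp
      · right; nth_rw 1 [h]; simp
end
end CVP

namespace CVP
open LieAlgebra Module LieAlgebra.IsKilling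

section
variable {K : Type*} [Field K] [CharZero K]
  {q : Type*} [LieRing q] [LieAlgebra K q] [FiniteDimensional K q] [IsKilling K q]
  {G : Type*} [LieRing G] [LieAlgebra K G] [FiniteDimensional K G]

lemma killing_inv (a b c : q) : killingForm K q ⁅a, b⁆ c = killingForm K q a ⁅b, c⁆ :=
  LieModule.traceForm_apply_lie_apply K q q a b c

/-- a functional on commutators comes from the Killing form of the quotient -/
lemma functional_comm (π : G →ₗ⁅K⁆ q) (hs : Function.Surjective π)
    (hk : ∀ x, π x = 0 → ∀ y : G, ⁅x, y⁆ = 0) (l : G →ₗ[K] K) :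
    ∃ d : q, ∀ a b : G, l ⁅a, b⁆ = killingForm K q d (π ⁅a, b⁆) := by
  obtain ⟨s, hs'⟩ := LinearMap.exists_rightInverse_of_surjective (π : G →ₗ[K] q)
    (LinearMap.range_eq_top.2 hs)
  have hs1 : ∀ u, π (s u) = u := fun u => LinearMap.congr_fun hs' u
  have hk1 : ∀ x y z : G, π x = π y → ⁅x, z⁆ = ⁅y, z⁆ := by
    intro x y z h
    rw [← sub_eq_zero, ← sub_lie]; apply hk; rw [map_sub, h, sub_self]
  have hk2 : ∀ x y z : G, π x = π y → ⁅z, x⁆ = ⁅z, y⁆ := by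
    intro x y z h
    rw [← lie_skew, hk1 x y z h, lie_skew]
  have hnd := killingForm_nondegenerate K q
  let Bf : q →ₗ[K] Module.Dual K q :=
    LinearMap.mk₂ K (fun u v => l ⁅s u, s v⁆) (by intros; simp) (by intros; simp) (by intros; simp)
      (by intros; simp)
  let dl : q →ₗ[K] q := (LinearMap.BilinForm.toDual (killingForm K q) hnd).symm.toLinearMap ∘ₗ Bf
  have hdl : ∀ u v, killingForm K q (dl u) v = l ⁅s u, s v⁆ := fun u v => by
    simp only [dl, LinearMap.comp_apply, LinearEquiv.coe_coe, LinearMap.BilinForm.apply_toDual_symm_apply]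
    rfl
  have hBs : ∀ u v : q, π ⁅s u, s v⁆ = ⁅u, v⁆ := fun u v => by rw [LieHom.map_lie, hs1, hs1]
  let D : LieDerivation K q q :=
    { dl with
      leibniz' := fun a b => by
        change dl ⁅a, b⁆ = ⁅a, dl b⁆ - ⁅b, dl a⁆
        rw [← sub_eq_zero]
        apply hnd.1
        intro c
        have e1 : killingForm K q ⁅a, dl b⁆ c = - l ⁅s b, ⁅s a, s c⁆⁆ := by
          rw [← lie_skew, map_neg, LinearMap.neg_apply, killing_inv, hdl,
            hk2 (s ⁅a, c⁆) ⁅s a, s c⁆ (s b) (by rw [hs1, hBs])]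
        have e2 : killingForm K q ⁅b, dl a⁆ c = - l ⁅s a, ⁅s b, s c⁆⁆ := by
          rw [← lie_skew, map_neg, LinearMap.neg_apply, killing_inv, hdl,
            hk2 (s ⁅b, c⁆) ⁅s b, s c⁆ (s a) (by rw [hs1, hBs])]
        rw [map_sub, LinearMap.sub_apply, map_sub, LinearMap.sub_apply, hdl, e1, e2,
          hk1 (s ⁅a, b⁆) ⁅s a, s b⁆ (s c) (by rw [hs1, hBs]), lie_lie, map_sub]
        ring }
  obtain ⟨d, hd⟩ := LieDerivation.IsKilling.exists_eq_ad D
  refine ⟨d, fun a b => ?_⟩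
  have h1 : dl (π a) = ⁅d, π a⁆ := by
    have := congrArg (fun D' : LieDerivation K q q => D' (π a)) hd
    have h3 : D (π a) = ⁅d, π a⁆ := by simpa using this.symm
    exact h3
  have h2 := hdl (π a) (π b)
  rw [hk1 _ a _ (hs1 _), hk2 _ b _ (hs1 _), h1, killing_inv] at h2
  rw [LieHom.map_lie, h2]

end

section
variable {K : Type*} [Field K] [CharZero K] [IsAlgClosed K]
  {q : Type*} [LieRing q] [LieAlgebra K q] [FiniteDimensional K q] [IsKilling K q]
  {G : Type*} [LieRing G] [LieAlgebra K G] [FiniteDimensional K G]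

lemma comm_span (X : LieIdeal K G) (x : G) (hx : x ∈ ⁅X, X⁆) (P : Submodule K G)
    (hP : ∀ a ∈ X, ∀ b ∈ X, ⁅a, b⁆ ∈ P) : x ∈ P := by
  have h1 : x ∈ (⁅X, X⁆ : LieIdeal K G).toSubmodule := hx
  rw [LieSubmodule.lieIdeal_oper_eq_linear_span'] at h1
  exact (Submodule.span_le.2 (by rintro _ ⟨a, ha, b, hb, rfl⟩; exact hP a ha b hb)) h1

lemma ker_comm (π : G →ₗ⁅K⁆ q) (hs : Function.Surjective π)
    (hk : ∀ x, π x = 0 → ∀ y : G, ⁅x, y⁆ = 0) (w : G) (hw : w ∈ ⁅(⊤ : LieIdeal K G), (⊤ : LieIdeal K G)⁆)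
    (h0 : π w = 0) : w = 0 := by
  rw [← Module.forall_dual_apply_eq_zero_iff K]
  intro l
  obtain ⟨d, hd⟩ := functional_comm π hs hk l
  have h1 : w ∈ LinearMap.ker (l - (killingForm K q d) ∘ₗ (π : G →ₗ[K] q)) := by
    apply comm_span ⊤ w hw
    intro a _ b _
    rw [LinearMap.mem_ker, LinearMap.sub_apply, hd, sub_eq_zero]; rfl
  rw [LinearMap.mem_ker, LinearMap.sub_apply, sub_eq_zero] at h1
  rw [h1]
  change killingForm K q d (π w) = 0
  rw [h0, map_zero]

theorem ideal_lacety (π : G →ₗ⁅K⁆ q) (hs : Function.Surjective π)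
    (hk : ∀ x, π x = 0 → ∀ y : G, ⁅x, y⁆ = 0) {N : ℤ} (hN : N ≠ 0) {T : Submodule K q} {e f h a : q}
    {α β : q → K} (Q : QN K q (N : K) T e f h a α β) :
    ∃ (I : LieIdeal K G) (_ : IsSimple K I) (_ : IsKilling K I)
      (t' : LieSubalgebra K I) (_ : t'.IsCartanSubalgebra), N.natAbs ≤ lacety K I t' := by
  -- the atom
  obtain ⟨J, hJ, j0, hj0, hj0e⟩ : ∃ J : LieIdeal K q, IsAtom J ∧ ∃ j ∈ J, ⁅j, e⁆ ≠ 0 := by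
    by_contra! hcon
    have h1 : (⊤ : Submodule K q) ≤ LinearMap.ker ((ad K q : q →ₗ[K] Module.End K q).flip e) := by
      rw [← LieSubmodule.top_toSubmodule (R := K) (L := q), ← IsSemisimple.sSup_atoms_eq_top (R := K) (L := q),
        LieSubmodule.sSup_toSubmodule]
      apply sSup_le
      rintro _ ⟨J, hJ, rfl⟩ j hj
      exact hcon J hJ j hj
    have h2 : ⁅h, e⁆ = 0 := h1 (x := h) trivial
    rw [Q.sl.lie_h_e_smul K] at h2
    exact (smul_ne_zero two_ne_zero Q.sl.e_ne_zero) h2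
  have hcompl := J.isCompl_killingCompl
  have hdisj : ∀ x ∈ J, ∀ y ∈ J.killingCompl, ⁅x, y⁆ = 0 := by
    intro x hx y hy
    have : ⁅x, y⁆ ∈ J ⊓ J.killingCompl :=
      ⟨lie_mem_left K q J _ _ hx, lie_mem_right K q _ _ _ hy⟩
    rw [hcompl.inf_eq_bot] at this
    simpa using this
  have hdec : ∀ x : q, ∃ j ∈ J, ∃ j' ∈ J.killingCompl, x = j + j' := by
    intro x
    have : x ∈ J ⊔ J.killingCompl := by rw [hcompl.sup_eq_top]; trivial
    obtain ⟨j, hj, j', hj', h⟩ := (LieSubmodule.mem_sup _ _ _).1 this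
    exact ⟨j, hj, j', hj', h.symm⟩
  have huniq : ∀ j ∈ J, ∀ j' ∈ J.killingCompl, j + j' = 0 → j = 0 := by
    intro j hj j' hj' h0
    have h1 : j = -j' := eq_neg_of_add_eq_zero_left h0
    have : j ∈ J ⊓ J.killingCompl := ⟨hj, by rw [h1]; exact neg_mem hj'⟩
    rw [hcompl.inf_eq_bot] at this
    simpa using this
  -- e lies in J
  obtain ⟨u, hu, u', hu', hue⟩ := hdec e
  obtain ⟨w, hw, w', hw', hwh⟩ := hdec h
  have hwT : w ∈ T := by
    apply Q.self
    intro x hx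
    apply huniq _ (lie_mem_right K q J x w hw) ⁅x, w'⁆ (lie_mem_right K q _ x w' hw')
    rw [← lie_add, ← hwh]; exact Q.ab x hx h Q.hT
  have hsplit : ∀ j1 ∈ J, ∀ j1' ∈ J.killingCompl, ∀ j2 ∈ J, ∀ j2' ∈ J.killingCompl,
      j1 + j1' = j2 + j2' → j1 = j2 ∧ j1' = j2' := by
    intro j1 h1 j1' h1' j2 h2 j2' h2' heq
    have h3 : j1 - j2 = 0 := huniq _ (sub_mem h1 h2) (j1' - j2') (sub_mem h1' h2') (by
      rw [sub_add_sub_comm, heq, sub_self])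
    have h4 : j1 = j2 := sub_eq_zero.1 h3
    rw [h4] at heq
    exact ⟨h4, add_left_cancel heq⟩
  have hwe : ⁅w, u⁆ = (2 : K) • u := by
    have h1 := Q.sl.lie_h_e_smul K
    rw [hwh, hue, add_lie, lie_add, lie_add, hdisj w hw u' hu', ← lie_skew w' u, hdisj u hu w' hw', smul_add,
      add_zero, neg_zero, zero_add] at h1
    exact (hsplit _ (lie_mem_left K q J _ _ hw) _ (lie_mem_left K q _ _ _ hw') _ (J.smul_mem _ hu) _
      (J.killingCompl.smul_mem _ hu') h1).1
  have hune : u ≠ 0 := by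
    rintro rfl
    rw [zero_add] at hue
    apply hj0e; rw [hue]; exact hdisj _ hj0 _ hu'
  have hu0 : u' = 0 := by
    have h1 := Q.we w hwT
    rw [hue, lie_add, hdisj w hw u' hu', smul_add, hwe] at h1
    obtain ⟨h2, h3⟩ := hsplit _ (J.smul_mem _ hu) 0 (LieSubmodule.zero_mem _) _ (J.smul_mem _ hu) _
      (J.killingCompl.smul_mem _ hu') h1
    have h4 : (2 : K) = β w := smul_left_injective K hune h2
    rw [← h4] at h3
    exact (smul_eq_zero.1 h3.symm).resolve_left two_ne_zero
  have heJ : e ∈ J := by rw [hue, hu0, add_zero]; exact hu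
  have hJJ : ⁅J, J⁆ = J := by
    rcases hJ.le_iff.1 (LieSubmodule.lie_le_left J J) with h1 | h1
    · exfalso
      apply IsSemisimple.non_abelian_of_isAtom J hJ
      rw [LieSubmodule.lie_abelian_iff_lie_self_eq_bot, h1]
    · exact h1
  -- the ideal
  let I : LieIdeal K G := LieIdeal.comap π J ⊓ ⁅(⊤ : LieIdeal K G), (⊤ : LieIdeal K G)⁆
  let p : I →ₗ⁅K⁆ q := π.comp I.incl
  have hpπ : ∀ i : I, p i = π i := fun i => rfl
  have hpJ : ∀ i : I, p i ∈ J := fun i => by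
    exact (LieIdeal.mem_comap (f := π)).1 i.2.1
  have hp : Function.Injective p := by
    rw [injective_iff_map_eq_zero]
    intro i hi
    exact Subtype.ext (ker_comm π hs hk i i.2.2 hi)
  have hpr : ∀ j ∈ J, ∃ i, p i = j := by
    intro j hj
    rw [← hJJ] at hj
    have := comm_span J j hj (LinearMap.range (p : I →ₗ[K] q)) (by
      intro a ha b hb
      obtain ⟨a, rfl⟩ := hs a
      obtain ⟨b, rfl⟩ := hs b
      refine ⟨⟨⁅a, b⁆, ?_, ?_⟩, ?_⟩
      · refine (LieIdeal.mem_comap (f := π)).2 ?_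
        rw [LieHom.map_lie]
        exact lie_mem_left K q J _ _ ha
      · exact LieSubmodule.lie_mem_lie (LieSubmodule.mem_top a) (LieSubmodule.mem_top b)
      · change π ⁅a, b⁆ = _
        rw [LieHom.map_lie])
    exact this
  have hJd : ∀ x : q, ∃ j j', x = p j + j' ∧ ∀ m, ⁅p m, j'⁆ = 0 := by
    intro x
    obtain ⟨j, hj, j', hj', rfl⟩ := hdec x
    obtain ⟨i, rfl⟩ := hpr j hj
    exact ⟨i, j', rfl, fun m => hdisj _ (hpJ m) _ hj'⟩
  obtain ⟨e', he'⟩ := hpr e heJ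
  have hsimple : IsSimple K I :=
    { eq_bot_or_eq_top := by
        intro X
        let Y : LieIdeal K q :=
          { X.toSubmodule.map (p : I →ₗ[K] q) with
            lie_mem := by
              rintro y _ ⟨x, hx, rfl⟩
              obtain ⟨j, j', rfl, hj⟩ := hJd y
              refine ⟨⁅j, x⁆, lie_mem_right K I X j x hx, ?_⟩
              change p ⁅j, x⁆ = ⁅p j + j', p x⁆
              rw [add_lie, LieHom.map_lie, ← lie_skew j', hj, neg_zero, add_zero] }
        have hY : ∀ y, y ∈ Y ↔ ∃ x ∈ X, p x = y := fun y => Iff.rfl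
        have hYJ : Y ≤ J := by
          intro y hy
          obtain ⟨x, -, rfl⟩ := (hY y).1 hy
          exact hpJ x
        rcases hJ.le_iff.1 hYJ with h1 | h1
        · left
          rw [eq_bot_iff]
          intro x hx
          have : p x ∈ Y := (hY _).2 ⟨x, hx, rfl⟩
          rw [h1, LieSubmodule.mem_bot] at this
          rw [LieSubmodule.mem_bot]; apply hp; rw [this, map_zero]
        · right
          rw [eq_top_iff]
          intro x _
          have : p x ∈ Y := by rw [h1]; exact hpJ x
          obtain ⟨x', hx', h2⟩ := (hY _).1 this
          rwa [← hp h2]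
      non_abelian := by
        intro hab
        have : IsLieAbelian J := ⟨fun x y => by
          obtain ⟨x', hx'⟩ := hpr _ x.2
          obtain ⟨y', hy'⟩ := hpr _ y.2
          apply Subtype.ext
          change ⁅(x : q), (y : q)⁆ = 0
          rw [← hx', ← hy', ← LieHom.map_lie, hab.trivial, map_zero]⟩
        exact IsSemisimple.non_abelian_of_isAtom J hJ this }
  have hkill : IsKilling K I := inferInstance
  obtain ⟨t', ht', hl⟩ := lacety_ge p hp hJd hN Q he'
  exact ⟨I, hsimple, hkill, t', ht', hl⟩
end
end CVP

namespace CVP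
open LieAlgebra Module LieAlgebra.IsKilling
open scoped TensorProduct

section
variable {K : Type*} [Field K] [CharZero K] [IsAlgClosed K]
  {q : Type*} [LieRing q] [LieAlgebra K q] [FiniteDimensional K q] [IsKilling K q]
  {G : Type*} [LieRing G] [LieAlgebra K G] [FiniteDimensional K G]
  {L : Type*} [Field L] [CharZero L] [IsAlgClosed L] [Algebra K L] [IsKilling L (L ⊗[K] q)]

theorem PB_of (π : G →ₗ⁅K⁆ q) (hs : Function.Surjective π)
    (hk : ∀ x, π x = 0 → ∀ y : G, ⁅x, y⁆ = 0) {c : ℕ}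
    (hl : ∀ (I : LieIdeal K G), IsSimple K I → ∀ [IsKilling K I] (t' : LieSubalgebra K I)
      [t'.IsCartanSubalgebra], lacety K I t' ≤ c) (H : LieSubalgebra L (L ⊗[K] q)) [H.IsCartanSubalgebra] :
    PB (rootSystem H) c := by
  intro i j h1 h2
  by_cases h0 : (rootSystem H).pairingIn ℤ i j = 0
  · rw [h0]; simp
  obtain ⟨T, e, f, h, a, α', β', Q⟩ := spec H i j h1 h2 rfl h0
  obtain ⟨I, hI, hK, t', ht', h3⟩ := ideal_lacety π hs hk h0 Q
  have := h3.trans (hl I hI t')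
  rw [Int.abs_eq_natAbs]
  exact_mod_cast this
end
end CVP

namespace CVP
open Module

section
variable {K : Type*} [Field K]

lemma algInd_step {A B : Type*} [CommRing A] [IsDomain A] [Algebra K A] [CommRing B] [Algebra K B]
    (φ : A →ₐ[K] B) {J : Type*} (x : J → A) (hx : AlgebraicIndependent K (φ ∘ x)) {f : A} (hf : f ≠ 0)
    (hf0 : φ f = 0) : AlgebraicIndependent K (fun o : Option J ↦ o.elim f x) := by
  rw [AlgebraicIndependent.option_iff]
  refine ⟨hx.of_comp φ, ?_⟩
  rintro ⟨p, hp, hpf⟩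
  obtain ⟨r, hr, hr'⟩ := Polynomial.exists_eq_pow_rootMultiplicity_mul_and_not_dvd p hp 0
  rw [Polynomial.C_0, sub_zero] at hr hr'
  rw [hr, map_mul, map_pow, Polynomial.aeval_X] at hpf
  have h1 : Polynomial.aeval f r = 0 := (mul_eq_zero.1 hpf).resolve_left (pow_ne_zero _ hf)
  rw [← Polynomial.divX_mul_X_add r, map_add, map_mul, Polynomial.aeval_X, Polynomial.aeval_C] at h1
  have h2 := congrArg φ h1
  rw [map_add, map_mul, hf0, mul_zero, zero_add, map_zero] at h2
  apply hr'
  rw [Polynomial.X_dvd_iff]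
  have h3 : ∀ c : Algebra.adjoin K (Set.range x), (c : A) ∈ (MvPolynomial.aeval x : MvPolynomial J K →ₐ[K] A).range := by
    intro c; rw [← Algebra.adjoin_range_eq_range_aeval]; exact c.2
  obtain ⟨F, hF⟩ := h3 (r.coeff 0)
  have hF' : MvPolynomial.aeval x F = ((r.coeff 0 : Algebra.adjoin K (Set.range x)) : A) := hF
  have h4 : φ ((r.coeff 0 : Algebra.adjoin K (Set.range x)) : A) = 0 := h2
  rw [← hF', ← AlgHom.comp_apply, MvPolynomial.comp_aeval] at h4
  have h5 : F = 0 := hx.eq_zero_of_aeval_eq_zero F h4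
  apply Subtype.ext
  rw [← hF', h5, map_zero]; rfl

lemma algInd_chain {R : Type*} [CommRing R] [Algebra K R] (n : ℕ) : ∀ (Q : Fin (n + 1) → Ideal R),
    (∀ i, (Q i).IsPrime) → (∀ i : Fin n, Q i.castSucc < Q i.succ) →
    ∃ (J : Type) (_ : Fintype J) (t : J → R), Fintype.card J = n ∧
      AlgebraicIndependent K (fun j => Ideal.Quotient.mkₐ K (Q 0) (t j)) := by
  induction n with
  | zero =>
    intro Q hQ _
    refine ⟨Empty, inferInstance, Empty.elim, by simp, ?_⟩
    haveI := (hQ 0)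
    rw [algebraicIndependent_empty_type_iff]
    exact (algebraMap K (R ⧸ Q 0)).injective
  | succ n ih =>
    intro Q hQ hlt
    obtain ⟨J, _, t, hJ, ht⟩ := ih (fun i => Q i.succ) (fun i => hQ _) (fun i => hlt i.succ)
    have h0 : Q 0 < Q (Fin.succ 0) := hlt 0
    obtain ⟨hle, f, hf1, hf0⟩ := SetLike.lt_iff_le_and_exists.1 h0
    haveI := hQ 0
    refine ⟨Option J, inferInstance, fun o => o.elim f t, by simp [hJ], ?_⟩
    have := algInd_step (Ideal.Quotient.factorₐ K hle) (fun j => Ideal.Quotient.mkₐ K (Q 0) (t j)) ht (f := Ideal.Quotient.mkₐ K (Q 0) f) (by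
      intro h; exact hf0 (Ideal.Quotient.eq_zero_iff_mem.1 h)) (by
      exact Ideal.Quotient.eq_zero_iff_mem.2 hf1)
    have e : (fun o : Option J => Ideal.Quotient.mkₐ K (Q 0) (o.elim f t)) =
        fun o : Option J => o.elim (Ideal.Quotient.mkₐ K (Q 0) f) (fun j => Ideal.Quotient.mkₐ K (Q 0) (t j)) := by
      ext o; cases o <;> rfl
    rw [e]
    exact this
end

section
variable {K L : Type*} [Field K] [CharZero K] [Field L] [Algebra K L]


lemma etale_of (S : Type*) [CommRing S] [IsDomain S] [CharZero S] [Algebra S L] [FaithfulSMul S L]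
    [Algebra.IsAlgebraic S L] : Algebra.FormallyEtale S L := by
  letI : Algebra (FractionRing S) L := FractionRing.liftAlgebra _ _
  haveI : IsScalarTower S (FractionRing S) L := FractionRing.isScalarTower_liftAlgebra _ _
  haveI : CharZero (FractionRing S) := charZero_of_injective_algebraMap (IsFractionRing.injective S (FractionRing S))
  haveI : Algebra.IsAlgebraic (FractionRing S) L := by
    rwa [← IsFractionRing.comap_isAlgebraic_iff (A := S)]
  haveI : Algebra.FormallyEtale (FractionRing S) L := Algebra.FormallyEtale.of_isSeparable _ _
  haveI : Algebra.FormallyEtale S (FractionRing S) :=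
    Algebra.FormallyEtale.of_isLocalization (nonZeroDivisors _)
  exact Algebra.FormallyEtale.comp _ (FractionRing S) _

lemma exists_der_aux {B : Type*} [Algebra (MvPolynomial B K) L] [IsScalarTower K (MvPolynomial B K) L]
    [Algebra.FormallyEtale (MvPolynomial B K) L] [DecidableEq B] (i : B) :
    ∃ D : Derivation K L L, ∀ j, D (algebraMap (MvPolynomial B K) L (MvPolynomial.X j)) = if j = i then 1 else 0 := by
  let bs := ((KaehlerDifferential.mvPolynomialBasis K B).baseChange L).map
    (KaehlerDifferential.tensorKaehlerEquivOfFormallyEtale K (MvPolynomial B K) L)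
  refine ⟨(bs.coord i).compDer (KaehlerDifferential.D K L), fun j => ?_⟩
  change bs.repr (KaehlerDifferential.D K L _) i = _
  have : KaehlerDifferential.D K L (algebraMap (MvPolynomial B K) L (MvPolynomial.X j)) = bs j := by
    simp only [bs, Basis.map_apply, Basis.baseChange_apply]
    rw [← LinearEquiv.symm_apply_eq, KaehlerDifferential.tensorKaehlerEquivOfFormallyEtale_symm_D_algebraMap]
    simp
  rw [this, Basis.repr_self, Finsupp.single_apply]

/-- dual derivations to an algebraically independent family -/
lemma exists_der {J : Type*} [DecidableEq J] (t : J → L) (ht : AlgebraicIndependent K t) :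
    ∃ D : J → Derivation K L L, ∀ i j, D i (t j) = if j = i then 1 else 0 := by
  classical
  obtain ⟨B, hB, hb⟩ := exists_isTranscendenceBasis_superset (R := K) (s := Set.range t) ht.to_subtype_range
  letI : Algebra (MvPolynomial B K) L := (MvPolynomial.aeval (R := K) (fun b : B => (b : L))).toAlgebra
  have hmap : ∀ p : MvPolynomial B K, algebraMap (MvPolynomial B K) L p = MvPolynomial.aeval (fun b : B => (b : L)) p := fun p => rfl
  haveI : IsScalarTower K (MvPolynomial B K) L := IsScalarTower.of_algebraMap_eq fun x => by
    rw [hmap]; simp [MvPolynomial.algebraMap_eq]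
  haveI : FaithfulSMul (MvPolynomial B K) L := by
    rw [faithfulSMul_iff_algebraMap_injective]
    exact hb.1
  haveI := hb.isAlgebraic
  haveI : Algebra.IsAlgebraic (MvPolynomial B K) L := by
    refine Algebra.IsAlgebraic.of_ringHom_of_comp_eq hb.1.aevalEquiv (RingHom.id L) (AlgEquiv.surjective _)
      Function.injective_id ?_
    exact RingHom.ext fun p => hb.1.algebraMap_aevalEquiv p
  haveI := etale_of (L := L) (MvPolynomial B K)
  choose D hD using fun i : B => exists_der_aux (K := K) (L := L) i
  refine ⟨fun i => D ⟨t i, hB ⟨i, rfl⟩⟩, fun i j => ?_⟩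
  have := hD ⟨t i, hB ⟨i, rfl⟩⟩ ⟨t j, hB ⟨j, rfl⟩⟩
  rw [hmap, MvPolynomial.aeval_X] at this
  rw [this]
  simp [ht.injective.eq_iff]
end
end CVP

namespace CVP
open Module

section
universe u v
variable {K : Type u} [Field K] {V : Type v} [AddCommGroup V] [Module K V] [FiniteDimensional K V]

lemma evalP_mul (F F' : MvPolynomial (Module.Free.ChooseBasisIndex K V) K) (z : V) :
    CV.evalP K V (F * F') z = CV.evalP K V F z * CV.evalP K V F' z := map_mul _ _ _
lemma evalP_add (F F' : MvPolynomial (Module.Free.ChooseBasisIndex K V) K) (z : V) :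
    CV.evalP K V (F + F') z = CV.evalP K V F z + CV.evalP K V F' z := map_add _ _ _
lemma evalP_one (z : V) : CV.evalP K V 1 z = 1 := map_one _
lemma evalP_zero (z : V) : CV.evalP K V 0 z = 0 := map_zero _

lemma zar_basis {U : Set V} (hU : @IsOpen V (CV.zar K V) U) : ∀ s ∈ U,
    ∃ F, CV.evalP K V F s ≠ 0 ∧ ∀ z, CV.evalP K V F z ≠ 0 → z ∈ U := by
  change TopologicalSpace.GenerateOpen _ U at hU
  induction hU with
  | basic U h =>
    obtain ⟨F, rfl⟩ := h
    exact fun s hs => ⟨F, hs, fun z hz => hz⟩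
  | univ => exact fun s _ => ⟨1, by rw [evalP_one]; exact one_ne_zero, fun z _ => trivial⟩
  | inter U U' _ _ h h' =>
    rintro s ⟨hs, hs'⟩
    obtain ⟨F, hF, hF2⟩ := h s hs
    obtain ⟨F', hF', hF2'⟩ := h' s hs'
    refine ⟨F * F', by rw [evalP_mul]; exact mul_ne_zero hF hF', fun z hz => ?_⟩
    rw [evalP_mul] at hz
    exact ⟨hF2 z (left_ne_zero_of_mul hz), hF2' z (right_ne_zero_of_mul hz)⟩
  | sUnion T _ h =>
    rintro s ⟨U, hU, hs⟩
    obtain ⟨F, hF, hF2⟩ := h U hU s hs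
    exact ⟨F, hF, fun z hz => ⟨U, hU, hF2 z hz⟩⟩

lemma zar_open (F : MvPolynomial (Module.Free.ChooseBasisIndex K V) K) :
    @IsOpen V (CV.zar K V) {z | CV.evalP K V F z ≠ 0} :=
  TopologicalSpace.isOpen_generateFrom_of_mem ⟨F, rfl⟩

/-- vanishing ideal of a subset of `S` -/
def van {S : Set V} (Z : Set S) : Ideal (MvPolynomial (Module.Free.ChooseBasisIndex K V) K) where
  carrier := {F | ∀ z ∈ Z, CV.evalP K V F z = 0}
  add_mem' := fun {a b} ha hb z hz => by rw [evalP_add, ha z hz, hb z hz, add_zero]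
  zero_mem' := fun z _ => evalP_zero _
  smul_mem' := fun c x hx z hz => by rw [smul_eq_mul, evalP_mul, hx z hz, mul_zero]

lemma mem_van {S : Set V} {Z : Set S} {F : MvPolynomial (Module.Free.ChooseBasisIndex K V) K} :
    F ∈ van (K := K) Z ↔ ∀ z ∈ Z, CV.evalP K V F z = 0 := Iff.rfl

lemma van_prime {S : Set V} (Z : Set S)
    (hZ : @IsIrreducible S (TopologicalSpace.induced Subtype.val (CV.zar K V)) Z) :
    (van (K := K) Z).IsPrime := by
  letI : TopologicalSpace S := TopologicalSpace.induced Subtype.val (CV.zar K V)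
  rw [Ideal.isPrime_iff]
  constructor
  · intro h
    obtain ⟨z, hz⟩ := hZ.1
    have h1 : (1 : MvPolynomial (Module.Free.ChooseBasisIndex K V) K) ∈ van (K := K) Z := by
      rw [h]; trivial
    have := mem_van.1 h1 z hz
    rw [evalP_one] at this
    exact one_ne_zero this
  · intro F F' h
    by_contra hc
    push Not at hc
    simp only [mem_van] at hc
    push Not at hc
    obtain ⟨⟨z, hz, hFz⟩, ⟨z', hz', hFz'⟩⟩ := hc
    obtain ⟨w, hw, h1, h2⟩ := hZ.2 (Subtype.val ⁻¹' {z | CV.evalP K V F z ≠ 0})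
      (Subtype.val ⁻¹' {z | CV.evalP K V F' z ≠ 0})
      ⟨_, zar_open F, rfl⟩ ⟨_, zar_open F', rfl⟩ ⟨z, hz, hFz⟩ ⟨z', hz', hFz'⟩
    have := mem_van.1 h w hw
    rw [evalP_mul] at this
    exact mul_ne_zero h1 h2 this

lemma van_lt {S : Set V} (Z Z' : Set S)
    (hZ : @IsClosed S (TopologicalSpace.induced Subtype.val (CV.zar K V)) Z) (h : Z < Z') :
    van (K := K) Z' < van (K := K) Z := by
  letI : TopologicalSpace S := TopologicalSpace.induced Subtype.val (CV.zar K V)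
  refine lt_of_le_not_ge (fun F hF z hz => hF z (h.1 hz)) fun hc => h.2 fun s hs => ?_
  by_contra hsZ
  obtain ⟨U, hU, hUZ⟩ := hZ.isOpen_compl
  have hsU : (s : V) ∈ U := by
    have : s ∈ Subtype.val ⁻¹' U := by rw [hUZ]; exact hsZ
    exact this
  obtain ⟨F, hF, hF2⟩ := zar_basis hU s hsU
  refine hF (hc (x := F) (fun z hz => ?_) s hs)
  by_contra hne
  have : z ∈ Subtype.val ⁻¹' U := hF2 z hne
  rw [hUZ] at this
  exact this hz

theorem geom [CharZero K] (S : Set V)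
    (p : LTSeries (@TopologicalSpace.IrreducibleCloseds S (TopologicalSpace.induced Subtype.val (CV.zar K V)))) :
    ∃ (Ω : Type (max u v)) (_ : Field Ω) (_ : IsAlgClosed Ω) (_ : Algebra K Ω)
      (ξ : Module.Free.ChooseBasisIndex K V → Ω),
      (∀ F : MvPolynomial (Module.Free.ChooseBasisIndex K V) K, (∀ s ∈ S, CV.evalP K V F s = 0) → MvPolynomial.aeval ξ F = 0) ∧
      ∃ (J : Type) (_ : Fintype J) (D : J → Derivation K Ω Ω), Fintype.card J = p.length ∧
        ∀ a : J → Ω, (∀ i, ∑ j, a j * D j (ξ i) = 0) → a = 0 := by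
  classical
  letI : TopologicalSpace S := TopologicalSpace.induced Subtype.val (CV.zar K V)
  let Q : Fin (p.length + 1) → Ideal (MvPolynomial (Module.Free.ChooseBasisIndex K V) K) :=
    fun i => van (K := K) ((p i.rev : TopologicalSpace.IrreducibleCloseds S) : Set S)
  have hQ : ∀ i, (Q i).IsPrime := fun i => van_prime _ (p i.rev).isIrreducible
  obtain ⟨J, hJ, t, hc, ht⟩ := algInd_chain (K := K) p.length Q hQ (fun i => by
    apply van_lt _ _ (p _).isClosed
    have : p i.succ.rev < p i.castSucc.rev := p.strictMono (by simp [Fin.lt_def, Fin.rev]; omega)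
    exact this)
  haveI := hQ 0
  let A := MvPolynomial (Module.Free.ChooseBasisIndex K V) K ⧸ Q 0
  let Ω := AlgebraicClosure (FractionRing A)
  have hinj : Function.Injective (algebraMap A Ω) := by
    rw [IsScalarTower.algebraMap_eq A (FractionRing A) Ω]
    exact (algebraMap (FractionRing A) Ω).injective.comp (IsFractionRing.injective A (FractionRing A))
  let ψ : MvPolynomial (Module.Free.ChooseBasisIndex K V) K →ₐ[K] Ω :=
    (IsScalarTower.toAlgHom K A Ω).comp (Ideal.Quotient.mkₐ K (Q 0))
  have ht' : AlgebraicIndependent K (fun j => ψ (t j)) :=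
    ht.map' (f := IsScalarTower.toAlgHom K A Ω) hinj
  have hψ : ∀ F, MvPolynomial.aeval (fun i => ψ (MvPolynomial.X i)) F = ψ F := by
    intro F
    have : MvPolynomial.aeval (fun i => ψ (MvPolynomial.X i)) = ψ := by
      apply MvPolynomial.algHom_ext; intro i; simp
    rw [this]
  obtain ⟨D, hD⟩ := exists_der (fun j => ψ (t j)) ht'
  refine ⟨Ω, inferInstance, inferInstance, inferInstance, fun i => ψ (MvPolynomial.X i), ?_, J, hJ, D, hc, ?_⟩
  · intro F hF
    rw [hψ]
    have : F ∈ Q 0 := fun z _ => hF z z.2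
    have h0 : Ideal.Quotient.mkₐ K (Q 0) F = 0 := Ideal.Quotient.eq_zero_iff_mem.2 this
    simp only [ψ, AlgHom.comp_apply, h0, map_zero]
  · intro a ha
    let E : Derivation K Ω Ω := ∑ j, a j • D j
    have hE : ∀ w, E w = ∑ j, a j * D j w := by
      intro w
      have h := congrFun (map_sum (Derivation.coeFnAddMonoidHom : Derivation K Ω Ω →+ Ω → Ω)
        (fun j => a j • D j) Finset.univ) w
      rw [Finset.sum_apply] at h
      exact h
    have h0 : ∀ F, E (ψ F) = 0 := by
      intro F
      induction F using MvPolynomial.induction_on with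
      | C c =>
        have : ψ (MvPolynomial.C c) = algebraMap K Ω c := ψ.commutes c
        rw [this, Derivation.map_algebraMap]
      | add F F' h h' => rw [map_add, map_add, h, h', add_zero]
      | mul_X F i h =>
        rw [map_mul, Derivation.leibniz, h, hE, ha i]; simp
    funext j
    have := h0 (t j)
    rw [hE] at this
    simpa [hD] using this

lemma dimSet_le [CharZero K] (S : Set V) (c n : ℕ)
    (h : ∀ p : LTSeries (@TopologicalSpace.IrreducibleCloseds S (TopologicalSpace.induced Subtype.val (CV.zar K V))),
      p.length + c ≤ n) : CV.dimSet K V S + (c : WithBot ℕ∞) ≤ (((n : ℕ) : ℕ∞) : WithBot ℕ∞) := by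
  letI : TopologicalSpace S := TopologicalSpace.induced Subtype.val (CV.zar K V)
  change Order.krullDim (TopologicalSpace.IrreducibleCloseds S) + _ ≤ _
  rcases isEmpty_or_nonempty (TopologicalSpace.IrreducibleCloseds S) with he | hne
  · rw [Order.krullDim_eq_bot]; simp
  · have h1 : Order.krullDim (TopologicalSpace.IrreducibleCloseds S) ≤ ((n - c : ℕ) : WithBot ℕ∞) := by
      refine iSup_le fun p => ?_
      have := h p
      exact_mod_cast (by omega : p.length ≤ n - c)
    have h2 : c ≤ n := by
      obtain ⟨x⟩ := hne
      have := h (RelSeries.singleton _ x)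
      omega
    calc _ ≤ ((n - c : ℕ) : WithBot ℕ∞) + (c : WithBot ℕ∞) := by gcongr
      _ = ((n - c + c : ℕ) : WithBot ℕ∞) := by push_cast; rfl
      _ = ((n : ℕ) : WithBot ℕ∞) := by rw [Nat.sub_add_cancel h2]
      _ ≤ _ := le_of_eq rfl
end
end CVP

namespace CVP
open LieAlgebra Module
open scoped TensorProduct

section
variable {F : Type*} [Field F] {m n : Type*} [Fintype m] [Fintype n]

lemma exists_cols (M : Matrix m n F) {r : ℕ} (h : r ≤ M.rank) :
    ∃ e : Fin r → n, LinearIndependent F (fun i => M.col (e i)) := by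
  rw [Matrix.rank_eq_finrank_span_cols] at h
  obtain ⟨f, hf, -, hl⟩ := Submodule.exists_fun_fin_finrank_span_eq F (Set.range M.col)
  choose e he using hf
  refine ⟨fun i => e (Fin.castLE h i), ?_⟩
  have : (fun i => M.col (e (Fin.castLE h i))) = fun i => f (Fin.castLE h i) := by
    ext1 i; exact he _
  rw [this]
  exact hl.comp _ (Fin.castLE_injective h)

lemma exists_minor (M : Matrix m n F) {r : ℕ} (h : r ≤ M.rank) :
    ∃ (f : Fin r → m) (e : Fin r → n), (M.submatrix f e).det ≠ 0 := by
  obtain ⟨e, he⟩ := exists_cols M h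
  have h1 : (M.submatrix id e).rank = r := by
    have : LinearIndependent F (M.submatrix id e).col := he
    rw [← Matrix.rank_transpose, this.rank_matrix, Fintype.card_fin]
  obtain ⟨f, hf⟩ := exists_cols (M.submatrix id e).transpose (r := r) (by rw [Matrix.rank_transpose, h1])
  refine ⟨f, e, ?_⟩
  have h2 : LinearIndependent F (M.submatrix f e).row := hf
  rw [Matrix.linearIndependent_rows_iff_isUnit, Matrix.isUnit_iff_isUnit_det] at h2
  exact h2.ne_zero

lemma minor_zero (M : Matrix m n F) {r : ℕ} (h : M.rank < r) (f : Fin r → m) (e : Fin r → n) :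
    (M.submatrix f e).det = 0 := by
  by_contra hc
  have h1 := Matrix.rank_of_isUnit (M.submatrix f e) (by
    rw [Matrix.isUnit_iff_isUnit_det]; exact isUnit_iff_ne_zero.2 hc)
  rw [Fintype.card_fin] at h1
  have := M.rank_submatrix_le f e
  omega
end

section
variable {K : Type*} [Field K]
  {q : Type*} [LieRing q] [LieAlgebra K q] [FiniteDimensional K q]
  {L : Type*} [Field L] [Algebra K L]

lemma killing_tmul (a b : L) (u v : q) : killingForm L (L ⊗[K] q) (a ⊗ₜ u) (b ⊗ₜ v) =
    (a * b) * algebraMap K L (killingForm K q u v) := by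
  have := LieModule.traceForm_baseChange (R := K) (L := q) (M := q) L
  have h2 : killingForm L (L ⊗[K] q) = (killingForm K q).baseChange L := this
  rw [h2, LinearMap.BilinForm.baseChange_tmul, Algebra.smul_def, mul_comm]

lemma isKilling_bc [IsKilling K q] : IsKilling L (L ⊗[K] q) := by
  classical
  constructor
  rw [eq_bot_iff]
  intro z hz
  rw [LieIdeal.mem_killingCompl] at hz
  let c := Module.finBasis K q
  have hnd : LinearMap.BilinForm.Nondegenerate (killingForm K q) := IsKilling.killingForm_nondegenerate K q
  let d := LinearMap.BilinForm.dualBasis (killingForm K q) hnd c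
  let B := Algebra.TensorProduct.basis L c
  have h1 : ∀ j, B.repr z j = 0 := by
    intro j
    have h2 := hz (1 ⊗ₜ d j) trivial
    rw [← B.sum_repr z, map_sum] at h2
    simp only [map_smul, B, Algebra.TensorProduct.basis_apply, killing_tmul] at h2
    have h3 : ∀ i, killingForm K q (d j) (c i) = if i = j then 1 else 0 := fun i => by
      rw [LinearMap.BilinForm.apply_dualBasis_left]
    simpa [h3] using h2
  have : z = 0 := B.repr.injective (by ext j; simp [h1])
  rw [this]; simp

/-- derivation of the coefficients -/
def coefD (δ : Derivation K L L) (q : Type*) [LieRing q] [LieAlgebra K q] : L ⊗[K] q →+ L ⊗[K] q :=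
  ((δ : L →ₗ[K] L).rTensor q).toAddMonoidHom

lemma coefD_tmul (δ : Derivation K L L) (a : L) (u : q) : coefD δ q (a ⊗ₜ u) = δ a ⊗ₜ u := rfl

lemma coefD_isSD (δ : Derivation K L L) : IsSD (L := L) (δ.restrictScalars ℤ) (coefD δ q) where
  lie a b := by
    induction a using TensorProduct.induction_on with
    | zero => simp
    | add a a' h h' => rw [add_lie, map_add, h, h', map_add, add_lie, add_lie]; abel
    | tmul a u =>
      induction b using TensorProduct.induction_on with
      | zero => simp
      | add b b' h h' => rw [lie_add, map_add, h, h', map_add, lie_add, lie_add]; abel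
      | tmul b v =>
        simp only [LieAlgebra.ExtendScalars.bracket_tmul, coefD_tmul, Derivation.leibniz, smul_eq_mul,
          TensorProduct.add_tmul]
        rw [add_comm, mul_comm b]
  smul c v := by
    induction v using TensorProduct.induction_on with
    | zero => simp
    | add a a' h h' => rw [smul_add, map_add, h, h', map_add, smul_add, smul_add]; abel
    | tmul a u =>
      simp only [TensorProduct.smul_tmul', coefD_tmul, smul_eq_mul, Derivation.leibniz, TensorProduct.add_tmul]
      rw [add_comm, mul_comm a]; rfl
  kap a b := by
    induction a using TensorProduct.induction_on with
    | zero => simp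
    | add a a' h h' => simp only [map_add, LinearMap.add_apply, ← h, ← h']; abel
    | tmul a u =>
      induction b using TensorProduct.induction_on with
      | zero => simp
      | add b b' h h' => simp only [map_add, LinearMap.add_apply, ← h, ← h']; abel
      | tmul b v =>
        rw [coefD_tmul, coefD_tmul, killing_tmul, killing_tmul, killing_tmul]
        change _ = δ _
        rw [Derivation.leibniz, Derivation.map_algebraMap, Derivation.leibniz]
        simp only [smul_eq_mul]; ring
end
end CVP

namespace CVP
open LieAlgebra Module
open scoped TensorProduct

section
variable {K : Type*} [Field K]
  {q : Type*} [LieRing q] [LieAlgebra K q] [FiniteDimensional K q]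
  {G : Type*} [LieRing G] [LieAlgebra K G] [FiniteDimensional K G]

lemma ker_le_cartan (π : G →ₗ⁅K⁆ q) (hk : ∀ x, π x = 0 → ∀ y : G, ⁅x, y⁆ = 0)
    (t : LieSubalgebra K G) [ht : t.IsCartanSubalgebra] {x : G} (hx : π x = 0) : x ∈ t := by
  rw [← ht.self_normalizing, LieSubalgebra.mem_normalizer_iff]
  intro y _
  rw [hk x hx y]; exact t.zero_mem

lemma cartan_map (π : G →ₗ⁅K⁆ q) (hs : Function.Surjective π)
    (hk : ∀ x, π x = 0 → ∀ y : G, ⁅x, y⁆ = 0)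
    (t : LieSubalgebra K G) [ht : t.IsCartanSubalgebra] : (t.map π).IsCartanSubalgebra := by
  constructor
  · let f : t →ₗ⁅K⁆ t.map π :=
      { toFun := fun x => ⟨π x, (x : G), x.2, rfl⟩
        map_add' := fun x y => Subtype.ext (map_add π (x : G) y)
        map_smul' := fun c x => Subtype.ext (map_smul π c (x : G))
        map_lie' := fun {x y} => Subtype.ext (LieHom.map_lie π (x : G) y) }
    have hf : Function.Surjective f := by
      rintro ⟨_, x, hx, rfl⟩
      exact ⟨⟨x, hx⟩, rfl⟩
    haveI := ht.nilpotent
    exact hf.lieAlgebra_isNilpotent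
  · apply le_antisymm _ (LieSubalgebra.le_normalizer _)
    intro w hw
    obtain ⟨u, rfl⟩ := hs w
    rw [LieSubalgebra.mem_normalizer_iff] at hw
    refine ⟨u, ?_, rfl⟩
    have : u ∈ t.normalizer := by
      rw [LieSubalgebra.mem_normalizer_iff]
      intro y hy
      obtain ⟨v, hv, hv2⟩ := hw (π y) ⟨y, hy, rfl⟩
      have hv3 : π v = ⁅π u, π y⁆ := hv2
      rw [← LieHom.map_lie] at hv3
      have h0 : π (⁅u, y⁆ - v) = 0 := by rw [map_sub, hv3, sub_self]
      have h1 := ker_le_cartan π hk t h0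
      have h2 := t.add_mem h1 hv
      rwa [sub_add_cancel] at h2
    rwa [ht.self_normalizing] at this

lemma finrank_cartan (π : G →ₗ⁅K⁆ q) (hs : Function.Surjective π)
    (hk : ∀ x, π x = 0 → ∀ y : G, ⁅x, y⁆ = 0)
    (t : LieSubalgebra K G) [ht : t.IsCartanSubalgebra] :
    finrank K t + finrank K q = finrank K ↥(t.map π) + finrank K G := by
  have h1 := LinearMap.finrank_range_add_finrank_ker (π : G →ₗ[K] q)
  have h2 := LinearMap.finrank_range_add_finrank_ker ((π : G →ₗ[K] q).domRestrict t.toSubmodule)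
  rw [LinearMap.range_eq_top.2 hs, finrank_top] at h1
  have h3 : LinearMap.range ((π : G →ₗ[K] q).domRestrict t.toSubmodule) = (t.map π).toSubmodule := by
    ext w
    constructor
    · rintro ⟨x, rfl⟩; exact ⟨x, x.2, rfl⟩
    · rintro ⟨x, hx, rfl⟩; exact ⟨⟨x, hx⟩, rfl⟩
  have h4 : finrank K ↥(LinearMap.ker ((π : G →ₗ[K] q).domRestrict t.toSubmodule)) =
      finrank K ↥(LinearMap.ker (π : G →ₗ[K] q)) := by
    have h5 : (LinearMap.ker ((π : G →ₗ[K] q).domRestrict t.toSubmodule)).map t.toSubmodule.subtype =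
        LinearMap.ker (π : G →ₗ[K] q) := by
      ext w
      constructor
      · rintro ⟨x, hx, rfl⟩; exact hx
      · intro hw
        exact ⟨⟨w, ker_le_cartan π hk t (LinearMap.mem_ker.1 hw)⟩, hw, rfl⟩
    rw [← h5]
    exact (Submodule.equivSubtypeMap _ _).finrank_eq
  rw [h3, h4] at h2
  change finrank K ↥(t.map π) + _ = finrank K t at h2
  omega

/-- bilinear polynomial -/
def bil (φ : G →ₗ[K] K) : MvPolynomial (Module.Free.ChooseBasisIndex K (G × G)) K :=
  ∑ i, ∑ j, MvPolynomial.C (φ ⁅(Module.Free.chooseBasis K (G × G) i).1, (Module.Free.chooseBasis K (G × G) j).2⁆) *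
    (MvPolynomial.X i * MvPolynomial.X j)

lemma fst_repr (z : G × G) : ∑ i, CV.coordFn K (G × G) z i • (Module.Free.chooseBasis K (G × G) i).1 = z.1 := by
  conv_rhs => rw [← (Module.Free.chooseBasis K (G × G)).sum_repr z]
  rw [Prod.fst_sum]; rfl

lemma snd_repr (z : G × G) : ∑ i, CV.coordFn K (G × G) z i • (Module.Free.chooseBasis K (G × G) i).2 = z.2 := by
  conv_rhs => rw [← (Module.Free.chooseBasis K (G × G)).sum_repr z]
  rw [Prod.snd_sum]; rfl

lemma suml {ι : Type*} [Fintype ι] (f : ι → G) (y : G) : ⁅∑ i, f i, y⁆ = ∑ i, ⁅f i, y⁆ := sum_lie ..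
lemma lsum {ι : Type*} [Fintype ι] (f : ι → G) (y : G) : ⁅y, ∑ i, f i⁆ = ∑ i, ⁅y, f i⁆ := lie_sum ..

lemma evalP_bil (φ : G →ₗ[K] K) (z : G × G) : CV.evalP K (G × G) (bil φ) z = φ ⁅z.1, z.2⁆ := by
  conv_rhs => rw [← fst_repr (K := K) z, ← snd_repr (K := K) z, suml, map_sum]
  simp only [CV.evalP, bil, map_sum, map_mul, MvPolynomial.aeval_C, MvPolynomial.aeval_X, suml,
    lsum, lie_smul, smul_lie, map_smul, smul_eq_mul, Algebra.algebraMap_self, RingHom.id_apply]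
  refine Finset.sum_congr rfl fun i _ => ?_
  exact Finset.sum_congr rfl fun j _ => by ring

/-- the differential of the bracket -/
def TT (z : G × G) : G × G →ₗ[K] G :=
  -(ad K G z.2 : G →ₗ[K] G) ∘ₗ LinearMap.fst K G G + (ad K G z.1 : G →ₗ[K] G) ∘ₗ LinearMap.snd K G G

lemma TT_apply (z w : G × G) : TT (K := K) z w = ⁅w.1, z.2⁆ + ⁅z.1, w.2⁆ := by
  simp [TT]

lemma diffAt_bil (φ : G →ₗ[K] K) (z w : G × G) : CV.diffAt K (G × G) (bil φ) z w = φ (TT (K := K) z w) := by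
  classical
  have : CV.diffAt K (G × G) (bil φ) z = φ ∘ₗ TT (K := K) z := by
    apply (Module.Free.chooseBasis K (G × G)).ext
    intro l
    rw [CV.diffAt, Basis.constr_basis, LinearMap.comp_apply, TT_apply, map_add]
    conv_rhs => rw [← fst_repr (K := K) z, ← snd_repr (K := K) z]
    simp only [CV.evalP, bil, map_sum, MvPolynomial.pderiv_mul, MvPolynomial.pderiv_C, MvPolynomial.pderiv_X, map_mul, map_add,
      MvPolynomial.aeval_C, MvPolynomial.aeval_X, suml,
      lsum, lie_smul, smul_lie, map_smul, smul_eq_mul, Algebra.algebraMap_self, RingHom.id_apply]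
    simp only [zero_mul, map_zero, zero_add, mul_add, Finset.sum_add_distrib, Pi.single_apply]
    congr 1
    · rw [Finset.sum_eq_single l]
      · refine Finset.sum_congr rfl fun j _ => by simp; ring
      · intro i _ hi
        refine Finset.sum_eq_zero fun j _ => by simp [Ne.symm hi, hi]
      · simp
    · refine Finset.sum_congr rfl fun i _ => ?_
      rw [Finset.sum_eq_single l]
      · simp; ring
      · intro j _ hj
        simp [Ne.symm hj, hj]
      · simp
  rw [this]; rfl

lemma tangent_le (z : G × G) : CV.tangent K (G × G) (commSet K G) z ≤ LinearMap.ker (TT (K := K) z) := by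
  intro w hw
  rw [LinearMap.mem_ker]
  have h1 : ∀ φ : G →ₗ[K] K, φ (TT (K := K) z w) = 0 := by
    intro φ
    rw [← diffAt_bil]
    rw [CV.tangent] at hw
    simp only [Submodule.mem_iInf] at hw
    exact LinearMap.mem_ker.1 (hw (bil φ) (fun s hs => by
      rw [evalP_bil]
      have : ⁅s.1, s.2⁆ = 0 := hs
      rw [this, map_zero]))
  exact (Module.forall_dual_apply_eq_zero_iff K _).1 h1

lemma pt_rank [IsKilling K q] (π : G →ₗ⁅K⁆ q) (hs : Function.Surjective π) {ρ dt : ℕ}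
    (hd : dt + finrank K q = ρ + finrank K G) (z : G × G)
    (hz : finrank K G + dt < finrank K ↥(CV.tangent K (G × G) (commSet K G) z)) :
    ρ < finrank K ↥(LinearMap.ker (ad K q (π z.1) : q →ₗ[K] q) ⊓ LinearMap.ker (ad K q (π z.2) : q →ₗ[K] q)) := by
  have h1 := hz.trans_le (Submodule.finrank_mono (tangent_le (K := K) z))
  have h2 := LinearMap.finrank_range_add_finrank_ker (TT (K := K) z)
  rw [Module.finrank_prod] at h2
  let U : Submodule K q := (LinearMap.range (TT (K := K) z)).map (π : G →ₗ[K] q)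
  have h3 : finrank K U ≤ finrank K ↥(LinearMap.range (TT (K := K) z)) := Submodule.finrank_map_le _ _
  let f : q →ₗ[K] Module.Dual K U := (U.subtype.dualMap) ∘ₗ (killingForm K q : q →ₗ[K] q →ₗ[K] K)
  have h4 := LinearMap.finrank_range_add_finrank_ker f
  have h5 : finrank K ↥(LinearMap.range f) ≤ finrank K U := by
    rw [← Subspace.dual_finrank_eq (K := K) (V := U)]
    exact Submodule.finrank_le _
  have h6 : LinearMap.ker f ≤ LinearMap.ker (ad K q (π z.1) : q →ₗ[K] q) ⊓ LinearMap.ker (ad K q (π z.2) : q →ₗ[K] q) := by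
    intro w hw
    have hw' : ∀ u v : G, killingForm K q w (⁅π u, π z.2⁆ + ⁅π z.1, π v⁆) = 0 := by
      intro u v
      have h := LinearMap.congr_fun (LinearMap.mem_ker.1 hw)
        ⟨π (TT (K := K) z (u, v)), Submodule.mem_map_of_mem ⟨_, rfl⟩⟩
      have h' : killingForm K q w (π (TT (K := K) z (u, v))) = 0 := h
      rwa [TT_apply, map_add, LieHom.map_lie, LieHom.map_lie] at h'
    have hnd : ∀ a : q, (∀ b, killingForm K q a b = 0) → a = 0 :=
      (IsKilling.killingForm_nondegenerate K q).1
    constructor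
    · rw [SetLike.mem_coe, LinearMap.mem_ker, ad_apply]
      rw [← lie_skew, neg_eq_zero]
      apply hnd
      intro b
      obtain ⟨v, rfl⟩ := hs b
      have := hw' 0 v
      rw [map_zero, zero_lie, zero_add] at this
      rwa [LieModule.traceForm_apply_lie_apply]
    · rw [SetLike.mem_coe, LinearMap.mem_ker, ad_apply]
      rw [← lie_skew, neg_eq_zero]
      apply hnd
      intro b
      obtain ⟨v, rfl⟩ := hs b
      have := hw' v 0
      rw [map_zero, lie_zero, add_zero, ← lie_skew, map_neg, neg_eq_zero] at this
      rwa [LieModule.traceForm_apply_lie_apply]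
  have h7 := Submodule.finrank_mono h6
  omega
end
end CVP

namespace CVP
open LieAlgebra Module
open scoped TensorProduct

section
lemma rank_rows {F E ι : Type*} [Field F] [AddCommGroup E] [Module F E] [FiniteDimensional F E] [Fintype ι] [DecidableEq ι]
    (B : Basis ι F E) (f1 f2 : E →ₗ[F] E) :
    (Matrix.fromRows (LinearMap.toMatrix B B f1) (LinearMap.toMatrix B B f2)).rank +
      finrank F ↥(LinearMap.ker f1 ⊓ LinearMap.ker f2) = finrank F E := by
  have h1 := LinearMap.finrank_range_add_finrank_ker
    (Matrix.fromRows (LinearMap.toMatrix B B f1) (LinearMap.toMatrix B B f2)).mulVecLin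
  have h2 : LinearMap.ker (Matrix.fromRows (LinearMap.toMatrix B B f1) (LinearMap.toMatrix B B f2)).mulVecLin
      = (LinearMap.ker f1 ⊓ LinearMap.ker f2).map (B.equivFun : E →ₗ[F] (ι → F)) := by
    ext v
    obtain ⟨w, rfl⟩ := B.equivFun.surjective v
    have e1 : ∀ f : E →ₗ[F] E, (LinearMap.toMatrix B B f).mulVec (B.equivFun w) = 0 ↔ f w = 0 := by
      intro f
      have := LinearMap.toMatrix_mulVec_repr B B f w
      have h3 : (LinearMap.toMatrix B B f).mulVec (B.equivFun w) = B.equivFun (f w) := this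
      rw [h3, LinearEquiv.map_eq_zero_iff]
    rw [LinearMap.mem_ker, Matrix.mulVecLin_apply, Matrix.fromRows_mulVec]
    have e2 : ∀ a b : ι → F, Sum.elim a b = 0 ↔ a = 0 ∧ b = 0 := by
      intro a b
      constructor
      · intro h
        exact ⟨funext fun i => congrFun h (Sum.inl i), funext fun i => congrFun h (Sum.inr i)⟩
      · rintro ⟨rfl, rfl⟩; ext i; cases i <;> rfl
    rw [e2, e1, e1]
    constructor
    · intro h; exact ⟨w, h, rfl⟩
    · rintro ⟨w', h, hw⟩
      have : w' = w := B.equivFun.injective hw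
      rw [← this]; exact h
  rw [h2, LinearEquiv.finrank_map_eq, Module.finrank_fintype_fun_eq_card, ← Module.finrank_eq_card_basis B] at h1
  exact h1
end

section
variable {K : Type*} [Field K]
  {q : Type*} [LieRing q] [LieAlgebra K q] [FiniteDimensional K q]
  {G : Type*} [LieRing G] [LieAlgebra K G] [FiniteDimensional K G]
  {L : Type*} [Field L] [Algebra K L]

/-- the generic point map -/
def PhiM (L : Type*) [Field L] [Algebra K L] (π : G →ₗ⁅K⁆ q) :
    (Module.Free.ChooseBasisIndex K (G × G) → L) →ₗ[L] (L ⊗[K] q) × (L ⊗[K] q) :=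
  Fintype.linearCombination L (fun i => ((1 : L) ⊗ₜ[K] π (Module.Free.chooseBasis K (G × G) i).1,
    (1 : L) ⊗ₜ[K] π (Module.Free.chooseBasis K (G × G) i).2))

lemma PhiM_fst (π : G →ₗ⁅K⁆ q) (v) : (PhiM L π v).1 = ∑ i, v i ⊗ₜ[K] π (Module.Free.chooseBasis K (G × G) i).1 := by
  rw [PhiM, Fintype.linearCombination_apply, Prod.fst_sum]
  simp [TensorProduct.smul_tmul']

lemma PhiM_snd (π : G →ₗ⁅K⁆ q) (v) : (PhiM L π v).2 = ∑ i, v i ⊗ₜ[K] π (Module.Free.chooseBasis K (G × G) i).2 := by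
  rw [PhiM, Fintype.linearCombination_apply, Prod.snd_sum]
  simp [TensorProduct.smul_tmul']

lemma PhiM_coord (π : G →ₗ⁅K⁆ q) (a : L) (s : G × G) :
    PhiM L π (fun i => CV.coordFn K (G × G) s i • a) = (a ⊗ₜ π s.1, a ⊗ₜ π s.2) := by
  refine Prod.ext ?_ ?_
  · rw [PhiM_fst]
    simp only [TensorProduct.smul_tmul]
    rw [← TensorProduct.tmul_sum]
    simp only [← map_smul]
    rw [← map_sum, fst_repr]
  · rw [PhiM_snd]
    simp only [TensorProduct.smul_tmul]
    rw [← TensorProduct.tmul_sum]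
    simp only [← map_smul]
    rw [← map_sum, snd_repr]

lemma PhiM_surj (π : G →ₗ⁅K⁆ q) (hs : Function.Surjective π) : Function.Surjective (PhiM L π) := by
  rw [← LinearMap.range_eq_top, eq_top_iff]
  rintro ⟨P, P'⟩ -
  have h1 : ∀ P : L ⊗[K] q, (P, (0 : L ⊗[K] q)) ∈ LinearMap.range (PhiM L π) := by
    intro P
    induction P using TensorProduct.induction_on with
    | zero => exact Submodule.zero_mem _
    | add a b ha hb =>
      have := Submodule.add_mem _ ha hb
      rwa [Prod.mk_add_mk, add_zero] at this
    | tmul a w =>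
      obtain ⟨u, rfl⟩ := hs w
      exact ⟨_, (PhiM_coord π a (u, 0)).trans (by simp)⟩
  have h2 : ∀ P : L ⊗[K] q, ((0 : L ⊗[K] q), P) ∈ LinearMap.range (PhiM L π) := by
    intro P
    induction P using TensorProduct.induction_on with
    | zero => exact Submodule.zero_mem _
    | add a b ha hb =>
      have := Submodule.add_mem _ ha hb
      rwa [Prod.mk_add_mk, add_zero] at this
    | tmul a w =>
      obtain ⟨u, rfl⟩ := hs w
      exact ⟨_, (PhiM_coord π a (0, u)).trans (by simp)⟩
  have := Submodule.add_mem _ (h1 P) (h2 P')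
  rwa [Prod.mk_add_mk, add_zero, zero_add] at this

lemma PhiM_ker (π : G →ₗ⁅K⁆ q) (hs : Function.Surjective π) :
    finrank L ↥(LinearMap.ker (PhiM L π)) + 2 * finrank K q = 2 * finrank K G := by
  have h1 := LinearMap.finrank_range_add_finrank_ker (PhiM L π)
  rw [LinearMap.range_eq_top.2 (PhiM_surj π hs), finrank_top, Module.finrank_prod, Module.finrank_baseChange,
    Module.finrank_fintype_fun_eq_card, ← Module.finrank_eq_card_basis (Module.Free.chooseBasis K (G × G)),
    Module.finrank_prod] at h1
  omega

lemma coefD_PhiM (π : G →ₗ⁅K⁆ q) (δ : Derivation K L L) (ξ) :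
    (coefD δ q (PhiM L π ξ).1, coefD δ q (PhiM L π ξ).2) = PhiM L π (fun i => δ (ξ i)) := by
  refine Prod.ext ?_ ?_
  · rw [PhiM_fst, PhiM_fst, map_sum]; rfl
  · rw [PhiM_snd, PhiM_snd, map_sum]; rfl

/-- the space spanned by the derivatives of the generic point -/
def WW (π : G →ₗ⁅K⁆ q) {J : Type*} (D : J → Derivation K L L)
    (ξ : Module.Free.ChooseBasisIndex K (G × G) → L) : Submodule L ((L ⊗[K] q) × (L ⊗[K] q)) :=
  (Submodule.span L (Set.range fun j i => D j (ξ i))).map (PhiM L π)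

lemma WW_dim (π : G →ₗ⁅K⁆ q) (hs : Function.Surjective π) {J : Type*} [Fintype J] (D : J → Derivation K L L)
    (ξ : Module.Free.ChooseBasisIndex K (G × G) → L)
    (h : ∀ a : J → L, (∀ i, ∑ j, a j * D j (ξ i) = 0) → a = 0) :
    Fintype.card J + 2 * finrank K q ≤ finrank L ↥(WW π D ξ) + 2 * finrank K G := by
  have hli : LinearIndependent L (fun j i => D j (ξ i)) := by
    rw [Fintype.linearIndependent_iff]
    intro a ha
    refine congrFun (h a fun i => ?_)
    have := congrFun ha i
    simpa using this
  have h1 := finrank_span_eq_card hli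
  let X := Submodule.span L (Set.range fun j i => D j (ξ i))
  have h2 := LinearMap.finrank_range_add_finrank_ker ((PhiM L π).domRestrict X)
  have h3 : LinearMap.range ((PhiM L π).domRestrict X) = WW π D ξ := by
    ext w
    constructor
    · rintro ⟨x, rfl⟩; exact ⟨x, x.2, rfl⟩
    · rintro ⟨x, hx, rfl⟩; exact ⟨⟨x, hx⟩, rfl⟩
  have h4 : finrank L ↥(LinearMap.ker ((PhiM L π).domRestrict X)) ≤ finrank L ↥(LinearMap.ker (PhiM L π)) := by
    rw [(Submodule.equivSubtypeMap X (LinearMap.ker ((PhiM L π).domRestrict X))).finrank_eq]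
    apply Submodule.finrank_mono
    rintro _ ⟨x, hx, rfl⟩
    exact hx
  have h5 := PhiM_ker (L := L) π hs
  rw [h3] at h2
  have h6 : finrank L X = Fintype.card J := h1
  omega

lemma WW_WD [CharZero L] (π : G →ₗ⁅K⁆ q) {J : Type*} [Fintype J] (D : J → Derivation K L L)
    (ξ : Module.Free.ChooseBasisIndex K (G × G) → L) :
    WD (PhiM L π ξ).1 (PhiM L π ξ).2 (WW π D ξ) := by
  rintro _ ⟨v, hv, rfl⟩
  have : ∃ δ : Derivation K L L, v = fun i => δ (ξ i) := by
    induction hv using Submodule.span_induction with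
    | mem v h => obtain ⟨j, rfl⟩ := h; exact ⟨D j, rfl⟩
    | zero => exact ⟨0, rfl⟩
    | add a b _ _ ha hb =>
      obtain ⟨δ, rfl⟩ := ha
      obtain ⟨δ', rfl⟩ := hb
      exact ⟨δ + δ', rfl⟩
    | smul c a _ ha =>
      obtain ⟨δ, rfl⟩ := ha
      exact ⟨c • δ, rfl⟩
  obtain ⟨δ, rfl⟩ := this
  exact ⟨_, _, coefD_isSD δ, (coefD_PhiM π δ ξ).symm⟩

/-- linear polynomial -/
def lin (f : Module.Free.ChooseBasisIndex K (G × G) → K) : MvPolynomial (Module.Free.ChooseBasisIndex K (G × G)) K :=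
  ∑ i, MvPolynomial.X i * MvPolynomial.C (f i)

lemma repr_tmul {ι : Type*} (c : Basis ι K q) (u : q) (r : ι) (a : L) :
    (Algebra.TensorProduct.basis L c).repr (a ⊗ₜ u) r = a * algebraMap K L (c.repr u r) := by
  rw [Algebra.TensorProduct.basis_repr_tmul]; simp

/-- polynomial matrix -/
def PM {ι : Type*} (c : Basis ι K q) (π : G →ₗ⁅K⁆ q) :
    Matrix (ι ⊕ ι) ι (MvPolynomial (Module.Free.ChooseBasisIndex K (G × G)) K) :=
  Matrix.fromRows
    (Matrix.of fun r j => lin fun i => c.repr ⁅π (Module.Free.chooseBasis K (G × G) i).1, c j⁆ r)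
    (Matrix.of fun r j => lin fun i => c.repr ⁅π (Module.Free.chooseBasis K (G × G) i).2, c j⁆ r)

lemma PM_eval {ι : Type*} [Fintype ι] [DecidableEq ι] (c : Basis ι K q) (π : G →ₗ⁅K⁆ q) (s : G × G) :
    (PM c π).map (MvPolynomial.aeval (CV.coordFn K (G × G) s)) =
    Matrix.fromRows (LinearMap.toMatrix c c (ad K q (π s.1) : q →ₗ[K] q))
      (LinearMap.toMatrix c c (ad K q (π s.2) : q →ₗ[K] q)) := by
  ext r j
  rcases r with r | r
  · rw [Matrix.map_apply, PM, Matrix.fromRows_apply_inl, Matrix.fromRows_apply_inl, LinearMap.toMatrix_apply,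
      ad_apply]
    conv_rhs => rw [← fst_repr (K := K) s, map_sum, sum_lie, map_sum, Finsupp.finset_sum_apply]
    simp [lin]
  · rw [Matrix.map_apply, PM, Matrix.fromRows_apply_inr, Matrix.fromRows_apply_inr, LinearMap.toMatrix_apply,
      ad_apply]
    conv_rhs => rw [← snd_repr (K := K) s, map_sum, sum_lie, map_sum, Finsupp.finset_sum_apply]
    simp [lin]

lemma PM_aeval {ι : Type*} [Fintype ι] [DecidableEq ι] (c : Basis ι K q) (π : G →ₗ⁅K⁆ q)
    (ξ : Module.Free.ChooseBasisIndex K (G × G) → L) :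
    (PM c π).map (MvPolynomial.aeval ξ) =
    Matrix.fromRows (LinearMap.toMatrix (Algebra.TensorProduct.basis L c) (Algebra.TensorProduct.basis L c)
        (ad L (L ⊗[K] q) (PhiM L π ξ).1 : L ⊗[K] q →ₗ[L] L ⊗[K] q))
      (LinearMap.toMatrix (Algebra.TensorProduct.basis L c) (Algebra.TensorProduct.basis L c)
        (ad L (L ⊗[K] q) (PhiM L π ξ).2 : L ⊗[K] q →ₗ[L] L ⊗[K] q)) := by
  ext r j
  rcases r with r | r
  · rw [Matrix.map_apply, PM, Matrix.fromRows_apply_inl, Matrix.fromRows_apply_inl, LinearMap.toMatrix_apply,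
      ad_apply, PhiM_fst, sum_lie, map_sum, Finsupp.finset_sum_apply]
    simp only [Algebra.TensorProduct.basis_apply, LieAlgebra.ExtendScalars.bracket_tmul, repr_tmul]
    simp [lin]
  · rw [Matrix.map_apply, PM, Matrix.fromRows_apply_inr, Matrix.fromRows_apply_inr, LinearMap.toMatrix_apply,
      ad_apply, PhiM_snd, sum_lie, map_sum, Finsupp.finset_sum_apply]
    simp only [Algebra.TensorProduct.basis_apply, LieAlgebra.ExtendScalars.bracket_tmul, repr_tmul]
    simp [lin]

lemma gen_rank (π : G →ₗ⁅K⁆ q) (S : Set (G × G)) {ρ : ℕ}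
    (hS : ∀ s ∈ S, ρ < finrank K ↥(LinearMap.ker (ad K q (π s.1) : q →ₗ[K] q) ⊓ LinearMap.ker (ad K q (π s.2) : q →ₗ[K] q)))
    (ξ : Module.Free.ChooseBasisIndex K (G × G) → L)
    (hξ : ∀ F : MvPolynomial (Module.Free.ChooseBasisIndex K (G × G)) K, (∀ s ∈ S, CV.evalP K (G × G) F s = 0) →
      MvPolynomial.aeval ξ F = 0) :
    ρ < finrank L ↥(LinearMap.ker (ad L (L ⊗[K] q) (PhiM L π ξ).1 : L ⊗[K] q →ₗ[L] L ⊗[K] q) ⊓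
      LinearMap.ker (ad L (L ⊗[K] q) (PhiM L π ξ).2 : L ⊗[K] q →ₗ[L] L ⊗[K] q)) := by
  by_contra hc
  have h1 := rank_rows (Algebra.TensorProduct.basis L (Module.finBasis K q))
    (ad L (L ⊗[K] q) (PhiM L π ξ).1 : L ⊗[K] q →ₗ[L] L ⊗[K] q) (ad L (L ⊗[K] q) (PhiM L π ξ).2)
  rw [Module.finrank_baseChange, ← PM_aeval] at h1
  obtain ⟨f, e, hfe⟩ := exists_minor _ (r := finrank K q - ρ) (by omega :
    finrank K q - ρ ≤ ((PM (Module.finBasis K q) π).map (MvPolynomial.aeval ξ)).rank)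
  apply hfe
  have h2 := AlgHom.map_det (MvPolynomial.aeval ξ) ((PM (Module.finBasis K q) π).submatrix f e)
  refine (Eq.symm h2).trans (hξ _ fun s hs => ?_)
  have h3 := AlgHom.map_det (MvPolynomial.aeval (CV.coordFn K (G × G) s)) ((PM (Module.finBasis K q) π).submatrix f e)
  refine h3.trans ?_
  have h4 := rank_rows (Module.finBasis K q) (ad K q (π s.1) : q →ₗ[K] q) (ad K q (π s.2))
  rw [← PM_eval] at h4
  have h5 := hS s hs
  exact minor_zero ((PM (Module.finBasis K q) π).map (MvPolynomial.aeval (CV.coordFn K (G × G) s))) (by omega) f e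

lemma gen_comm (π : G →ₗ⁅K⁆ q) (S : Set (G × G)) (hS : ∀ s ∈ S, ⁅s.1, s.2⁆ = 0)
    (ξ : Module.Free.ChooseBasisIndex K (G × G) → L)
    (hξ : ∀ F : MvPolynomial (Module.Free.ChooseBasisIndex K (G × G)) K, (∀ s ∈ S, CV.evalP K (G × G) F s = 0) →
      MvPolynomial.aeval ξ F = 0) : ⁅(PhiM L π ξ).1, (PhiM L π ξ).2⁆ = 0 := by
  let c := Module.finBasis K q
  let B := Algebra.TensorProduct.basis L c
  apply B.repr.injective
  ext r
  have h := hξ (bil ((c.coord r) ∘ₗ (π : G →ₗ[K] q))) (fun s hs => by rw [evalP_bil, hS s hs, map_zero])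
  rw [PhiM_fst, PhiM_snd, sum_lie, map_sum, Finsupp.finset_sum_apply, map_zero, Finsupp.zero_apply, ← h, bil, map_sum]
  refine Finset.sum_congr rfl fun i _ => ?_
  rw [lie_sum, map_sum, Finsupp.finset_sum_apply, map_sum]
  refine Finset.sum_congr rfl fun j _ => ?_
  rw [LieAlgebra.ExtendScalars.bracket_tmul, repr_tmul]
  simp [mul_comm]
end
end CVP

namespace CVP
open LieAlgebra Module
open scoped TensorProduct

section
variable {K : Type*} [Field K] [IsAlgClosed K] [CharZero K]
  {q : Type*} [LieRing q] [LieAlgebra K q] [FiniteDimensional K q]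
  {G : Type*} [LieRing G] [LieAlgebra K G] [FiniteDimensional K G]

theorem core [IsKilling K q] (π : G →ₗ⁅K⁆ q) (hs : Function.Surjective π)
    (hk : ∀ x, π x = 0 → ∀ y : G, ⁅x, y⁆ = 0) (t : LieSubalgebra K G) [t.IsCartanSubalgebra] {c : ℕ}
    (hc : c = 2 ∨ (c = 3 ∧ ∀ (I : LieIdeal K G), IsSimple K I → ∀ [IsKilling K I] (t' : LieSubalgebra K I)
      [t'.IsCartanSubalgebra], lacety K I t' ≤ 2) ∨ (c = 4 ∧ ∀ (I : LieIdeal K G), IsSimple K I → ∀ [IsKilling K I] (t' : LieSubalgebra K I)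
      [t'.IsCartanSubalgebra], lacety K I t' ≤ 1)) :
    CV.dimSet K (G × G) (Csing K G t) + (c : WithBot ℕ∞) ≤ (((finrank K G + finrank K t : ℕ) : ℕ∞) : WithBot ℕ∞) := by
  apply dimSet_le
  intro p
  obtain ⟨L, _, _, _, ξ, hξ, J, _, D, hJ, hD⟩ := geom _ p
  haveI : CharZero L := charZero_of_injective_algebraMap (algebraMap K L).injective
  haveI : IsKilling L (L ⊗[K] q) := isKilling_bc
  haveI := cartan_map π hs hk t
  have hd := finrank_cartan π hs hk t
  have hZ := gen_rank π (Csing K G t) (fun s hs' => pt_rank π hs hd s hs'.2) ξ hξ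
  have hcomm := gen_comm π (Csing K G t) (fun s hs' => hs'.1) ξ hξ
  have hρ : ∀ (H : LieSubalgebra L (L ⊗[K] q)) [H.IsCartanSubalgebra], finrank L H = finrank K ↥(t.map π) := by
    intro H _
    rw [cartan_rank H, rank_bc, cartan_rank (t.map π)]
  have hL : Lace L (L ⊗[K] q) c := by
    rcases hc with h | ⟨h, h'⟩ | ⟨h, h'⟩
    · exact Or.inl h
    · exact Or.inr (Or.inl ⟨h, fun H _ => PB_of π hs hk h' H⟩)
    · exact Or.inr (Or.inr ⟨h, fun H _ => PB_of π hs hk h' H⟩)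
  have h1 := thmK hcomm (WW_WD π D ξ) hρ hZ hL
  have h2 := WW_dim π hs D ξ hD
  rw [Module.finrank_baseChange] at h1
  omega

/-- the quotient map -/
def qm (I : LieIdeal K G) : G →ₗ⁅K⁆ G ⧸ I :=
  { (LieSubmodule.Quotient.mk' I : G →ₗ[K] G ⧸ I) with
    map_lie' := fun {x y} => LieSubmodule.Quotient.mk_bracket _ x y }

lemma qm_surj (I : LieIdeal K G) : Function.Surjective (qm I) := LieSubmodule.Quotient.surjective_mk' I
lemma qm_zero (I : LieIdeal K G) {x : G} : qm I x = 0 ↔ x ∈ I := LieSubmodule.Quotient.mk_eq_zero I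

lemma quot_killing (hred : LieAlgebra.radical K G = LieAlgebra.center K G) :
    IsKilling K (G ⧸ LieAlgebra.center K G) := by
  haveI : HasTrivialRadical K (G ⧸ LieAlgebra.center K G) := by
    rw [hasTrivialRadical_iff_no_abelian_ideals]
    intro I hI
    let J : LieIdeal K G := I.comap (qm (LieAlgebra.center K G))
    have hJ : ∀ x, x ∈ J ↔ qm (LieAlgebra.center K G) x ∈ I := fun x => LieIdeal.mem_comap
    have h1 : ⁅J, J⁆ ≤ LieAlgebra.center K G := by
      rw [LieSubmodule.lieIdeal_oper_eq_span, LieSubmodule.lieSpan_le]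
      rintro _ ⟨⟨a, ha⟩, ⟨b, hb⟩, rfl⟩
      have h2 : qm (LieAlgebra.center K G) ⁅a, b⁆ = 0 := by
        rw [LieHom.map_lie]
        have := hI.trivial ⟨_, (hJ a).1 ha⟩ ⟨_, (hJ b).1 hb⟩
        exact congrArg Subtype.val this
      exact (qm_zero _).1 h2
    have h3 : ⁅⁅J, J⁆, ⁅J, J⁆⁆ = ⊥ := by
      rw [eq_bot_iff, LieSubmodule.lieIdeal_oper_eq_span, LieSubmodule.lieSpan_le]
      rintro _ ⟨⟨a, ha⟩, ⟨b, hb⟩, rfl⟩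
      have h4 : ⁅a, b⁆ = 0 := (LieModule.mem_maxTrivSubmodule K G G b).1 (h1 hb) a
      change ⁅a, b⁆ ∈ _
      rw [h4]; exact Submodule.zero_mem _
    have h5 : IsSolvable J := by
      rw [isSolvable_iff K]
      refine ⟨2, ?_⟩
      rw [LieIdeal.derivedSeries_eq_bot_iff]
      exact h3
    have h6 : J ≤ LieAlgebra.center K G := by
      rw [← hred]; exact (LieIdeal.solvable_iff_le_radical K G J).1 h5
    rw [eq_bot_iff]
    intro w hw
    obtain ⟨x, rfl⟩ := qm_surj (LieAlgebra.center K G) w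
    have h7 := h6 ((hJ x).2 hw)
    rw [(qm_zero _).2 h7]; exact Submodule.zero_mem _
  infer_instance

theorem final (hred : LieAlgebra.radical K G = LieAlgebra.center K G)
    (t : LieSubalgebra K G) [t.IsCartanSubalgebra] {c : ℕ}
    (hc : c = 2 ∨ (c = 3 ∧ ∀ (I : LieIdeal K G), IsSimple K I → ∀ [IsKilling K I] (t' : LieSubalgebra K I)
      [t'.IsCartanSubalgebra], lacety K I t' ≤ 2) ∨ (c = 4 ∧ ∀ (I : LieIdeal K G), IsSimple K I → ∀ [IsKilling K I] (t' : LieSubalgebra K I)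
      [t'.IsCartanSubalgebra], lacety K I t' ≤ 1)) :
    CV.dimSet K (G × G) (Csing K G t) + (c : WithBot ℕ∞) ≤ (((finrank K G + finrank K t : ℕ) : ℕ∞) : WithBot ℕ∞) := by
  haveI := quot_killing hred
  refine core (qm (LieAlgebra.center K G)) (qm_surj _) (fun x hx y => ?_) t hc
  have h := (LieModule.mem_maxTrivSubmodule K G G x).1 ((qm_zero _).1 hx) y
  rw [← lie_skew, h, neg_zero]
end
end CVP

/-- For every noncommutative reductive Lie algebra `g`:
(i) `codim_C C^sing ≥ 2`;
(ii) if `g` contains no simple ideal of type `G₂` (i.e. every simple ideal has lacing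
number at most `2`), then `codim_C C^sing ≥ 3`;
(iii) if `g` is simply laced (every simple ideal has lacing number `1`), then
`codim_C C^sing ≥ 4`. -/
theorem singular_codim_bounds
    (hred : LieAlgebra.radical k g = LieAlgebra.center k g) (hnc : ¬IsLieAbelian g)
    (t : LieSubalgebra k g) (ht : t.IsCartanSubalgebra) :
    (CV.dimSet k (g × g) (Csing k g t) + 2
        ≤ (((Module.finrank k g + Module.finrank k ↥t : ℕ) : ℕ∞) : WithBot ℕ∞)) ∧
    ((∀ (I : LieIdeal k g), LieAlgebra.IsSimple k ↥I →
        ∀ [LieAlgebra.IsKilling k ↥I] (t' : LieSubalgebra k ↥I) [t'.IsCartanSubalgebra],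
          lacety k ↥I t' ≤ 2) →
      CV.dimSet k (g × g) (Csing k g t) + 3
        ≤ (((Module.finrank k g + Module.finrank k ↥t : ℕ) : ℕ∞) : WithBot ℕ∞)) ∧
    ((∀ (I : LieIdeal k g), LieAlgebra.IsSimple k ↥I →
        ∀ [LieAlgebra.IsKilling k ↥I] (t' : LieSubalgebra k ↥I) [t'.IsCartanSubalgebra],
          lacety k ↥I t' = 1) →
      CV.dimSet k (g × g) (Csing k g t) + 4
        ≤ (((Module.finrank k g + Module.finrank k ↥t : ℕ) : ℕ∞) : WithBot ℕ∞)) := by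
  have H := fun c : ℕ => CVP.final (K := k) (G := g) hred t (c := c)
  have e2 : ((2 : ℕ) : WithBot ℕ∞) = 2 := rfl
  have e3 : ((3 : ℕ) : WithBot ℕ∞) = 3 := rfl
  have e4 : ((4 : ℕ) : WithBot ℕ∞) = 4 := rfl
  refine ⟨?_, fun h => ?_, fun h => ?_⟩
  · rw [← e2]; exact H 2 (Or.inl rfl)
  · rw [← e3]; exact H 3 (Or.inr (Or.inl ⟨rfl, h⟩))
  · rw [← e4]; exact H 4 (Or.inr (Or.inr ⟨rfl, fun I hI _ t' _ => (h I hI t').le⟩))
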